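/- arXiv:1808.04466 — 3 statements merged into one kernel-verified Lean document; each statement's English description precedes it below -/
import Mathlib

section
/- Let E be a finite directed graph (E⁰ and E¹ both finite) and K a field, and let L = L_K(E) be the (unital) Leavitt path algebra. Then no cycle in E has an exit if and only if L is a Baer ring, i.e., for every subset X of L the left annihilator {a ∈ L : ax = 0 for all x ∈ X} equals Le for some idempotent e ∈ L. -/
/-- Generators for the Leavitt path algebra of a directed graph: one generator for each
vertex `v`, each edge `e`, and each ghost edge `e*`. -/
inductive LPAGen (V E : Type) : Type
  | vertex : V → LPAGen V E
  | edge : E → LPAGen V E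
  | ghost : E → LPAGen V E

/-- The defining relations of the (unital) Leavitt path algebra of a directed graph
`(V, E, s, r)` with finitely many vertices, imposed on the free unital `K`-algebra on the
generators; the relation `unit` makes the identity equal to the sum of the vertices. -/
inductive LPARel (K : Type) [Field K] (V E : Type) [Fintype V] (s r : E → V) :
    FreeAlgebra K (LPAGen V E) → FreeAlgebra K (LPAGen V E) → Prop
  | vertex_orth (v w : V) (h : v ≠ w) :
      LPARel K V E s r (FreeAlgebra.ι K (LPAGen.vertex v) * FreeAlgebra.ι K (LPAGen.vertex w)) 0
  | vertex_idem (v : V) :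
      LPARel K V E s r (FreeAlgebra.ι K (LPAGen.vertex v) * FreeAlgebra.ι K (LPAGen.vertex v))
        (FreeAlgebra.ι K (LPAGen.vertex v))
  | edge_src (e : E) :
      LPARel K V E s r (FreeAlgebra.ι K (LPAGen.vertex (s e)) * FreeAlgebra.ι K (LPAGen.edge e))
        (FreeAlgebra.ι K (LPAGen.edge e))
  | edge_rng (e : E) :
      LPARel K V E s r (FreeAlgebra.ι K (LPAGen.edge e) * FreeAlgebra.ι K (LPAGen.vertex (r e)))
        (FreeAlgebra.ι K (LPAGen.edge e))
  | ghost_rng (e : E) :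
      LPARel K V E s r (FreeAlgebra.ι K (LPAGen.vertex (r e)) * FreeAlgebra.ι K (LPAGen.ghost e))
        (FreeAlgebra.ι K (LPAGen.ghost e))
  | ghost_src (e : E) :
      LPARel K V E s r (FreeAlgebra.ι K (LPAGen.ghost e) * FreeAlgebra.ι K (LPAGen.vertex (s e)))
        (FreeAlgebra.ι K (LPAGen.ghost e))
  | ck1_distinct (e f : E) (h : e ≠ f) :
      LPARel K V E s r (FreeAlgebra.ι K (LPAGen.ghost e) * FreeAlgebra.ι K (LPAGen.edge f)) 0
  | ck1_same (e : E) :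
      LPARel K V E s r (FreeAlgebra.ι K (LPAGen.ghost e) * FreeAlgebra.ι K (LPAGen.edge e))
        (FreeAlgebra.ι K (LPAGen.vertex (r e)))
  | ck2 (v : V) (h : {e : E | s e = v}.Finite) (hne : {e : E | s e = v}.Nonempty) :
      LPARel K V E s r (FreeAlgebra.ι K (LPAGen.vertex v))
        (∑ e ∈ h.toFinset, FreeAlgebra.ι K (LPAGen.edge e) * FreeAlgebra.ι K (LPAGen.ghost e))
  | unit :
      LPARel K V E s r 1 (∑ v : V, FreeAlgebra.ι K (LPAGen.vertex v))

/-- The unital Leavitt path algebra `L_K(E)` of a directed graph with finitely many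
vertices, as the quotient of the free unital `K`-algebra on the generators by the
defining relations. -/
abbrev LeavittPathAlgebra (K : Type) [Field K] (V E : Type) [Fintype V] (s r : E → V) :=
  RingQuot (LPARel K V E s r)

/-- A list of edges is a path chain if the range of each edge is the source of the next. -/
def IsPathChain {V E : Type} (s r : E → V) (es : List E) : Prop :=
  ∀ (i : ℕ) (h : i + 1 < es.length), r (es[i]'(by omega)) = s (es[i+1]'h)

/-- A nonempty list of edges is a cycle if it is a closed path chain whose sources are
pairwise distinct. -/
def IsCycle {V E : Type} (s r : E → V) (es : List E) : Prop :=
  ∃ hne : es ≠ [], IsPathChain s r es ∧ r (es.getLast hne) = s (es.head hne) ∧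
    (es.map s).Nodup

/-- A path (given as a list of edges) has an exit if some edge `f` has the same source as
one of the edges of the path but differs from it. -/
def HasExit {V E : Type} (s r : E → V) (es : List E) : Prop :=
  ∃ (f : E) (i : ℕ) (h : i < es.length), s f = s (es[i]'h) ∧ f ≠ es[i]'h



set_option linter.unusedSimpArgs false
set_option linter.unusedSectionVars false
set_option linter.unusedVariables false

namespace LPAux

section basics

variable (K : Type) [Field K] {V E : Type} [Fintype V] (s r : E → V)

/-- vertex element -/
noncomputable def vt (v : V) : LeavittPathAlgebra K V E s r :=
  RingQuot.mkAlgHom K (LPARel K V E s r) (FreeAlgebra.ι K (LPAGen.vertex v))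

/-- edge element -/
noncomputable def ed (e : E) : LeavittPathAlgebra K V E s r :=
  RingQuot.mkAlgHom K (LPARel K V E s r) (FreeAlgebra.ι K (LPAGen.edge e))

/-- ghost edge element -/
noncomputable def gh (e : E) : LeavittPathAlgebra K V E s r :=
  RingQuot.mkAlgHom K (LPARel K V E s r) (FreeAlgebra.ι K (LPAGen.ghost e))

lemma vt_orth {v w : V} (h : v ≠ w) : vt K s r v * vt K s r w = 0 := by
  simpa [vt] using RingQuot.mkAlgHom_rel K (LPARel.vertex_orth (K := K) (s := s) (r := r) v w h)

lemma vt_idem (v : V) : vt K s r v * vt K s r v = vt K s r v := by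
  simpa [vt] using RingQuot.mkAlgHom_rel K (LPARel.vertex_idem (K := K) (s := s) (r := r) v)

lemma vt_ed (e : E) : vt K s r (s e) * ed K s r e = ed K s r e := by
  simpa [vt, ed] using RingQuot.mkAlgHom_rel K (LPARel.edge_src (K := K) (s := s) (r := r) e)

lemma ed_vt (e : E) : ed K s r e * vt K s r (r e) = ed K s r e := by
  simpa [vt, ed] using RingQuot.mkAlgHom_rel K (LPARel.edge_rng (K := K) (s := s) (r := r) e)

lemma vt_gh (e : E) : vt K s r (r e) * gh K s r e = gh K s r e := by
  simpa [vt, gh] using RingQuot.mkAlgHom_rel K (LPARel.ghost_rng (K := K) (s := s) (r := r) e)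

lemma gh_vt (e : E) : gh K s r e * vt K s r (s e) = gh K s r e := by
  simpa [vt, gh] using RingQuot.mkAlgHom_rel K (LPARel.ghost_src (K := K) (s := s) (r := r) e)

lemma gh_ed_ne {e f : E} (h : e ≠ f) : gh K s r e * ed K s r f = 0 := by
  simpa [gh, ed] using
    RingQuot.mkAlgHom_rel K (LPARel.ck1_distinct (K := K) (s := s) (r := r) e f h)

lemma gh_ed (e : E) : gh K s r e * ed K s r e = vt K s r (r e) := by
  simpa [gh, ed, vt] using
    RingQuot.mkAlgHom_rel K (LPARel.ck1_same (K := K) (s := s) (r := r) e)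

lemma ck2 [Fintype E] [DecidableEq V] (v : V) (hne : ∃ e, s e = v) :
    vt K s r v = ∑ e with s e = v, ed K s r e * gh K s r e := by
  have h := RingQuot.mkAlgHom_rel K (LPARel.ck2 (K := K) (s := s) (r := r) v
    (Set.toFinite _) hne)
  simp only [map_sum, map_mul] at h
  refine h.trans (Finset.sum_congr ?_ fun _ _ => rfl)
  ext; simp

lemma one_eq : (1 : LeavittPathAlgebra K V E s r) = ∑ v, vt K s r v := by
  simpa [vt] using RingQuot.mkAlgHom_rel K (LPARel.unit (K := K) (s := s) (r := r))

lemma vt_vt [DecidableEq V] (v w : V) :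
    vt K s r v * vt K s r w = if v = w then vt K s r v else 0 := by
  split_ifs with h
  · subst h; exact vt_idem K s r v
  · exact vt_orth K s r h

lemma vt_ed' [DecidableEq V] (v : V) (e : E) :
    vt K s r v * ed K s r e = if v = s e then ed K s r e else 0 := by
  rw [← vt_ed, ← mul_assoc, vt_vt]
  split_ifs with h
  · rw [h]
  · simp

lemma ed_vt' [DecidableEq V] (v : V) (e : E) :
    ed K s r e * vt K s r v = if r e = v then ed K s r e else 0 := by
  rw [← ed_vt, mul_assoc, vt_vt]
  split_ifs with h
  · rfl
  · simp

lemma vt_gh' [DecidableEq V] (v : V) (e : E) :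
    vt K s r v * gh K s r e = if v = r e then gh K s r e else 0 := by
  rw [← vt_gh, ← mul_assoc, vt_vt]
  split_ifs with h
  · rw [h]
  · simp

lemma gh_vt' [DecidableEq V] (v : V) (e : E) :
    gh K s r e * vt K s r v = if s e = v then gh K s r e else 0 := by
  rw [← gh_vt, mul_assoc, vt_vt]
  split_ifs with h
  · rfl
  · simp

/-- Induction principle for the algebra. -/
lemma lpa_induction {p : LeavittPathAlgebra K V E s r → Prop}
    (hk : ∀ k : K, p (algebraMap K _ k)) (hv : ∀ v, p (vt K s r v)) (he : ∀ e, p (ed K s r e))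
    (hg : ∀ e, p (gh K s r e)) (hm : ∀ a b, p a → p b → p (a * b))
    (ha : ∀ a b, p a → p b → p (a + b)) (a : LeavittPathAlgebra K V E s r) : p a := by
  obtain ⟨x, rfl⟩ := RingQuot.mkAlgHom_surjective K (LPARel K V E s r) a
  induction x using FreeAlgebra.induction with
  | grade0 k => rw [AlgHom.commutes]; exact hk k
  | grade1 x =>
    cases x with
    | vertex v => exact hv v
    | edge e => exact he e
    | ghost e => exact hg e
  | mul a b h1 h2 => rw [map_mul]; exact hm _ _ h1 h2
  | add a b h1 h2 => rw [map_add]; exact ha _ _ h1 h2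

/-- product of edges of a list -/
noncomputable def PP (l : List E) : LeavittPathAlgebra K V E s r := (l.map (ed K s r)).prod

/-- adjoint of the product of edges of a list -/
noncomputable def GG : List E → LeavittPathAlgebra K V E s r
  | [] => 1
  | e :: l => GG l * gh K s r e

@[simp] lemma PP_nil : PP K s r ([] : List E) = 1 := by simp [PP]
@[simp] lemma PP_cons (e : E) (l : List E) : PP K s r (e :: l) = ed K s r e * PP K s r l := by
  simp [PP]
lemma PP_append (l l' : List E) : PP K s r (l ++ l') = PP K s r l * PP K s r l' := by
  simp [PP]
@[simp] lemma GG_nil : GG K s r ([] : List E) = 1 := rfl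
@[simp] lemma GG_cons (e : E) (l : List E) : GG K s r (e :: l) = GG K s r l * gh K s r e := rfl
lemma GG_append (l l' : List E) : GG K s r (l ++ l') = GG K s r l' * GG K s r l := by
  induction l with
  | nil => simp
  | cons e l ih => simp [ih, mul_assoc]



/-- `IsPath s r u l v`: the list `l` is a path from `u` to `v`. -/
def IsPath (s r : E → V) : V → List E → V → Prop
  | u, [], v => u = v
  | u, e :: l, v => u = s e ∧ IsPath s r (r e) l v

open Classical in
lemma vt_PP_vt (u v : V) (l : List E) : vt K s r u * PP K s r l * vt K s r v =
    if IsPath s r u l v then PP K s r l * vt K s r v else 0 := by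
  induction l generalizing u with
  | nil =>
    simp only [PP_nil, mul_one, vt_vt, IsPath, one_mul]
    split_ifs with h
    · rw [h]
    · rfl
  | cons e l ih =>
    rw [PP_cons, ← mul_assoc, vt_ed']
    by_cases h : u = s e
    · have := ih (r e)
      rw [if_pos h, ← ed_vt, mul_assoc, mul_assoc, ← mul_assoc (vt K s r (r e)), this]
      simp only [IsPath, h, true_and]
      split_ifs with h2
      · simp only [mul_assoc]
      · simp
    · simp [h, IsPath]

open Classical in
lemma vt_GG_vt (u v : V) (l : List E) : vt K s r v * GG K s r l * vt K s r u =
    if IsPath s r u l v then vt K s r v * GG K s r l else 0 := by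
  induction l generalizing u with
  | nil =>
    simp only [GG_nil, mul_one, vt_vt, IsPath, eq_comm]
  | cons e l ih =>
    rw [GG_cons, mul_assoc, mul_assoc, gh_vt']
    by_cases h : s e = u
    · have := ih (r e)
      rw [if_pos h, ← vt_gh, ← mul_assoc, ← mul_assoc, this]
      simp only [IsPath, h, true_and]
      split_ifs with h2
      · rw [mul_assoc]
      · simp
    · have h' : ¬ u = s e := fun h1 => h h1.symm
      simp [h, h', IsPath]

/-- Span of the monomials. -/
lemma mem_span (a : LeavittPathAlgebra K V E s r) :
    a ∈ Submodule.span K {x | ∃ l v l', x = PP K s r l * vt K s r v * GG K s r l'} := by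
  classical
  set S := Submodule.span K {x | ∃ l v l', x = PP K s r l * vt K s r v * GG K s r l'} with hS
  have hmem : ∀ l v l', PP K s r l * vt K s r v * GG K s r l' ∈ S := fun l v l' =>
    Submodule.subset_span ⟨l, v, l', rfl⟩
  have hvm : ∀ u l v l', vt K s r u * (PP K s r l * vt K s r v * GG K s r l') ∈ S := by
    intro u l v l'
    rw [← mul_assoc, ← mul_assoc, vt_PP_vt]
    split_ifs
    · exact hmem _ _ _
    · simp
  have key : ∀ a : LeavittPathAlgebra K V E s r, ∀ x ∈ S, a * x ∈ S := by
    intro a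
    induction a using lpa_induction with
    | hk k =>
      intro x hx
      rw [← Algebra.smul_def]; exact S.smul_mem k hx
    | hm a b h1 h2 => intro x hx; rw [mul_assoc]; exact h1 _ (h2 _ hx)
    | ha a b h1 h2 => intro x hx; rw [add_mul]; exact S.add_mem (h1 _ hx) (h2 _ hx)
    | hv u =>
      intro x hx
      induction hx using Submodule.span_induction with
      | mem x h => obtain ⟨l, v, l', rfl⟩ := h; exact hvm _ _ _ _
      | zero => simp
      | add x y _ _ h1 h2 => rw [mul_add]; exact S.add_mem h1 h2
      | smul k x _ h => rw [mul_smul_comm]; exact S.smul_mem k h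
    | he e =>
      intro x hx
      induction hx using Submodule.span_induction with
      | mem x h =>
        obtain ⟨l, v, l', rfl⟩ := h
        have := hmem (e :: l) v l'
        simpa [mul_assoc] using this
      | zero => simp
      | add x y _ _ h1 h2 => rw [mul_add]; exact S.add_mem h1 h2
      | smul k x _ h => rw [mul_smul_comm]; exact S.smul_mem k h
    | hg e =>
      intro x hx
      induction hx using Submodule.span_induction with
      | mem x h =>
        obtain ⟨l, v, l', rfl⟩ := h
        cases l with
        | nil =>
          rw [PP_nil, one_mul, ← mul_assoc, gh_vt']
          split_ifs with h
          · have := hmem [] (r e) (l' ++ [e])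
            simp only [PP_nil, one_mul, GG_append, GG_cons, GG_nil] at this
            rwa [← mul_assoc, vt_gh] at this
          · simp
        | cons f l =>
          have : gh K s r e * (PP K s r (f :: l) * vt K s r v * GG K s r l') =
            (gh K s r e * ed K s r f) * (PP K s r l * vt K s r v * GG K s r l') := by
            simp [mul_assoc]
          rw [this]
          by_cases h : e = f
          · subst h; rw [gh_ed]; exact hvm _ _ _ _
          · rw [gh_ed_ne K s r h]; simp
      | zero => simp
      | add x y _ _ h1 h2 => rw [mul_add]; exact S.add_mem h1 h2
      | smul k x _ h => rw [mul_smul_comm]; exact S.smul_mem k h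
  have h1 : (1 : LeavittPathAlgebra K V E s r) ∈ S := by
    rw [one_eq]
    refine S.sum_mem fun v _ => ?_
    have := hmem [] v []
    simpa using this
  simpa using key a 1 h1

end basics

section paths

variable {V E : Type} {s r : E → V}

lemma isPath_append {u w : V} {l l' : List E} :
    IsPath s r u (l ++ l') w ↔ ∃ v, IsPath s r u l v ∧ IsPath s r v l' w := by
  induction l generalizing u with
  | nil => simp [IsPath]
  | cons e l ih => simp [IsPath, ih, and_assoc]

lemma IsPath.append {u v w : V} {l l' : List E} (h : IsPath s r u l v) (h' : IsPath s r v l' w) :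
    IsPath s r u (l ++ l') w := isPath_append.2 ⟨v, h, h'⟩

lemma IsPath.unique {u v w : V} {l : List E} (h : IsPath s r u l v) (h' : IsPath s r u l w) :
    v = w := by
  induction l generalizing u with
  | nil => simp only [IsPath] at h h'; rw [← h, h']
  | cons e l ih => exact ih h.2 h'.2

lemma exists_simple {u w : V} {l : List E} (h : IsPath s r w l u) :
    ∃ l', IsPath s r w l' u ∧ (l'.map s).Nodup ∧ u ∉ l'.map s := by
  induction l generalizing w with
  | nil => exact ⟨[], h, by simp, by simp⟩
  | cons e l ih =>
    obtain ⟨l', h1, h2, h3⟩ := ih h.2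
    by_cases hwu : w = u
    · exact ⟨[], hwu, by simp, by simp⟩
    by_cases hm : w ∈ l'.map s
    · obtain ⟨f, hf, hfw⟩ := List.mem_map.1 hm
      obtain ⟨a, b, rfl⟩ := List.append_of_mem hf
      obtain ⟨v, -, h4⟩ := isPath_append.1 h1
      refine ⟨f :: b, ⟨hfw.symm, h4.2⟩, ?_, ?_⟩
      · rw [List.map_append, List.nodup_append] at h2
        exact h2.2.1
      · intro hh; apply h3; rw [List.map_append]; exact List.mem_append_right _ hh
    · refine ⟨e :: l', ⟨h.1, h1⟩, ?_, ?_⟩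
      · rw [List.map_cons, List.nodup_cons]; rw [h.1] at hm; exact ⟨hm, h2⟩
      · rw [List.map_cons, List.mem_cons]
        rintro (h4 | h4)
        · exact hwu (h.1.trans h4.symm)
        · exact h3 h4

lemma isPathChain_iff {l : List E} :
    IsPathChain s r l ↔ List.IsChain (fun a b => r a = s b) l := by
  rw [List.isChain_iff_getElem]; rfl

lemma IsPath.isChain {u v : V} {l : List E} (h : IsPath s r u l v) :
    List.IsChain (fun a b => r a = s b) l := by
  induction l generalizing u with
  | nil => simp
  | cons e l ih =>
    cases l with
    | nil => simp
    | cons f l => rw [List.isChain_cons_cons]; exact ⟨h.2.1, ih h.2⟩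

lemma IsPath.getLast {u v : V} {l : List E} (h : IsPath s r u l v) (hl : l ≠ []) :
    r (l.getLast hl) = v := by
  induction l generalizing u with
  | nil => simp at hl
  | cons e l ih =>
    cases l with
    | nil => simpa [IsPath] using h.2
    | cons f l => rw [List.getLast_cons (by simp)]; exact ih h.2 _

lemma isPath_of_isChain {l : List E} (h : List.IsChain (fun a b => r a = s b) l) (hl : l ≠ []) :
    IsPath s r (s (l.head hl)) l (r (l.getLast hl)) := by
  induction l with
  | nil => simp at hl
  | cons e l ih =>
    cases l with
    | nil => simp [IsPath]
    | cons f l =>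
      rw [List.isChain_cons_cons] at h
      refine ⟨rfl, ?_⟩
      have := ih h.2 (by simp)
      rw [h.1]
      exact this

/-- Every edge lying on a closed path is the unique edge emitted by its source. -/
def NE (s r : E → V) : Prop :=
  ∀ e f : E, s e = s f → (∃ l, IsPath s r (r e) l (s e)) → e = f

lemma noExit_iff : (∀ es : List E, IsCycle s r es → ¬ HasExit s r es) ↔ NE s r := by
  constructor
  · rintro h e f hef ⟨l, hl⟩
    by_contra hne
    obtain ⟨l', h1, h2, h3⟩ := exists_simple hl
    refine h (e :: l') ⟨by simp, ?_, ?_, ?_⟩ ⟨f, 0, by simp, by simpa using hef.symm, ?_⟩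
    · rw [isPathChain_iff]
      exact IsPath.isChain (u := s e) (v := s e) ⟨rfl, h1⟩
    · have h4 : IsPath s r (s e) (e :: l') (s e) := ⟨rfl, h1⟩
      rw [h4.getLast]; simp
    · rw [List.map_cons, List.nodup_cons]; exact ⟨h3, h2⟩
    · simpa using fun h => hne h.symm
  · rintro h es ⟨hne, hc, hl, -⟩ ⟨f, i, hi, hs, hf⟩
    rw [isPathChain_iff] at hc
    have hp := isPath_of_isChain hc hne
    apply hf
    obtain ⟨a, b, hab⟩ := List.append_of_mem (List.getElem_mem hi)
    have hp' : ∃ u, IsPath s r u es u := ⟨_, by rw [hl] at hp; exact hp⟩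
    obtain ⟨u, hp'⟩ := hp'
    rw [hab] at hp'
    obtain ⟨v, h1, h2, h3⟩ := isPath_append.1 hp'
    rw [h2] at h1
    exact (h _ _ hs.symm ⟨_, h3.append h1⟩).symm

end paths

section rep

variable (K : Type) [Field K] {V E : Type} [Fintype V] [Fintype E] (s r : E → V)

lemma exists_branching : ∃ i : E → ℕ → ℕ, (∀ e, Function.Injective (i e)) ∧
    (∀ e f k k', s e = s f → i e k = i f k' → e = f) ∧
    (∀ v, (∃ e, s e = v) → ∀ n, ∃ e k, s e = v ∧ i e k = n) := by
  have h : ∀ v, (∃ e, s e = v) → Nonempty (({e // s e = v} × ℕ) ≃ ℕ) := by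
    rintro v ⟨e, he⟩
    have : Nonempty {e // s e = v} := ⟨⟨e, he⟩⟩
    exact nonempty_equiv_of_countable
  choose j hj using fun v (h' : ∃ e, s e = v) => (⟨(h v h').some, trivial⟩ : ∃ _ : ({e // s e = v} × ℕ) ≃ ℕ, True)
  have key : ∀ e f k k' v (hv : v = s f) (he : s e = v), j v ⟨e, he⟩ (⟨e, he⟩, k) = j (s f) ⟨f, rfl⟩ (⟨f, rfl⟩, k') → e = f := by
    rintro e f k k' v rfl he h
    have := (j (s f) ⟨f, rfl⟩).injective h
    simpa using congrArg (fun x => x.1.1) this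
  refine ⟨fun e k => j (s e) ⟨e, rfl⟩ (⟨e, rfl⟩, k), ?_, ?_, ?_⟩
  · intro e k k' h
    simpa using (j (s e) ⟨e, rfl⟩).injective h
  · intro e f k k' hs h
    refine key e f k k' (s e) hs rfl h
  · rintro v hv n
    obtain ⟨⟨⟨e, rfl⟩, k⟩, h⟩ := (j v hv).surjective n
    exact ⟨e, k, rfl, h⟩

variable {A : Type} [CommRing A] [Algebra K A]

open Classical in
/-- the action of a vertex -/
noncomputable def opV (v : V) : Module.End K (V × ℕ → A) where
  toFun g := fun x => if x.1 = v then g x else 0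
  map_add' g h := by ext x; simp only [Pi.add_apply]; split_ifs <;> simp
  map_smul' k g := by ext x; simp

open Classical in
/-- the action of an edge -/
noncomputable def opE (i : E → ℕ → ℕ) (w : E → Aˣ) (e : E) : Module.End K (V × ℕ → A) where
  toFun g := fun x => if x.1 = s e ∧ ∃ k, i e k = x.2 then
    (w e : A) * g (r e, Function.invFun (i e) x.2) else 0
  map_add' g h := by ext x; simp only [Pi.add_apply]; split_ifs <;> simp [mul_add]
  map_smul' k g := by ext x; simp

open Classical in
/-- the action of a ghost edge -/
noncomputable def opG (i : E → ℕ → ℕ) (w : E → Aˣ) (e : E) : Module.End K (V × ℕ → A) where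
  toFun g := fun x => if x.1 = r e then ((w e)⁻¹ : Aˣ) * g (s e, i e x.2) else 0
  map_add' g h := by ext x; simp only [Pi.add_apply]; split_ifs <;> simp [mul_add]
  map_smul' k g := by ext x; simp

/-- the action of a generator -/
noncomputable def opGen (i : E → ℕ → ℕ) (w : E → Aˣ) : LPAGen V E → Module.End K (V × ℕ → A)
  | .vertex v => opV K v
  | .edge e => opE K s r i w e
  | .ghost e => opG K s r i w e

open Classical in
/-- indicator function of the fibre of a vertex -/
noncomputable def xi (A : Type) [CommRing A] (v : V) : V × ℕ → A := fun x => if x.1 = v then 1 else 0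

lemma exists_rep (w : E → Aˣ) :
    ∃ ρ : LeavittPathAlgebra K V E s r →ₐ[K] Module.End K (V × ℕ → A), ∀ a : A,
      (∀ v, ρ (vt K s r v) (a • xi A v) = a • xi A v) ∧
      (∀ e, (∀ f, s e = s f → e = f) → ρ (gh K s r e) (a • xi A (s e)) =
        (((w e)⁻¹ : Aˣ) * a) • xi A (r e)) ∧
      (∀ e, (∀ f, s e = s f → e = f) → ρ (ed K s r e) (a • xi A (r e)) =
        (w e * a) • xi A (s e)) := by
  classical
  obtain ⟨i, hi1, hi2, hi3⟩ := exists_branching s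
  have hinv : ∀ e k, Function.invFun (i e) (i e k) = k := fun e =>
    Function.leftInverse_invFun (hi1 e)
  have hrel : ∀ ⦃x y⦄, LPARel K V E s r x y →
      FreeAlgebra.lift K (opGen K s r i w) x = FreeAlgebra.lift K (opGen K s r i w) y := by
    intro x y h
    cases h with
    | vertex_orth v w h =>
      simp only [map_mul, FreeAlgebra.lift_ι_apply, opGen, map_zero]
      ext g x
      simp only [Module.End.mul_apply, opV, LinearMap.coe_mk, AddHom.coe_mk, LinearMap.zero_apply, Pi.zero_apply]
      split_ifs with h1 h2
      · exact absurd (h1.symm.trans h2) h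
      · rfl
      · rfl
    | vertex_idem v =>
      simp only [map_mul, FreeAlgebra.lift_ι_apply, opGen, map_zero]
      ext g x
      simp only [Module.End.mul_apply, opV, LinearMap.coe_mk, AddHom.coe_mk]
      split_ifs <;> rfl
    | edge_src e =>
      simp only [map_mul, FreeAlgebra.lift_ι_apply, opGen, map_zero]
      ext g x
      simp only [Module.End.mul_apply, opV, opE, LinearMap.coe_mk, AddHom.coe_mk]
      split_ifs <;> tauto
    | edge_rng e =>
      simp only [map_mul, FreeAlgebra.lift_ι_apply, opGen, map_zero]
      ext g x
      simp [Module.End.mul_apply, opV, opE, LinearMap.coe_mk, AddHom.coe_mk]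
    | ghost_rng e =>
      simp only [map_mul, FreeAlgebra.lift_ι_apply, opGen, map_zero]
      ext g x
      simp only [Module.End.mul_apply, opV, opG, LinearMap.coe_mk, AddHom.coe_mk]
      split_ifs <;> tauto
    | ghost_src e =>
      simp only [map_mul, FreeAlgebra.lift_ι_apply, opGen, map_zero]
      ext g x
      simp [Module.End.mul_apply, opV, opG, LinearMap.coe_mk, AddHom.coe_mk]
    | ck1_distinct e f h =>
      simp only [map_mul, FreeAlgebra.lift_ι_apply, opGen, map_zero]
      ext g x
      simp only [Module.End.mul_apply, opE, opG, LinearMap.coe_mk, AddHom.coe_mk, LinearMap.zero_apply, Pi.zero_apply]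
      split_ifs with h1 h2
      · obtain ⟨h2, k, h3⟩ := h2
        exact absurd (hi2 _ _ _ _ h2 h3.symm) h
      · simp
      · rfl
    | ck1_same e =>
      simp only [map_mul, FreeAlgebra.lift_ι_apply, opGen, map_zero]
      ext g x
      simp only [Module.End.mul_apply, opE, opG, opV, LinearMap.coe_mk, AddHom.coe_mk, hinv]
      split_ifs with h1 h2 h2
      · simp [← h1]
      · exact absurd ⟨trivial, _, rfl⟩ h2
      · rfl
    | ck2 v hf hne =>
      simp only [map_mul, map_sum, FreeAlgebra.lift_ι_apply, opGen, map_zero]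
      ext g x
      simp only [LinearMap.sum_apply, Finset.sum_apply, Module.End.mul_apply, opE, opG, opV,
        LinearMap.coe_mk, AddHom.coe_mk]
      by_cases h : x.1 = v
      · obtain ⟨e, k, he, hk⟩ := hi3 v hne x.2
        rw [if_pos h, Finset.sum_eq_single_of_mem e (by simpa using he)]
        · rw [if_pos ⟨h.trans he.symm, k, hk⟩, ← hk, hinv]
          simp [he, ← h, hk]
        · intro f hf hne
          rw [if_neg]
          rintro ⟨h1, k', h2⟩
          exact hne (hi2 _ _ _ _ (h1.symm.trans (h.trans he.symm)) (h2.trans hk.symm))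
      · rw [if_neg h, Finset.sum_eq_zero]
        intro f hf
        rw [if_neg]
        rintro ⟨h1, -⟩
        apply h; rw [h1]; simpa using hf
    | unit =>
      simp only [map_one, map_sum, FreeAlgebra.lift_ι_apply, opGen]
      ext g x
      simp [LinearMap.sum_apply, Finset.sum_apply, opV]
  refine ⟨RingQuot.liftAlgHom K ⟨FreeAlgebra.lift K (opGen K s r i w), hrel⟩, fun a => ⟨?_, ?_, ?_⟩⟩
  · intro v
    simp only [vt, RingQuot.liftAlgHom_mkAlgHom_apply, FreeAlgebra.lift_ι_apply, opGen]
    ext x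
    by_cases h : x.1 = v <;> simp [opV, h, xi]
  · intro e _
    simp only [gh, RingQuot.liftAlgHom_mkAlgHom_apply, FreeAlgebra.lift_ι_apply, opGen]
    ext x
    by_cases h : x.1 = r e <;> simp [opG, h, xi]
  · intro e he
    simp only [ed, RingQuot.liftAlgHom_mkAlgHom_apply, FreeAlgebra.lift_ι_apply, opGen]
    ext x
    by_cases h : x.1 = s e
    · obtain ⟨f, k, hf, hk⟩ := hi3 (s e) ⟨e, rfl⟩ x.2
      have := he f hf.symm
      subst this
      have : ∃ k, i e k = x.2 := ⟨k, hk⟩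
      simp [opE, h, this, xi]
    · simp [opE, h, xi]

lemma xi_smul_inj {v : V} {a : A} (h : a • xi A v = 0) : a = 0 := by
  have := congrFun h (v, 0)
  simpa [xi] using this

lemma vt_ne_zero (v : V) : vt K s r v ≠ 0 := by
  obtain ⟨ρ, hρ⟩ := exists_rep K s r (A := K) (fun _ => 1)
  intro h
  have := (hρ 1).1 v
  rw [h, map_zero] at this
  exact one_ne_zero (xi_smul_inj (v := v) this.symm)

end rep

section baerToNE

variable (K : Type) [Field K] {V E : Type} [Fintype V] (s r : E → V)

variable {s r} in
lemma IsPath.unique_left {u u' v : V} {l : List E} (h : IsPath s r u l v)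
    (h' : IsPath s r u' l v) : u = u' := by
  cases l with
  | nil => exact Eq.trans h (Eq.symm h')
  | cons e l => exact h.1.trans h'.1.symm

open Classical in
lemma GG_PP_left {u x w : V} (v : V) {l k : List E} (hl : IsPath s r u l x)
    (hk : IsPath s r x k w) : vt K s r w * GG K s r (l ++ k) * PP K s r l * vt K s r v =
      if x = v then vt K s r w * GG K s r k else 0 := by
  induction l generalizing u with
  | nil =>
    rw [List.nil_append, PP_nil, mul_one, vt_GG_vt]
    by_cases h : x = v
    · subst h; simp [hk]
    · rw [if_neg, if_neg h]
      exact fun h' => h (hk.unique_left h')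
  | cons e l ih =>
    rw [← ih hl.2]
    have h1 := vt_GG_vt K s r (r e) w (l ++ k)
    rw [if_pos (hl.2.append hk)] at h1
    rw [List.cons_append, GG_cons, PP_cons]
    calc _ = vt K s r w * GG K s r (l ++ k) * (gh K s r e * ed K s r e) * PP K s r l * vt K s r v := by
            simp only [mul_assoc]
      _ = _ := by rw [gh_ed, h1]

open Classical in
lemma GG_PP_right {u x w : V} (v : V) {l k : List E} (hl : IsPath s r u l x)
    (hk : IsPath s r x k w) : vt K s r v * GG K s r l * PP K s r (l ++ k) * vt K s r w =
      if x = v then PP K s r k * vt K s r w else 0 := by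
  induction l generalizing u with
  | nil =>
    rw [List.nil_append, GG_nil, mul_one, vt_PP_vt]
    by_cases h : x = v
    · subst h; simp [hk]
    · rw [if_neg, if_neg h]
      exact fun h' => h (hk.unique_left h')
  | cons e l ih =>
    rw [← ih hl.2]
    have h1 := vt_PP_vt K s r (r e) w (l ++ k)
    rw [if_pos (hl.2.append hk)] at h1
    rw [List.cons_append, GG_cons, PP_cons]
    calc _ = vt K s r v * GG K s r l * ((gh K s r e * ed K s r e) * PP K s r (l ++ k) * vt K s r w) := by
            simp only [mul_assoc]
      _ = _ := by rw [gh_ed, h1]; simp only [mul_assoc]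

lemma GG_PP_self {u w : V} {l : List E} (hl : IsPath s r u l w) :
    vt K s r w * GG K s r l * PP K s r l * vt K s r w = vt K s r w := by
  have := GG_PP_left K s r w hl (k := []) (w := w) rfl
  simpa using this

lemma GG_PP_zero {q l : List E} (h1 : ¬ q <+: l) (h2 : ¬ l <+: q) :
    GG K s r q * PP K s r l = 0 := by
  classical
  induction q generalizing l with
  | nil => simp at h1
  | cons e q ih =>
    cases l with
    | nil => simp at h2
    | cons f l =>
      have : GG K s r (e :: q) * PP K s r (f :: l) =
        GG K s r q * ((gh K s r e * ed K s r f) * PP K s r l) := by simp [mul_assoc]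
      rw [this]
      by_cases h : e = f
      · subst h
        rw [List.cons_prefix_cons] at h1 h2
        have h3 := ih (fun h => h1 ⟨rfl, h⟩) (fun h => h2 ⟨rfl, h⟩)
        rw [gh_ed]
        cases l with
        | nil => simp at h2
        | cons g l =>
          rw [PP_cons, ← mul_assoc (vt K s r (r e)), vt_ed']
          split_ifs
          · rw [← PP_cons, h3]
          · simp
      · rw [gh_ed_ne K s r h]; simp

lemma prefix_marker {f : E} {a b : List E} (ha : f ∉ a) (hb : f ∉ b)
    (h : a ++ [f] <+: b ++ [f]) : a = b := by
  induction a generalizing b with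
  | nil =>
    cases b with
    | nil => rfl
    | cons y b => simp at h; simp [h] at hb
  | cons x a ih =>
    cases b with
    | nil => simp at h
    | cons y b =>
      simp only [List.cons_append, List.cons_prefix_cons] at h
      rw [h.1, ih (by simp at ha; exact ha.2) (by simp at hb; exact hb.2) h.2]

/-- power of a list -/
def lpow (c : List E) : ℕ → List E
  | 0 => []
  | n + 1 => c ++ lpow c n

lemma lpow_add (c : List E) (m n : ℕ) : lpow c (m + n) = lpow c m ++ lpow c n := by
  induction m with
  | zero => simp [lpow]
  | succ m ih => rw [Nat.succ_add]; simp [lpow, ih]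

lemma mem_lpow {c : List E} {m : ℕ} {x : E} (h : x ∈ lpow c m) : x ∈ c := by
  induction m with
  | zero => simp [lpow] at h
  | succ m ih => simp only [lpow, List.mem_append] at h; exact h.elim id ih

lemma le_length_lpow {c : List E} (hc : c ≠ []) (m : ℕ) : m ≤ (lpow c m).length := by
  induction m with
  | zero => simp
  | succ m ih =>
    have := List.length_pos_iff.2 hc
    simp only [lpow, List.length_append]; omega

variable {s r} in
lemma isPath_lpow {u : V} {c : List E} (h : IsPath s r u c u) (m : ℕ) :
    IsPath s r u (lpow c m) u := by
  induction m with
  | zero => rfl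
  | succ m ih => exact h.append ih

lemma eventually_const {u : V} {c : List E} {f : E} (hc : IsPath s r u c u) (hc0 : c ≠ [])
    (hf : s f = u) (hfc : f ∉ c) (a : LeavittPathAlgebra K V E s r) :
    ∃ N z, ∀ m ≥ N, vt K s r (r f) * GG K s r (lpow c m ++ [f]) * a *
      (PP K s r (lpow c m ++ [f]) * vt K s r (r f)) = z := by
  classical
  induction mem_span K s r a using Submodule.span_induction with
  | zero => exact ⟨0, 0, by simp⟩
  | add x y _ _ h1 h2 =>
    obtain ⟨N, z, h1⟩ := h1
    obtain ⟨N', z', h2⟩ := h2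
    refine ⟨max N N', z + z', fun m hm => ?_⟩
    rw [mul_add, add_mul, h1 m (le_trans (le_max_left _ _) hm),
      h2 m (le_trans (le_max_right _ _) hm)]
  | smul k x _ h =>
    obtain ⟨N, z, h⟩ := h
    refine ⟨N, k • z, fun m hm => ?_⟩
    rw [mul_smul_comm, smul_mul_assoc, h m hm]
  | mem x h =>
    obtain ⟨l, v, l', rfl⟩ := h
    set N := l.length + l'.length + 1 with hN
    have hlen := le_length_lpow hc0 N
    have hsplit : ∀ m ≥ N, ∃ j, lpow c m ++ [f] = lpow c N ++ (lpow c j ++ [f]) := by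
      intro m hm
      obtain ⟨j, rfl⟩ := Nat.exists_eq_add_of_le hm
      exact ⟨j, by rw [lpow_add]; simp⟩
    have hnot : ∀ l1 : List E, l1.length < N → ¬ l1 <+: lpow c N → ∀ m ≥ N,
        ¬ (lpow c m ++ [f]) <+: l1 ∧ ¬ l1 <+: (lpow c m ++ [f]) := by
      intro l1 h1 h2 m hm
      obtain ⟨j, hj⟩ := hsplit m hm
      rw [hj]
      constructor
      · intro h
        have := h.length_le
        simp at this; omega
      · intro h
        exact h2 (List.prefix_of_prefix_length_le h (List.prefix_append _ _) (by omega))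
    by_cases hl : l <+: lpow c N
    swap
    · refine ⟨N, 0, fun m hm => ?_⟩
      obtain ⟨h1, h2⟩ := hnot l (by omega) hl m hm
      have := GG_PP_zero K s r h1 h2
      rw [mul_assoc (vt K s r (r f)), mul_assoc (PP K s r l), ← mul_assoc (GG K s r _) (PP K s r l), this]
      simp
    by_cases hl' : l' <+: lpow c N
    swap
    · refine ⟨N, 0, fun m hm => ?_⟩
      obtain ⟨h1, h2⟩ := hnot l' (by omega) hl' m hm
      have := GG_PP_zero K s r h2 h1
      rw [mul_assoc (vt K s r (r f)), mul_assoc, mul_assoc, mul_assoc (PP K s r l * _), ← mul_assoc (GG K s r l'), this]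
      simp
    obtain ⟨k, hk⟩ := hl
    obtain ⟨k', hk'⟩ := hl'
    have hpN := isPath_lpow hc N
    obtain ⟨x, hx1, hx2⟩ := isPath_append.1 (hk ▸ hpN)
    obtain ⟨x', hx1', hx2'⟩ := isPath_append.1 (hk' ▸ hpN)
    have hpj : ∀ j, IsPath s r u (lpow c j ++ [f]) (r f) := fun j =>
      (isPath_lpow hc j).append ⟨hf.symm, rfl⟩
    refine ⟨N, if x = v ∧ x' = v ∧ k = k' then vt K s r (r f) else 0, fun m hm => ?_⟩
    obtain ⟨j, hj⟩ := hsplit m hm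
    have e1 : lpow c m ++ [f] = l ++ (k ++ (lpow c j ++ [f])) := by rw [hj, ← hk]; simp
    have e2 : lpow c m ++ [f] = l' ++ (k' ++ (lpow c j ++ [f])) := by rw [hj, ← hk']; simp
    have f1 := GG_PP_left K s r v hx1 (hx2.append (hpj j))
    have f2 := GG_PP_right K s r v hx1' (hx2'.append (hpj j))
    rw [← e1] at f1
    rw [← e2] at f2
    have : vt K s r (r f) * GG K s r (lpow c m ++ [f]) * (PP K s r l * vt K s r v * GG K s r l') *
      (PP K s r (lpow c m ++ [f]) * vt K s r (r f)) =
      (vt K s r (r f) * GG K s r (lpow c m ++ [f]) * PP K s r l * vt K s r v) *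
      (vt K s r v * GG K s r l' * PP K s r (lpow c m ++ [f]) * vt K s r (r f)) := by
      have h := vt_idem K s r v
      conv_lhs => rw [← h]
      simp only [mul_assoc]
    rw [this, f1, f2]
    by_cases h1 : x = v
    swap
    · simp [h1]
    by_cases h2 : x' = v
    swap
    · simp [h2]
    rw [if_pos h1, if_pos h2]
    by_cases h3 : k = k'
    · subst h3
      rw [if_pos ⟨h1, h2, rfl⟩, ← mul_assoc]
      exact GG_PP_self K s r (hx2.append (hpj j))
    · rw [if_neg (by tauto)]
      have hk1 : f ∉ k ++ lpow c j := by
        simp only [List.mem_append, not_or]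
        refine ⟨fun h => hfc (mem_lpow (m := N) ?_), fun h => hfc (mem_lpow h)⟩
        rw [← hk]; simp [h]
      have hk2 : f ∉ k' ++ lpow c j := by
        simp only [List.mem_append, not_or]
        refine ⟨fun h => hfc (mem_lpow (m := N) ?_), fun h => hfc (mem_lpow h)⟩
        rw [← hk']; simp [h]
      have : GG K s r (k ++ (lpow c j ++ [f])) * PP K s r (k' ++ (lpow c j ++ [f])) = 0 := by
        rw [← List.append_assoc, ← List.append_assoc]
        apply GG_PP_zero
        · intro h
          exact h3 (List.append_cancel_right (prefix_marker hk1 hk2 h))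
        · intro h
          exact h3 (List.append_cancel_right (prefix_marker hk2 hk1 h)).symm
      rw [mul_assoc, ← mul_assoc (GG K s r _), this]
      simp

lemma NE_of_baer [Fintype E] (h : ∀ X : Set (LeavittPathAlgebra K V E s r),
        ∃ e : LeavittPathAlgebra K V E s r, e * e = e ∧
          ∀ a : LeavittPathAlgebra K V E s r,
            (∀ x ∈ X, a * x = 0) ↔ ∃ y : LeavittPathAlgebra K V E s r, a = y * e) :
    NE s r := by
  rintro g f hgf ⟨l, hl⟩
  by_contra hne
  obtain ⟨l0, h1, -, h3⟩ := exists_simple hl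
  set c := g :: l0 with hcdef
  have hc : IsPath s r (s g) c (s g) := ⟨rfl, h1⟩
  have hfc : f ∉ c := by
    rw [hcdef, List.mem_cons, not_or]
    exact ⟨fun h => hne h.symm, fun h => h3 (hgf ▸ List.mem_map_of_mem h)⟩
  have hc0 : c ≠ [] := by simp [hcdef]
  have hq : ∀ m, IsPath s r (s g) (lpow c m ++ [f]) (r f) := fun m =>
    (isPath_lpow hc m).append ⟨hgf, rfl⟩
  have hself : ∀ m, vt K s r (r f) * GG K s r (lpow c m ++ [f]) *
      (PP K s r (lpow c m ++ [f]) * vt K s r (r f)) = vt K s r (r f) := fun m => by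
    rw [← mul_assoc]; exact GG_PP_self K s r (hq m)
  have horth : ∀ m n, m ≠ n → vt K s r (r f) * GG K s r (lpow c m ++ [f]) *
      (PP K s r (lpow c n ++ [f]) * vt K s r (r f)) = 0 := by
    intro m n hmn
    have hinj : ∀ m n, lpow c m = lpow c n → m = n := by
      have : StrictMono fun m => (lpow c m).length := strictMono_nat_of_lt_succ fun m => by
        simp [lpow, hcdef]
      intro m n h
      exact this.injective (congrArg List.length h)
    have hnm : ∀ m, f ∉ lpow c m := fun m h => hfc (mem_lpow h)
    have : GG K s r (lpow c m ++ [f]) * PP K s r (lpow c n ++ [f]) = 0 := by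
      apply GG_PP_zero
      · intro h; exact hmn (hinj _ _ (prefix_marker (hnm _) (hnm _) h))
      · intro h; exact hmn (hinj _ _ (prefix_marker (hnm _) (hnm _) h)).symm
    rw [mul_assoc, ← mul_assoc (GG K s r _), this]
    simp
  set G : ℕ → LeavittPathAlgebra K V E s r :=
    fun m => vt K s r (r f) * GG K s r (lpow c m ++ [f]) with hG
  set P : ℕ → LeavittPathAlgebra K V E s r :=
    fun m => PP K s r (lpow c m ++ [f]) * vt K s r (r f) with hP
  have hself : ∀ m, G m * P m = vt K s r (r f) := hself
  have horth : ∀ m n, m ≠ n → G m * P n = 0 := horth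
  have hvG : ∀ m, vt K s r (r f) * G m = G m := fun m => by
    simp only [hG]; rw [← mul_assoc, vt_idem]
  obtain ⟨e, he, hX⟩ := h {x | ∃ m, x = P (2 * m) * G (2 * m)}
  obtain ⟨N, z, hz⟩ := eventually_const K s r hc hc0 hgf.symm hfc e
  have hz : ∀ m ≥ N, G m * e * P m = z := hz
  have hPv : ∀ m, P m * vt K s r (r f) = P m := fun m => by
    simp only [hP]; rw [mul_assoc, vt_idem]
  have ev : G (2 * N) * e * P (2 * N) = 0 := by
    have := (hX e).2 ⟨e, he.symm⟩ _ ⟨N, rfl⟩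
    calc _ = G (2 * N) * (e * (P (2 * N) * G (2 * N))) * P (2 * N) := by
          have h2 : G (2 * N) * (e * (P (2 * N) * G (2 * N))) * P (2 * N) =
            G (2 * N) * e * (P (2 * N) * (G (2 * N) * P (2 * N))) := by simp only [mul_assoc]
          rw [h2, hself, hPv]
      _ = 0 := by rw [this]; simp
  have od : G (2 * N + 1) * e * P (2 * N + 1) = vt K s r (r f) := by
    obtain ⟨y, hy⟩ := (hX (P (2 * N + 1) * G (2 * N + 1))).1 (by
      rintro _ ⟨m, rfl⟩
      rw [mul_assoc, ← mul_assoc (G _), horth _ _ (by omega)]; simp)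
    have hye : P (2 * N + 1) * G (2 * N + 1) * e = P (2 * N + 1) * G (2 * N + 1) := by
      rw [hy, mul_assoc, he]
    calc _ = (G (2 * N + 1) * P (2 * N + 1)) * G (2 * N + 1) * e * P (2 * N + 1) := by
          rw [hself, hvG]
      _ = G (2 * N + 1) * (P (2 * N + 1) * G (2 * N + 1) * e) * P (2 * N + 1) := by
          simp only [mul_assoc]
      _ = (G (2 * N + 1) * P (2 * N + 1)) * (G (2 * N + 1) * P (2 * N + 1)) := by
          rw [hye]; simp only [mul_assoc]
      _ = _ := by rw [hself, vt_idem]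
  rw [hz _ (by omega)] at ev od
  exact vt_ne_zero K s r (r f) (od.symm.trans ev)

end baerToNE

section abstractBaer

lemma corner_baer {L : Type} [Ring L] {A : Type} [CommRing A] [IsDomain A]
    [IsPrincipalIdealRing A] (ψ : A →+* L) (t : L)
    (hcomm : ∀ x, ψ x * t = t * ψ x) (hinj : ∀ x, t * ψ x = 0 → x = 0)
    (hsurj : ∀ y, ∃ x, t * y * t = t * ψ x) {ι : Type} [Fintype ι]
    (a b : ι → L) (hab : ∀ i, b i * a i = t) (hab' : ∀ i j, i ≠ j → b i * a j = 0)
    (hat : ∀ i, a i * t = a i) (htb : ∀ i, t * b i = b i)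
    (hz : ∀ y, (∑ i, a i * b i) * y = y * ∑ i, a i * b i) (X : Set L) :
    ∃ e, (∀ x ∈ X, e * x = 0) ∧
      ∀ y, (∀ x ∈ X, y * x = 0) → y * e = y * ∑ i, a i * b i := by
  classical
  set z := ∑ i, a i * b i with hzdef
  let Φ : (ι → A) → L := fun g => ∑ i, a i * ψ (g i)
  have hΦadd : ∀ g h, Φ (g + h) = Φ g + Φ h := fun g h => by
    simp [Φ, mul_add, Finset.sum_add_distrib]
  have hΦzero : Φ 0 = 0 := by simp [Φ]
  have hΦsmul : ∀ (x : A) g, Φ (x • g) = Φ g * ψ x := fun x g => by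
    simp only [Φ, Finset.sum_mul, Pi.smul_apply, smul_eq_mul]
    exact Finset.sum_congr rfl fun i _ => by rw [mul_comm, map_mul, mul_assoc]
  have hΦsum : ∀ (S : Finset ι) (g : ι → ι → A), Φ (∑ i ∈ S, g i) = ∑ i ∈ S, Φ (g i) := by
    intro S g
    induction S using Finset.induction_on with
    | empty => simpa using hΦzero
    | insert i S hi ih => rw [Finset.sum_insert hi, Finset.sum_insert hi, hΦadd, ih]
  have hbΦ : ∀ j g, b j * Φ g = t * ψ (g j) := fun j g => by
    simp only [Φ, Finset.mul_sum]
    rw [Finset.sum_eq_single j]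
    · rw [← mul_assoc, hab]
    · intro i _ hi; rw [← mul_assoc, hab' _ _ hi.symm, zero_mul]
    · simp
  have hΦinj : ∀ g, Φ g = 0 → g = 0 := fun g hg => by
    ext j; apply hinj; rw [← hbΦ, hg, mul_zero]
  have haψ : ∀ i x, a i * (t * ψ x) = a i * ψ x := fun i x => by rw [← mul_assoc, hat]
  have hΦt : ∀ g, Φ g * t = Φ g := fun g => by
    simp only [Φ, Finset.sum_mul]
    exact Finset.sum_congr rfl fun i _ => by rw [mul_assoc, hcomm, haψ]
  have hzΦ : ∀ g, z * Φ g = Φ g := fun g => by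
    rw [hzdef, Finset.sum_mul]
    exact Finset.sum_congr rfl fun i _ => by rw [mul_assoc, hbΦ, haψ]
  have himg : ∀ y, z * y = y → y * t = y → ∃ g, y = Φ g := by
    intro y h1 h2
    choose g hg using fun i => hsurj (b i * y)
    refine ⟨g, ?_⟩
    conv_lhs => rw [← h1, hzdef, Finset.sum_mul]
    refine Finset.sum_congr rfl fun i _ => ?_
    have : t * (b i * y) * t = b i * y := by
      rw [← mul_assoc, htb, mul_assoc, h2]
    rw [mul_assoc, ← this, hg, haψ]
  have hza : ∀ i, z * a i = a i := fun i => by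
    rw [hzdef, Finset.sum_mul, Finset.sum_eq_single i]
    · rw [mul_assoc, hab, hat]
    · intro j _ hj; rw [mul_assoc, hab' _ _ hj, mul_zero]
    · simp
  have hbz : ∀ i, b i * z = b i := fun i => by
    rw [hzdef, Finset.mul_sum, Finset.sum_eq_single i]
    · rw [← mul_assoc, hab, htb]
    · intro j _ hj; rw [← mul_assoc, hab' _ _ hj.symm, zero_mul]
    · simp
  let W : Submodule A (ι → A) :=
    { carrier := {g | ∀ y, (∀ x ∈ X, y * x = 0) → y * Φ g = 0}
      add_mem' := fun {g h} hg hh y hy => by rw [hΦadd, mul_add, hg y hy, hh y hy, add_zero]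
      zero_mem' := fun y _ => by rw [hΦzero, mul_zero]
      smul_mem' := fun x g hg y hy => by rw [hΦsmul, ← mul_assoc, hg y hy, zero_mul] }
  have hWmem : ∀ g, g ∈ W ↔ ∀ y, (∀ x ∈ X, y * x = 0) → y * Φ g = 0 := fun g => Iff.rfl
  have htf : Module.IsTorsionFree A ((ι → A) ⧸ W) := by
    rw [Module.isTorsionFree_iff_smul_eq_zero]
    intro x q hq
    obtain ⟨g, rfl⟩ := W.mkQ_surjective q
    by_cases hx : x = 0
    · exact Or.inl hx
    refine Or.inr ?_
    rw [← map_smul, Submodule.mkQ_apply, Submodule.Quotient.mk_eq_zero] at hq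
    rw [Submodule.mkQ_apply, Submodule.Quotient.mk_eq_zero, hWmem]
    intro y hy
    have h1 := (hWmem _).1 hq y hy
    rw [hΦsmul, ← mul_assoc] at h1
    obtain ⟨h, hh⟩ := himg (y * Φ g) (by rw [← mul_assoc, hz, mul_assoc, hzΦ])
      (by rw [mul_assoc, hΦt])
    rw [hh, ← hΦsmul] at h1
    have h2 := hΦinj _ h1
    rw [hh]
    have : h = 0 := (smul_eq_zero.1 h2).resolve_left hx
    rw [this, hΦzero]
  obtain ⟨σ, hσ⟩ := W.mkQ.exists_rightInverse_of_surjective W.range_mkQ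
  let π : (ι → A) →ₗ[A] (ι → A) := σ ∘ₗ W.mkQ
  have hπ1 : ∀ g ∈ W, π g = 0 := fun g hg => by
    have : W.mkQ g = 0 := by simpa using hg
    simp only [π, LinearMap.comp_apply, this, map_zero]
  have hπ2 : ∀ g, g - π g ∈ W := fun g => by
    have h1 : W.mkQ (π g) = W.mkQ g := by
      have := LinearMap.congr_fun hσ (W.mkQ g)
      simpa only [π, LinearMap.comp_apply, LinearMap.id_apply] using this
    rw [← Submodule.Quotient.mk_eq_zero, ← Submodule.mkQ_apply, map_sub, h1, sub_self]
  let δ : ι → ι → A := fun i => Pi.single i 1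
  have hδ : ∀ i, Φ (δ i) = a i := fun i => by
    simp only [Φ, δ]
    rw [Finset.sum_eq_single i]
    · simp
    · intro j _ hj; simp [Pi.single_eq_of_ne hj]
    · simp
  let e := ∑ i, Φ (π (δ i)) * b i
  have heΦ : ∀ g, e * Φ g = Φ (π g) := fun g => by
    have hg : g = ∑ i, g i • δ i := by
      ext j; simp [δ, Finset.sum_apply, Pi.single_apply]
    conv_rhs => rw [hg, map_sum, hΦsum]
    rw [Finset.sum_mul]
    refine Finset.sum_congr rfl fun i _ => ?_
    rw [mul_assoc, hbΦ, map_smul, hΦsmul, ← mul_assoc, hΦt]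
  refine ⟨e, fun x hx => ?_, fun y hy => ?_⟩
  · have h1 : e * z = e := by
      simp only [e, Finset.sum_mul]
      exact Finset.sum_congr rfl fun i _ => by rw [mul_assoc, hbz]
    rw [← h1, mul_assoc, hz, hzdef, Finset.mul_sum, Finset.mul_sum]
    refine Finset.sum_eq_zero fun j _ => ?_
    obtain ⟨g, hg⟩ := himg (x * a j) (by rw [← mul_assoc, hz, mul_assoc, hza])
      (by rw [mul_assoc, hat])
    have hgW : g ∈ W := by
      rw [hWmem]; intro y hy; rw [← hg, ← mul_assoc, hy x hx, zero_mul]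
    rw [← mul_assoc x, hg, ← mul_assoc, heΦ, hπ1 g hgW, hΦzero, zero_mul]
  · simp only [e, hzdef, Finset.mul_sum]
    refine Finset.sum_congr rfl fun i _ => ?_
    have h1 := (hWmem _).1 (hπ2 (δ i)) y hy
    have h2 : Φ (δ i) = Φ (δ i - π (δ i)) + Φ (π (δ i)) := by rw [← hΦadd]; simp
    rw [hδ] at h2
    have h3 : y * a i = y * Φ (π (δ i)) := by rw [h2, mul_add, h1, zero_add]
    rw [← mul_assoc, ← mul_assoc, h3]

lemma laurent_pid (K : Type) [Field K] : IsPrincipalIdealRing (LaurentPolynomial K) := by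
  constructor
  intro I
  have h := IsLocalization.map_under (Submonoid.powers (Polynomial.X : Polynomial K))
    (LaurentPolynomial K) I
  rw [← h]
  obtain ⟨p, hp⟩ := IsPrincipalIdealRing.principal
    (I.under (Polynomial K))
  rw [hp]
  refine ⟨⟨algebraMap _ _ p, ?_⟩⟩
  rw [Ideal.submodule_span_eq, Ideal.map_span]
  simp


end abstractBaer


section reach

variable {V E : Type} {s r : E → V}

/-- reachability -/
def Rch (s r : E → V) (u v : V) : Prop := ∃ l, IsPath s r u l v

lemma Rch.refl (u : V) : Rch s r u u := ⟨[], rfl⟩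

lemma Rch.trans {u v w : V} (h : Rch s r u v) (h' : Rch s r v w) : Rch s r u w := by
  obtain ⟨l, hl⟩ := h
  obtain ⟨m, hm⟩ := h'
  exact ⟨l ++ m, hl.append hm⟩

lemma Rch.edge (e : E) : Rch s r (s e) (r e) := ⟨[e], rfl, rfl⟩

/-- vertices from which one can always come back -/
def UU (s r : E → V) (u : V) : Prop := ∀ w, Rch s r u w → Rch s r w u

lemma UU.of_rch {u v : V} (hu : UU s r u) (h : Rch s r u v) : UU s r v :=
  fun w hw => (hu w (h.trans hw)).trans h

lemma UU.unique (hNE : NE s r) {e f : E} (hu : UU s r (s e)) (h : s e = s f) : e = f :=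
  hNE e f h (hu _ (Rch.edge e))

lemma UU_of_cycle (hNE : NE s r) {e : E} (h : Rch s r (r e) (s e)) : UU s r (s e) := by
  have key : ∀ (l : List E) (w x : V), Rch s r w (s e) → Rch s r (s e) w → IsPath s r w l x →
      Rch s r x (s e) := by
    intro l
    induction l with
    | nil => rintro w x h1 - h2; cases h2; exact h1
    | cons f l ih =>
      rintro w x ⟨m, hm⟩ h1 ⟨rfl, h2⟩
      have h3 : Rch s r (r f) (s e) := by
        cases m with
        | nil =>
          have : e = f := hNE e f (Eq.symm hm) h
          rw [← this]; exact h
        | cons g m =>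
          have h5 : Rch s r (r g) (s e) := ⟨m, hm.2⟩
          have : g = f := hNE g f hm.1.symm (by rw [← hm.1]; exact h5.trans h1)
          rw [← this]; exact h5
      exact ih _ _ h3 (h1.trans (Rch.edge f)) h2
  rintro w ⟨l, hl⟩
  exact key l _ _ (Rch.refl _) (Rch.refl _) hl

lemma exists_edge {v : V} (h : ¬ UU s r v) : ∃ e, s e = v := by
  by_contra hne
  push Not at hne
  apply h
  rintro w ⟨l, hl⟩
  cases l with
  | nil => cases hl; exact Rch.refl _
  | cons e l => exact absurd hl.1.symm (hne e)

/-- mutual reachability -/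
def rset (s r : E → V) : Setoid V where
  r u v := Rch s r u v ∧ Rch s r v u
  iseqv := ⟨fun u => ⟨Rch.refl u, Rch.refl u⟩, fun h => ⟨h.2, h.1⟩,
    fun h h' => ⟨h.1.trans h'.1, h'.2.trans h.2⟩⟩

/-- representatives of terminal components -/
def IsRep (s r : E → V) (t : V) : Prop := UU s r t ∧ (Quotient.mk (rset s r) t).out = t

lemma IsRep.eq {t t' v : V} (h : IsRep s r t) (h' : IsRep s r t') (hv : Rch s r t v)
    (hv' : Rch s r t' v) : t = t' := by
  rw [← h.2, ← h'.2]
  congr 1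
  apply Quotient.sound
  exact ⟨hv.trans (h'.1 _ hv'), hv'.trans (h.1 _ hv)⟩

lemma exists_rep_vertex {v : V} (h : UU s r v) : ∃ t, IsRep s r t ∧ Rch s r v t := by
  have h1 : (rset s r).r (Quotient.mk (rset s r) v).out v := Quotient.mk_out (s := rset s r) v
  refine ⟨(Quotient.mk (rset s r) v).out, ⟨h.of_rch h1.2, ?_⟩, h1.2⟩
  rw [Quotient.out_eq]

end reach

section decomp

variable (K : Type) [Field K] {V E : Type} [Fintype V] [Fintype E] (s r : E → V)

variable {s r} in
lemma UU_path (hNE : NE s r) {u v : V} {l : List E} (hu : UU s r u) (hl : IsPath s r u l v) :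
    PP K s r l * vt K s r v * GG K s r l = vt K s r u := by
  classical
  induction l generalizing u with
  | nil => cases hl; simp
  | cons e l ih =>
    obtain ⟨rfl, h2⟩ := hl
    have h3 := ih (hu.of_rch (Rch.edge e)) h2
    have h4 : PP K s r (e :: l) * vt K s r v * GG K s r (e :: l) =
      ed K s r e * (PP K s r l * vt K s r v * GG K s r l) * gh K s r e := by
      simp [mul_assoc]
    rw [h4, h3, ed_vt, ck2 K s r (s e) ⟨e, rfl⟩]
    have : (Finset.univ.filter fun f => s f = s e) = {e} := by
      ext f
      simp only [Finset.mem_filter, Finset.mem_univ, true_and, Finset.mem_singleton]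
      exact ⟨fun h => (UU.unique hNE hu h.symm).symm, fun h => by rw [h]⟩
    rw [this, Finset.sum_singleton]

/-- decomposition of a vertex -/
def Dec (v : V) : Prop :=
  ∃ (ι : Type) (_ : Fintype ι) (a b : ι → LeavittPathAlgebra K V E s r) (t : ι → V),
    (∀ i, IsRep s r (t i)) ∧ (∀ i, a i * vt K s r (t i) = a i) ∧
    (∀ i, vt K s r (t i) * b i = b i) ∧ (∀ i, vt K s r v * a i = a i) ∧
    (∀ i, b i * vt K s r v = b i) ∧ (∀ i, b i * a i = vt K s r (t i)) ∧
    (∀ i j, i ≠ j → b i * a j = 0) ∧ ∑ i, a i * b i = vt K s r v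

variable {s r} in
lemma Dec_of_UU (hNE : NE s r) {v : V} (hv : UU s r v) : Dec K s r v := by
  classical
  obtain ⟨t, ht, l, hl⟩ := exists_rep_vertex hv
  have e1 := vt_PP_vt K s r v t l
  have e2 := vt_GG_vt K s r v t l
  rw [if_pos hl] at e1 e2
  refine ⟨Unit, inferInstance, fun _ => PP K s r l * vt K s r t, fun _ => vt K s r t * GG K s r l,
    fun _ => t, fun _ => ht, fun _ => ?_, fun _ => ?_, fun _ => ?_, fun _ => ?_, fun _ => ?_,
    fun i j hij => absurd rfl hij, ?_⟩
  · rw [mul_assoc, vt_idem]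
  · rw [← mul_assoc, vt_idem]
  · rw [← mul_assoc, e1]
  · exact e2
  · rw [← mul_assoc]; exact GG_PP_self K s r hl
  · rw [Finset.univ_unique, Finset.sum_singleton, ← mul_assoc, mul_assoc (PP K s r l), vt_idem]
    exact UU_path K hNE hv hl

variable {s r} in
lemma Dec_all (hNE : NE s r) (v : V) : Dec K s r v := by
  classical
  induction hn : (Finset.univ.filter fun w => Rch s r v w).card using Nat.strong_induction_on
    generalizing v with
  | _ n ih =>
  by_cases hv : UU s r v
  · exact Dec_of_UU K hNE hv
  have h1 : ∀ e : {e // s e = v}, Dec K s r (r e.1) := by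
    rintro ⟨e, rfl⟩
    refine ih _ ?_ _ rfl
    rw [← hn]
    apply Finset.card_lt_card
    refine ⟨fun w hw => ?_, fun hh => ?_⟩
    · simp only [Finset.mem_filter, Finset.mem_univ, true_and] at hw ⊢
      exact (Rch.edge e).trans hw
    · have := hh (x := s e) (by simpa using Rch.refl _)
      simp only [Finset.mem_filter, Finset.mem_univ, true_and] at this
      exact hv (UU_of_cycle hNE this)
  choose ι fι a b t k1 k2 k3 k4 k5 k6 k7 k8 using h1
  refine ⟨Σ e, ι e, inferInstance, fun i => ed K s r i.1.1 * a i.1 i.2,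
    fun i => b i.1 i.2 * gh K s r i.1.1, fun i => t i.1 i.2, fun i => k1 _ _, fun i => ?_,
    fun i => ?_, fun i => ?_, fun i => ?_, fun i => ?_, fun i j hij => ?_, ?_⟩
  · rw [mul_assoc, k2]
  · rw [← mul_assoc, k3]
  · rw [← mul_assoc]; congr 1; have := vt_ed K s r i.1.1; rwa [i.1.2] at this
  · rw [mul_assoc]; congr 1; have := gh_vt K s r i.1.1; rwa [i.1.2] at this
  · rw [mul_assoc, ← mul_assoc (gh K s r _), gh_ed, k4, k6]
  · rw [mul_assoc, ← mul_assoc (gh K s r _)]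
    obtain ⟨e, i⟩ := i
    obtain ⟨f, j⟩ := j
    by_cases hef : e = f
    · subst hef
      rw [gh_ed, k4, k7]
      rintro rfl; exact hij rfl
    · rw [gh_ed_ne, zero_mul, mul_zero]
      intro h; exact hef (Subtype.ext h)
  · rw [Fintype.sum_sigma, ck2 K s r v (exists_edge hv), Finset.sum_filter,
      ← Finset.sum_filter, ← Finset.sum_subtype_eq_sum_filter]
    simp only [Finset.subtype_univ]
    refine Finset.sum_congr rfl fun e _ => ?_
    have : ∀ i, ed K s r e.1 * a e i * (b e i * gh K s r e.1) =
      ed K s r e.1 * (a e i * b e i) * gh K s r e.1 := fun i => by simp only [mul_assoc]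
    simp only [this]
    rw [← Finset.sum_mul, ← Finset.mul_sum, k8, ed_vt]

lemma rep_orth {t t' : V} (ht : IsRep s r t) (ht' : IsRep s r t') (hne : t ≠ t')
    (y : LeavittPathAlgebra K V E s r) : vt K s r t * y * vt K s r t' = 0 := by
  classical
  induction mem_span K s r y using Submodule.span_induction with
  | zero => simp
  | add x y _ _ h1 h2 => rw [mul_add, add_mul, h1, h2, add_zero]
  | smul k x _ h => rw [mul_smul_comm, smul_mul_assoc, h, smul_zero]
  | mem x h =>
    obtain ⟨l, v, l', rfl⟩ := h
    have h1 : vt K s r t * (PP K s r l * vt K s r v * GG K s r l') * vt K s r t' =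
      (vt K s r t * PP K s r l * vt K s r v) * (vt K s r v * GG K s r l' * vt K s r t') := by
      simp only [mul_assoc]
      rw [← mul_assoc (vt K s r v) (vt K s r v), vt_idem]
    rw [h1, vt_PP_vt, vt_GG_vt]
    split_ifs with h2 h3
    · exact absurd (ht.eq ht' ⟨_, h2⟩ ⟨_, h3⟩) hne
    all_goals simp

end decomp

section corner

variable (K : Type) [Field K] {V E : Type} [Fintype V] [Fintype E] {s r : E → V}

lemma corner_surj (hNE : NE s r) {t : V} (ht : UU s r t) {A : Type} [CommRing A] [Algebra K A]
    (ψ : A →ₐ[K] LeavittPathAlgebra K V E s r)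
    (h : ∀ l1 l2, IsPath s r t l1 t → IsPath s r t l2 t →
      ∃ x, PP K s r l1 * vt K s r t * GG K s r l2 = vt K s r t * ψ x)
    (y : LeavittPathAlgebra K V E s r) : ∃ x, vt K s r t * y * vt K s r t = vt K s r t * ψ x := by
  classical
  induction mem_span K s r y using Submodule.span_induction with
  | zero => exact ⟨0, by simp⟩
  | add x y _ _ h1 h2 =>
    obtain ⟨a, ha⟩ := h1
    obtain ⟨b, hb⟩ := h2
    exact ⟨a + b, by rw [mul_add, add_mul, ha, hb, map_add, mul_add]⟩
  | smul k x _ h =>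
    obtain ⟨a, ha⟩ := h
    exact ⟨k • a, by rw [mul_smul_comm, smul_mul_assoc, ha, map_smul, mul_smul_comm]⟩
  | mem x hx =>
    obtain ⟨l, v, l', rfl⟩ := hx
    have h1 : vt K s r t * (PP K s r l * vt K s r v * GG K s r l') * vt K s r t =
      (vt K s r t * PP K s r l * vt K s r v) * (vt K s r v * GG K s r l' * vt K s r t) := by
      simp only [mul_assoc]
      rw [← mul_assoc (vt K s r v) (vt K s r v), vt_idem]
    rw [h1, vt_PP_vt, vt_GG_vt]
    split_ifs with h2 h3
    · obtain ⟨m, hm⟩ := ht v ⟨_, h2⟩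
      obtain ⟨x, hx⟩ := h _ _ (h2.append hm) (h3.append hm)
      refine ⟨x, ?_⟩
      rw [← hx, ← mul_assoc, mul_assoc (PP K s r l), vt_idem,
        ← UU_path K hNE (ht.of_rch ⟨_, h2⟩) hm, PP_append, GG_append]
      simp only [mul_assoc]
    all_goals exact ⟨0, by simp⟩

lemma corner_sink (hNE : NE s r) {t : V} (ht : UU s r t) (hs : ∀ e, s e ≠ t) :
    ∃ (A : Type) (_ : CommRing A) (_ : IsDomain A) (_ : IsPrincipalIdealRing A)
      (ψ : A →+* LeavittPathAlgebra K V E s r),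
      (∀ x, ψ x * vt K s r t = vt K s r t * ψ x) ∧ (∀ x, vt K s r t * ψ x = 0 → x = 0) ∧
      ∀ y, ∃ x, vt K s r t * y * vt K s r t = vt K s r t * ψ x := by
  refine ⟨K, inferInstance, inferInstance, inferInstance,
    (Algebra.ofId K (LeavittPathAlgebra K V E s r)).toRingHom, fun x => ?_, fun x hx => ?_, ?_⟩
  · exact Algebra.commutes x _
  · by_contra hx0
    apply vt_ne_zero K s r t
    have h1 : vt K s r t * algebraMap K _ x = 0 := hx
    have h2 : x • vt K s r t = 0 := by rw [Algebra.smul_def, Algebra.commutes, h1]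
    exact (smul_eq_zero.1 h2).resolve_left hx0
  · have hnil : ∀ l, IsPath s r t l t → l = [] := by
      intro l hl
      cases l with
      | nil => rfl
      | cons e l => exact absurd hl.1.symm (hs e)
    refine corner_surj K hNE ht (Algebra.ofId K (LeavittPathAlgebra K V E s r)) ?_
    intro l1 l2 h1 h2
    rw [hnil l1 h1, hnil l2 h2]
    exact ⟨1, by simp⟩

lemma follow (hNE : NE s r) {t : V} {l0 l1 : List E} {w : V} (hw : UU s r w)
    (h0 : IsPath s r w l0 t) (hs : t ∉ l0.map s) (h1 : IsPath s r w l1 t) :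
    ∃ l2, l1 = l0 ++ l2 ∧ IsPath s r t l2 t := by
  induction l0 generalizing w l1 with
  | nil => cases h0; exact ⟨l1, rfl, h1⟩
  | cons f l0 ih =>
    obtain ⟨rfl, h0⟩ := h0
    cases l1 with
    | nil => exact absurd (by rw [← show s f = t from h1]; simp) hs
    | cons g l1 =>
      have hfg : f = g := UU.unique hNE hw h1.1
      subst hfg
      obtain ⟨l2, h2, h3⟩ := ih (hw.of_rch (Rch.edge f)) h0
        (fun h => hs (by rw [List.map_cons]; exact List.mem_cons_of_mem _ h)) h1.2
      exact ⟨l2, by rw [h2]; rfl, h3⟩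

lemma closed_lpow (hNE : NE s r) {e : E} {l0 : List E} (hu : UU s r (s e))
    (h0 : IsPath s r (r e) l0 (s e)) (hs : s e ∉ l0.map s) (l1 : List E)
    (h1 : IsPath s r (s e) l1 (s e)) : ∃ n, l1 = lpow (e :: l0) n := by
  induction hn : l1.length using Nat.strong_induction_on generalizing l1 with
  | _ n ih =>
  cases l1 with
  | nil => exact ⟨0, rfl⟩
  | cons g l1 =>
    have hfg : e = g := UU.unique hNE hu h1.1
    subst hfg
    obtain ⟨l2, rfl, h3⟩ := follow hNE (hu.of_rch (Rch.edge e)) h0 hs h1.2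
    obtain ⟨m, hm⟩ := ih l2.length (by rw [← hn]; simp only [List.length_cons, List.length_append]; omega) l2 h3 rfl
    exact ⟨m + 1, by rw [hm]; rfl⟩

open LaurentPolynomial in
lemma corner_cycle (hNE : NE s r) {e : E} (ht : UU s r (s e)) :
    ∃ (A : Type) (_ : CommRing A) (_ : IsDomain A) (_ : IsPrincipalIdealRing A)
      (ψ : A →+* LeavittPathAlgebra K V E s r),
      (∀ x, ψ x * vt K s r (s e) = vt K s r (s e) * ψ x) ∧
      (∀ x, vt K s r (s e) * ψ x = 0 → x = 0) ∧
      ∀ y, ∃ x, vt K s r (s e) * y * vt K s r (s e) = vt K s r (s e) * ψ x := by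
  classical
  obtain ⟨l, hl⟩ := ht _ (Rch.edge e)
  obtain ⟨l0, h0, -, hs⟩ := exists_simple hl
  have hc0 : IsPath s r (s e) (e :: l0) (s e) := ⟨rfl, h0⟩
  have hlp := closed_lpow hNE ht h0 hs
  set t := vt K s r (s e) with htdef
  have htt : t * t = t := vt_idem K s r _
  obtain ⟨c, hc⟩ : ∃ c, c = PP K s r (e :: l0) * t := ⟨_, rfl⟩
  obtain ⟨c', hc'⟩ : ∃ c', c' = t * GG K s r (e :: l0) := ⟨_, rfl⟩
  have hct : c * t = c := by rw [hc, mul_assoc, htt]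
  have htc : t * c = c := by
    have := vt_PP_vt K s r (s e) (s e) (e :: l0)
    rw [if_pos hc0] at this
    rw [hc, ← mul_assoc]; exact this
  have htc' : t * c' = c' := by rw [hc', ← mul_assoc, htt]
  have hct' : c' * t = c' := by
    have := vt_GG_vt K s r (s e) (s e) (e :: l0)
    rw [if_pos hc0] at this
    rw [hc']; exact this
  have hcc : c * c' = t := by
    rw [hc, hc', ← mul_assoc, mul_assoc _ t t, htt]
    exact UU_path K hNE ht hc0
  have hcc' : c' * c = t := by
    rw [hc, hc', ← mul_assoc]
    exact GG_PP_self K s r hc0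
  let u : (LeavittPathAlgebra K V E s r)ˣ :=
    { val := c + (1 - t)
      inv := c' + (1 - t)
      val_inv := by
        simp only [mul_add, add_mul, mul_sub, sub_mul, one_mul, mul_one, htt, hct, htc, htc', hct',
          hcc]
        abel
      inv_val := by
        simp only [mul_add, add_mul, mul_sub, sub_mul, one_mul, mul_one, htt, hct, htc, htc', hct',
          hcc']
        abel }
  have hu : (u : LeavittPathAlgebra K V E s r) = c + (1 - t) := rfl
  have hui : ((u⁻¹ : (LeavittPathAlgebra K V E s r)ˣ) : LeavittPathAlgebra K V E s r) =
    c' + (1 - t) := rfl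
  have htu : t * u = c := by rw [hu, mul_add, mul_sub, htc, htt]; simp
  have hut : u * t = c := by rw [hu, add_mul, sub_mul, hct, htt]; simp
  have hcm : ∀ n : ℤ, Commute t ((u ^ n : (LeavittPathAlgebra K V E s r)ˣ) :
      LeavittPathAlgebra K V E s r) := fun n =>
    Commute.units_zpow_right (show Commute t (u : LeavittPathAlgebra K V E s r) from
      htu.trans hut.symm) n
  have huit : ((u⁻¹ : (LeavittPathAlgebra K V E s r)ˣ) : LeavittPathAlgebra K V E s r) * t
    = c' := by rw [hui, add_mul, sub_mul, hct', htt]; simp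
  let ψ : K[T;T⁻¹] →ₐ[K] LeavittPathAlgebra K V E s r :=
    AddMonoidAlgebra.lift K (LeavittPathAlgebra K V E s r) ℤ
      ((Units.coeHom (LeavittPathAlgebra K V E s r)).comp (zpowersHom _ u))
  have hψT : ∀ n : ℤ, ψ (T n) = ((u ^ n : (LeavittPathAlgebra K V E s r)ˣ) :
      LeavittPathAlgebra K V E s r) := by
    intro n
    have h : (T n : K[T;T⁻¹]) = AddMonoidAlgebra.single n 1 := rfl
    rw [h, AddMonoidAlgebra.lift_single, one_smul]
    rfl
  have hψCT : ∀ (n : ℤ) (k : K), ψ (C k * T n) =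
      k • ((u ^ n : (LeavittPathAlgebra K V E s r)ˣ) : LeavittPathAlgebra K V E s r) := by
    intro n k
    rw [← LaurentPolynomial.smul_eq_C_mul, map_smul, hψT]
  have hψcomm : ∀ x, ψ x * t = t * ψ x := by
    intro x
    induction x using LaurentPolynomial.induction_on' with
    | add p q hp hq => rw [map_add, add_mul, mul_add, hp, hq]
    | C_mul_T n k => rw [hψCT, smul_mul_assoc, mul_smul_comm, (hcm n).eq]
  refine ⟨K[T;T⁻¹], inferInstance, inferInstance, laurent_pid K, ψ.toRingHom, hψcomm, ?_, ?_⟩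
  · -- injectivity
    have hTu : (T 1 : K[T;T⁻¹]) * T (-1) = 1 := by rw [← T_add]; simp
    have hTu' : (T (-1) : K[T;T⁻¹]) * T 1 = 1 := by rw [← T_add]; simp
    obtain ⟨ρ, hρ⟩ := exists_rep (A := K[T;T⁻¹]) K s r
      (fun f => if f = e then ⟨T 1, T (-1), hTu, hTu'⟩ else 1)
    have hpath : ∀ (l : List E) (w : V), UU s r w → IsPath s r w l (s e) → s e ∉ l.map s →
        ∀ a : K[T;T⁻¹], ρ (PP K s r l) (a • xi K[T;T⁻¹] (s e)) = a • xi K[T;T⁻¹] w := by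
      intro l
      induction l with
      | nil => intro w _ hw _ a; cases hw; simp
      | cons f l ih =>
        rintro w hw ⟨rfl, h2⟩ hn a
        have hne : f ≠ e := by rintro rfl; simp at hn
        rw [PP_cons, map_mul, Module.End.mul_apply, ih _ (hw.of_rch (Rch.edge f)) h2
          (fun h => hn (by rw [List.map_cons]; exact List.mem_cons_of_mem _ h)) a,
          (hρ a).2.2 f (fun g hg => UU.unique hNE hw hg), if_neg hne]
        simp
    have hρt : ∀ a : K[T;T⁻¹], ρ t (a • xi K[T;T⁻¹] (s e)) = a • xi K[T;T⁻¹] (s e) :=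
      fun a => (hρ a).1 _
    have hρu : ∀ a : K[T;T⁻¹], ρ u (a • xi K[T;T⁻¹] (s e)) = (T 1 * a) • xi K[T;T⁻¹] (s e) := by
      intro a
      rw [hu, hc, map_add, map_sub, map_mul, map_one, LinearMap.add_apply, Module.End.mul_apply,
        LinearMap.sub_apply, Module.End.one_apply, hρt, sub_self, add_zero, PP_cons, map_mul,
        Module.End.mul_apply, hpath l0 _ (ht.of_rch (Rch.edge e)) h0 hs,
        (hρ a).2.2 e (fun g hg => UU.unique hNE ht hg), if_pos rfl]
    have hρui : ∀ a : K[T;T⁻¹], ρ ((u⁻¹ : (LeavittPathAlgebra K V E s r)ˣ) :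
        LeavittPathAlgebra K V E s r) (a • xi K[T;T⁻¹] (s e)) =
        (T (-1) * a) • xi K[T;T⁻¹] (s e) := by
      intro a
      have h1 := hρu (T (-1) * a)
      rw [← mul_assoc, hTu, one_mul] at h1
      rw [← h1, ← Module.End.mul_apply, ← map_mul, Units.inv_mul, map_one, Module.End.one_apply]
    have hρz : ∀ (n : ℤ) (a : K[T;T⁻¹]), ρ ((u ^ n : (LeavittPathAlgebra K V E s r)ˣ) :
        LeavittPathAlgebra K V E s r) (a • xi K[T;T⁻¹] (s e)) =
        (T n * a) • xi K[T;T⁻¹] (s e) := by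
      intro n
      induction n using Int.induction_on with
      | zero => intro a; simp
      | succ n ih =>
        intro a
        rw [zpow_add_one, Units.val_mul, map_mul, Module.End.mul_apply, hρu, ih, ← mul_assoc,
          ← T_add]
      | pred n ih =>
        intro a
        rw [zpow_sub_one, Units.val_mul, map_mul, Module.End.mul_apply, hρui, ih, ← mul_assoc,
          ← T_add, sub_eq_add_neg]
    have hρψ : ∀ x a : K[T;T⁻¹], ρ (ψ x) (a • xi K[T;T⁻¹] (s e)) =
        (x * a) • xi K[T;T⁻¹] (s e) := by
      intro x a
      induction x using LaurentPolynomial.induction_on' with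
      | add p q hp hq => rw [map_add, map_add, LinearMap.add_apply, hp, hq, add_mul, add_smul]
      | C_mul_T n k =>
        rw [hψCT, map_smul ρ, LinearMap.smul_apply, hρz, ← LaurentPolynomial.smul_eq_C_mul,
          smul_mul_assoc, smul_assoc]
    intro x hx
    have h1 : t * ψ x = 0 := hx
    have h2 := hρψ x 1
    rw [← hρt 1, ← Module.End.mul_apply, ← map_mul, hψcomm, h1, map_zero, mul_one] at h2
    exact xi_smul_inj h2.symm
  · refine corner_surj K hNE ht ψ ?_
    intro l1 l2 h1 h2
    obtain ⟨i, rfl⟩ := hlp l1 h1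
    obtain ⟨j, rfl⟩ := hlp l2 h2
    have hP : ∀ n : ℕ, PP K s r (lpow (e :: l0) n) * t = t * (u : LeavittPathAlgebra K V E s r) ^ n := by
      intro n
      induction n with
      | zero => simp [lpow]
      | succ n ih =>
        rw [lpow, PP_append, mul_assoc, ih, ← mul_assoc, ← hc, ← htu, pow_succ', mul_assoc]
    have hG : ∀ n : ℕ, t * GG K s r (lpow (e :: l0) n) =
        ((u⁻¹ : (LeavittPathAlgebra K V E s r)ˣ) : LeavittPathAlgebra K V E s r) ^ n * t := by
      intro n
      induction n with
      | zero => simp [lpow]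
      | succ n ih =>
        rw [lpow, GG_append, ← mul_assoc, ih, mul_assoc, ← hc', ← huit, pow_succ, mul_assoc]
    refine ⟨T (i - j), ?_⟩
    have h3 : PP K s r (lpow (e :: l0) i) * t * GG K s r (lpow (e :: l0) j) =
      (PP K s r (lpow (e :: l0) i) * t) * (t * GG K s r (lpow (e :: l0) j)) := by
      rw [← mul_assoc, mul_assoc _ t t, htt]
    have h4 : (u : LeavittPathAlgebra K V E s r) ^ i *
      ((u⁻¹ : (LeavittPathAlgebra K V E s r)ˣ) : LeavittPathAlgebra K V E s r) ^ j =
      ((u ^ ((i : ℤ) - j) : (LeavittPathAlgebra K V E s r)ˣ) : LeavittPathAlgebra K V E s r) := by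
      rw [← Units.val_pow_eq_pow_val, ← Units.val_pow_eq_pow_val, ← Units.val_mul, zpow_sub]
      simp
    rw [h3, hP, hG, hψT, mul_assoc, ← mul_assoc (_ ^ i), h4, ← (hcm _).eq, ← mul_assoc, htt]

end corner

section final

variable (K : Type) [Field K] {V E : Type} [Fintype V] [Fintype E] {s r : E → V}

lemma corner_exists (hNE : NE s r) {t : V} (ht : UU s r t) :
    ∃ (A : Type) (_ : CommRing A) (_ : IsDomain A) (_ : IsPrincipalIdealRing A)
      (ψ : A →+* LeavittPathAlgebra K V E s r),
      (∀ x, ψ x * vt K s r t = vt K s r t * ψ x) ∧ (∀ x, vt K s r t * ψ x = 0 → x = 0) ∧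
      ∀ y, ∃ x, vt K s r t * y * vt K s r t = vt K s r t * ψ x := by
  by_cases h : ∃ e, s e = t
  · obtain ⟨e, rfl⟩ := h
    exact corner_cycle K hNE ht
  · push Not at h
    exact corner_sink K hNE ht h

lemma baer_of_NE (hNE : NE s r) (X : Set (LeavittPathAlgebra K V E s r)) :
    ∃ e : LeavittPathAlgebra K V E s r, e * e = e ∧
      ∀ a : LeavittPathAlgebra K V E s r,
        (∀ x ∈ X, a * x = 0) ↔ ∃ y : LeavittPathAlgebra K V E s r, a = y * e := by
  classical
  choose ι fι a b t k1 k2 k3 k4 k5 k6 k7 k8 using Dec_all K hNE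
  let A : (Σ v, ι v) → LeavittPathAlgebra K V E s r := fun i => a i.1 i.2
  let B : (Σ v, ι v) → LeavittPathAlgebra K V E s r := fun i => b i.1 i.2
  let τ : (Σ v, ι v) → {t // IsRep s r t} := fun i => ⟨t i.1 i.2, k1 _ _⟩
  have hsum : ∑ i, A i * B i = 1 := by
    rw [one_eq, Fintype.sum_sigma]
    exact Finset.sum_congr rfl fun v _ => k8 v
  have horth : ∀ i j, i ≠ j → B i * A j = 0 := by
    rintro ⟨v, i⟩ ⟨w, j⟩ hij
    change b v i * a w j = 0
    by_cases hvw : v = w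
    · subst hvw
      apply k7
      rintro rfl; exact hij rfl
    · rw [← k5 v i, ← k4 w j, mul_assoc, ← mul_assoc (vt K s r v), vt_orth K s r hvw, zero_mul,
        mul_zero]
  have hBA : ∀ i, B i * A i = vt K s r (τ i).1 := fun i => k6 _ _
  have hAt : ∀ i, A i * vt K s r (τ i).1 = A i := fun i => k2 _ _
  have htB : ∀ i, vt K s r (τ i).1 * B i = B i := fun i => k3 _ _
  let z : {t // IsRep s r t} → LeavittPathAlgebra K V E s r :=
    fun t => ∑ i : {i // τ i = t}, A i * B i
  have hz1 : ∑ t, z t = 1 := by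
    rw [← hsum]
    exact Fintype.sum_fiberwise τ fun i => A i * B i
  have hzz : ∀ t t', t ≠ t' → ∀ y, z t * y * z t' = 0 := by
    intro t t' hne y
    simp only [z, Finset.sum_mul, Finset.mul_sum]
    refine Finset.sum_eq_zero fun j _ => Finset.sum_eq_zero fun i _ => ?_
    obtain ⟨i, hi⟩ := i
    obtain ⟨j, hj⟩ := j
    have h1 : B i * y * A j = 0 := by
      rw [← htB i, ← hAt j, hi, hj]
      have : vt K s r t.1 * B i * y * (A j * vt K s r t'.1) =
        vt K s r t.1 * (B i * y * A j) * vt K s r t'.1 := by simp only [mul_assoc]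
      rw [this]
      exact rep_orth K s r t.2 t'.2 (fun h => hne (Subtype.ext h)) _
    have h2 : A i * B i * y * (A j * B j) = A i * (B i * y * A j) * B j := by
      simp only [mul_assoc]
    rw [h2, h1, mul_zero, zero_mul]
  have hcen : ∀ t y, z t * y = y * z t := by
    intro t y
    have h1 : z t * y = z t * y * z t := by
      conv_lhs => rw [← mul_one (z t * y), ← hz1, Finset.mul_sum]
      rw [Finset.sum_eq_single t]
      · intro t' _ h; exact hzz _ _ h.symm _
      · simp
    have h2 : y * z t = z t * y * z t := by
      conv_lhs => rw [← one_mul (y * z t), ← hz1, Finset.sum_mul]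
      rw [Finset.sum_eq_single t]
      · rw [mul_assoc]
      · intro t' _ h; rw [← mul_assoc]; exact hzz _ _ h _
      · simp
    rw [h1, h2]
  have hmain : ∀ t : {t // IsRep s r t}, ∃ e, (∀ x ∈ X, e * x = 0) ∧
      ∀ y, (∀ x ∈ X, y * x = 0) → y * e = y * z t := by
    intro t
    obtain ⟨R, _, _, _, ψ, q1, q2, q3⟩ := corner_exists K hNE t.2.1
    refine corner_baer ψ (vt K s r t.1) q1 q2 q3 (fun i : {i // τ i = t} => A i) (fun i => B i)
      ?_ ?_ ?_ ?_ (hcen t) X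
    · rintro ⟨i, rfl⟩; exact hBA i
    · intro i j hij; exact horth _ _ fun h => hij (Subtype.ext h)
    · rintro ⟨i, rfl⟩; exact hAt i
    · rintro ⟨i, rfl⟩; exact htB i
  choose e he1 he2 using hmain
  have hx : ∀ x ∈ X, (∑ t, e t) * x = 0 := fun x hx => by
    rw [Finset.sum_mul]; exact Finset.sum_eq_zero fun t _ => he1 t x hx
  have hy : ∀ y, (∀ x ∈ X, y * x = 0) → y * (∑ t, e t) = y := fun y hy => by
    rw [Finset.mul_sum, Finset.sum_congr rfl fun t _ => he2 t y hy, ← Finset.mul_sum, hz1, mul_one]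
  refine ⟨∑ t, e t, hy _ hx, fun y => ⟨fun h => ⟨y, (hy y h).symm⟩, ?_⟩⟩
  rintro ⟨w, rfl⟩ x hxX
  rw [mul_assoc, hx x hxX, mul_zero]

end final

end LPAux

/-- For a finite directed graph `E` and a field `K`, no cycle in `E` has
an exit if and only if the Leavitt path algebra `L = L_K(E)` is a Baer ring: for every
subset `X` of `L` the left annihilator of `X` equals `L e` for some idempotent `e`. -/
theorem lpa_noExitCycles_iff_Baer (K V E : Type) [Field K] [Fintype V] [Fintype E]
    (s r : E → V) :
    (∀ es : List E, IsCycle s r es → ¬ HasExit s r es) ↔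
      ∀ X : Set (LeavittPathAlgebra K V E s r),
        ∃ e : LeavittPathAlgebra K V E s r, e * e = e ∧
          ∀ a : LeavittPathAlgebra K V E s r,
            (∀ x ∈ X, a * x = 0) ↔ ∃ y : LeavittPathAlgebra K V E s r, a = y * e := by
  rw [LPAux.noExit_iff]
  exact ⟨LPAux.baer_of_NE K, LPAux.NE_of_baer K s r⟩
end

section
/- Let E be a finite directed graph (E⁰ and E¹ both finite) and K a field, and let L = L_K(E) be the (unital) Leavitt path algebra. Then no cycle in E has an exit if and only if L has bounded index of nilpotence, i.e., there exists a positive integer n such that aⁿ = 0 for every nilpotent element a ∈ L. -/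
theorem lpa_matrix_pow {C : Type} [CommRing C] [IsDomain C] (N : ℕ)
    (M : Matrix (Fin N) (Fin N) C) (h : IsNilpotent M) : M ^ N = 0 := by
  have h1 := Matrix.isNilpotent_charpoly_sub_pow_of_isNilpotent h
  have h2 := h1.eq_zero
  have h3 := M.aeval_self_charpoly
  rw [sub_eq_zero] at h2
  rw [h2] at h3
  simpa using h3

theorem lpa_bounded_abstract {R : Type} [Ring R] {W : Type} (om : W → R)
    (hidem : ∀ w, om w * om w = om w)
    (horth : ∀ w w', w ≠ w' → ∀ a, om w * a * om w' = 0)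
    (C : W → Type) [∀ w, CommRing (C w)] [∀ w, IsDomain (C w)]
    (ψ : ∀ w, C w →ₙ+* R) (hinj : ∀ w, Function.Injective (ψ w))
    (hsurj : ∀ w a, ∃ c, ψ w c = om w * a * om w)
    (N : ℕ) (x y : Fin N → R) (t : Fin N → W) (hone : ∑ i, x i * om (t i) * y i = 1)
    (a : R) (ha : IsNilpotent a) : a ^ (N + 1) = 0 := by
  classical
  choose κ hκ using hsurj
  let B : R → ∀ w, Matrix (Fin N) (Fin N) (C w) := fun b w =>
    fun i j => if t i = w ∧ t j = w then κ w (y i * b * x j) else 0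
  have hB : ∀ b w i j, ψ w (B b w i j) =
      if t i = w ∧ t j = w then om w * (y i * b * x j) * om w else 0 := by
    intro b w i j
    simp only [B]
    split_ifs
    · rw [hκ]
    · simp
  have hmul : ∀ b c w, B b w * B c w = B (b * c) w := by
    intro b c w
    ext i k
    apply hinj
    rw [Matrix.mul_apply, map_sum, hB]
    simp only [map_mul, hB]
    by_cases hi : t i = w
    · by_cases hk : t k = w
      · simp only [hi, hk, and_self, true_and, and_true, if_true]
        have : om w * (y i * (b * c) * x k) * om w =
            om w * (y i * (b * (∑ i, x i * om (t i) * y i) * c) * x k) * om w := by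
          rw [hone]; simp [mul_assoc]
        rw [this]
        simp only [Finset.mul_sum, Finset.sum_mul]
        apply Finset.sum_congr rfl
        intro j _
        split_ifs with hj
        · rw [hj]
          simp only [mul_assoc]
          rw [← mul_assoc (om w) (om w), hidem]
        · have := horth w (t j) (Ne.symm hj) (y i * b * x j)
          simp only [zero_mul]
          calc (0 : R) = om w * (y i * b * x j) * om (t j) * (y j * c * x k * om w) := by
                rw [this, zero_mul]
            _ = _ := by simp only [mul_assoc]
      · simp [hk]
    · simp [hi]
  have hpow : ∀ b w k, B b w ^ (k + 1) = B (b ^ (k + 1)) w := by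
    intro b w k
    induction k with
    | zero => simp
    | succ k ih => rw [pow_succ, ih, hmul, ← pow_succ]
  have hz : ∀ w, B 0 w = 0 := by
    intro w; ext i j; apply hinj; rw [hB]; simp
  obtain ⟨m, hm⟩ := ha
  have hnil : ∀ w, B a w ^ (N + 1) = 0 := by
    intro w
    rw [pow_succ, lpa_matrix_pow, zero_mul]
    exact ⟨m + 1, by rw [hpow, pow_succ, hm, zero_mul, hz]⟩
  have key : ∀ i j, om (t i) * (y i * a ^ (N + 1) * x j) * om (t j) = 0 := by
    intro i j
    by_cases hij : t i = t j
    · have h := hB (a ^ (N + 1)) (t j) i j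
      rw [← hpow, hnil] at h
      simp [hij] at h
      rw [hij, ← h]
    · exact horth _ _ hij _
  calc a ^ (N + 1) = 1 * a ^ (N + 1) * 1 := by simp
    _ = ∑ i, ∑ j, x i * (om (t i) * (y i * a ^ (N + 1) * x j) * om (t j)) * y j := by
      rw [← hone]
      simp only [Finset.mul_sum, Finset.sum_mul]
      rw [Finset.sum_comm]
      simp only [mul_assoc]
    _ = 0 := by simp [key]

theorem lpa_unbounded_abstract {R : Type} [Ring R] (x y : R) (hyx : y * x = 1) (hxy : x * y ≠ 1)
    (n : ℕ) : ∃ a : R, IsNilpotent a ∧ a ^ n ≠ 0 := by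
  obtain ⟨g, hg⟩ : ∃ g, g = 1 - x * y := ⟨_, rfl⟩
  have hg0 : g ≠ 0 := by
    intro h; apply hxy; rw [h] at hg; exact (sub_eq_zero.mp hg.symm).symm
  have hgx : g * x = 0 := by rw [hg, sub_mul, mul_assoc, hyx]; simp
  have hyg : y * g = 0 := by rw [hg, mul_sub, ← mul_assoc, hyx]; simp
  have hgg : g * g = g := by
    nth_rewrite 2 [hg]
    rw [mul_sub, ← mul_assoc, hgx]; simp
  have hp : ∀ j, y ^ j * x ^ j = 1 := by
    intro j
    induction j with
    | zero => simp
    | succ j ih =>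
      rw [pow_succ, pow_succ', mul_assoc, ← mul_assoc y x, hyx, one_mul, ih]
  have hmid : ∀ i j, g * y ^ j * (x ^ i * g) = if i = j then g else 0 := by
    intro i j
    rcases lt_trichotomy i j with h | h | h
    · obtain ⟨k, rfl⟩ := Nat.exists_eq_add_of_lt h
      rw [if_neg (by omega), show i + k + 1 = (k + 1) + i by ring, pow_add]
      rw [mul_assoc, mul_assoc, ← mul_assoc (y ^ i), hp, one_mul, pow_succ, mul_assoc, hyg]
      simp
    · subst h
      rw [if_pos rfl, mul_assoc, ← mul_assoc (y ^ i), hp, one_mul, hgg]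
    · obtain ⟨k, rfl⟩ := Nat.exists_eq_add_of_lt h
      rw [if_neg (by omega), show j + k + 1 = j + (k + 1) by ring, pow_add]
      rw [mul_assoc, ← mul_assoc (y ^ j), ← mul_assoc (y ^ j), hp, one_mul, ← mul_assoc,
        pow_succ', ← mul_assoc, hgx]
      simp
  obtain ⟨a, ha⟩ : ∃ a, a = ∑ i ∈ Finset.range n, x ^ i * g * y ^ (i + 1) := ⟨_, rfl⟩
  have hstep : ∀ j, g * y ^ j * a = if j < n then g * y ^ (j + 1) else 0 := by
    intro j
    rw [ha, Finset.mul_sum]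
    have : ∀ i, g * y ^ j * (x ^ i * g * y ^ (i + 1)) = if i = j then g * y ^ (i + 1) else 0 := by
      intro i
      rw [← mul_assoc, hmid]
      split_ifs <;> simp
    simp only [this]
    simp
  have hpow : ∀ k j, g * y ^ j * a ^ k = if k = 0 ∨ j + k ≤ n then g * y ^ (j + k) else 0 := by
    intro k
    induction k with
    | zero => intro j; simp
    | succ k ih =>
      intro j
      rw [pow_succ', ← mul_assoc, hstep]
      by_cases h : j < n
      · rw [if_pos h, ih, show j + 1 + k = j + (k + 1) by ring]
        congr 1
        simp only [eq_iff_iff]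
        omega
      · rw [if_neg h, if_neg (by omega), zero_mul]
  refine ⟨a, ⟨n + 1, ?_⟩, ?_⟩
  · rw [pow_succ']
    nth_rewrite 1 [ha]
    rw [Finset.sum_mul]
    apply Finset.sum_eq_zero
    intro i _
    rw [mul_assoc, mul_assoc, ← mul_assoc g, hpow]
    by_cases h : n = 0
    · simp_all
    · rw [if_neg (by omega), mul_zero]
  · intro h0
    have h := hpow n 0
    rw [h0] at h
    simp at h
    apply hg0
    have := congrArg (· * x ^ n) h
    simp only [mul_assoc, hp, mul_one, zero_mul] at this
    exact this.symm
set_option linter.unusedVariables false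
set_option linter.unusedSectionVars false
namespace LPA

variable (K V E : Type) [Field K] [Fintype V] [Fintype E] (s r : E → V)

noncomputable def vv (v : V) : LeavittPathAlgebra K V E s r :=
  RingQuot.mkAlgHom K (LPARel K V E s r) (FreeAlgebra.ι K (LPAGen.vertex v))
noncomputable def ee (e : E) : LeavittPathAlgebra K V E s r :=
  RingQuot.mkAlgHom K (LPARel K V E s r) (FreeAlgebra.ι K (LPAGen.edge e))
noncomputable def gg (e : E) : LeavittPathAlgebra K V E s r :=
  RingQuot.mkAlgHom K (LPARel K V E s r) (FreeAlgebra.ι K (LPAGen.ghost e))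

theorem vv_orth (v w : V) (h : v ≠ w) : vv K V E s r v * vv K V E s r w = 0 := by
  simpa [vv] using RingQuot.mkAlgHom_rel K (LPARel.vertex_orth (K := K) (s := s) (r := r) v w h)
theorem vv_idem (v : V) : vv K V E s r v * vv K V E s r v = vv K V E s r v := by
  simpa [vv] using RingQuot.mkAlgHom_rel K (LPARel.vertex_idem (K := K) (s := s) (r := r) v)
theorem ee_src (e : E) : vv K V E s r (s e) * ee K V E s r e = ee K V E s r e := by
  simpa [vv, ee] using RingQuot.mkAlgHom_rel K (LPARel.edge_src (K := K) (s := s) (r := r) e)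
theorem ee_rng (e : E) : ee K V E s r e * vv K V E s r (r e) = ee K V E s r e := by
  simpa [vv, ee] using RingQuot.mkAlgHom_rel K (LPARel.edge_rng (K := K) (s := s) (r := r) e)
theorem gg_rng (e : E) : vv K V E s r (r e) * gg K V E s r e = gg K V E s r e := by
  simpa [vv, gg] using RingQuot.mkAlgHom_rel K (LPARel.ghost_rng (K := K) (s := s) (r := r) e)
theorem gg_src (e : E) : gg K V E s r e * vv K V E s r (s e) = gg K V E s r e := by
  simpa [vv, gg] using RingQuot.mkAlgHom_rel K (LPARel.ghost_src (K := K) (s := s) (r := r) e)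
theorem gg_ee_ne (e f : E) (h : e ≠ f) : gg K V E s r e * ee K V E s r f = 0 := by
  simpa [ee, gg] using
    RingQuot.mkAlgHom_rel K (LPARel.ck1_distinct (K := K) (s := s) (r := r) e f h)
theorem gg_ee (e : E) : gg K V E s r e * ee K V E s r e = vv K V E s r (r e) := by
  simpa [vv, ee, gg] using RingQuot.mkAlgHom_rel K (LPARel.ck1_same (K := K) (s := s) (r := r) e)
theorem ck2 [DecidableEq V] (v : V) (e : E) (h : s e = v) :
    vv K V E s r v = ∑ e with s e = v, ee K V E s r e * gg K V E s r e := by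
  have h1 := RingQuot.mkAlgHom_rel K
    (LPARel.ck2 (K := K) (s := s) (r := r) v (Set.toFinite _) ⟨e, h⟩)
  rw [map_sum] at h1
  simp only [map_mul] at h1
  rw [vv, h1]
  apply Finset.sum_congr
  · ext; simp
  · intros; rfl
theorem one_eq : (1 : LeavittPathAlgebra K V E s r) = ∑ v, vv K V E s r v := by
  have h1 := RingQuot.mkAlgHom_rel K (LPARel.unit (K := K) (E := E) (s := s) (r := r))
  simpa [map_sum, vv] using h1

theorem exists_lift {A : Type} [Semiring A] [Algebra K A] [DecidableEq V]
    (fv : V → A) (fe fg : E → A)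
    (h1 : ∀ v w, v ≠ w → fv v * fv w = 0) (h2 : ∀ v, fv v * fv v = fv v)
    (h3 : ∀ e, fv (s e) * fe e = fe e) (h4 : ∀ e, fe e * fv (r e) = fe e)
    (h5 : ∀ e, fv (r e) * fg e = fg e) (h6 : ∀ e, fg e * fv (s e) = fg e)
    (h7 : ∀ e f, e ≠ f → fg e * fe f = 0) (h8 : ∀ e, fg e * fe e = fv (r e))
    (h9 : ∀ v e, s e = v → fv v = ∑ e with s e = v, fe e * fg e)
    (h10 : 1 = ∑ v, fv v) :
    ∃ F : LeavittPathAlgebra K V E s r →ₐ[K] A, (∀ v, F (vv K V E s r v) = fv v) ∧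
      (∀ e, F (ee K V E s r e) = fe e) ∧ (∀ e, F (gg K V E s r e) = fg e) := by
  let f : FreeAlgebra K (LPAGen V E) →ₐ[K] A := FreeAlgebra.lift K
    (fun x => match x with
      | .vertex v => fv v
      | .edge e => fe e
      | .ghost e => fg e)
  have hf : ∀ ⦃x y⦄, LPARel K V E s r x y → f x = f y := by
    intro x y h
    cases h with
    | vertex_orth v w h => simpa [f] using h1 v w h
    | vertex_idem v => simpa [f] using h2 v
    | edge_src e => simpa [f] using h3 e
    | edge_rng e => simpa [f] using h4 e
    | ghost_rng e => simpa [f] using h5 e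
    | ghost_src e => simpa [f] using h6 e
    | ck1_distinct e f' h => simpa [f] using h7 e f' h
    | ck1_same e => simpa [f] using h8 e
    | ck2 v h hne =>
      obtain ⟨e, he⟩ := hne
      rw [map_sum]
      simp only [map_mul, f, FreeAlgebra.lift_ι_apply]
      rw [h9 v e he]
      apply Finset.sum_congr
      · ext; simp
      · intros; rfl
    | unit => rw [map_sum, map_one]; simpa [f] using h10
  refine ⟨RingQuot.liftAlgHom K ⟨f, hf⟩, ?_, ?_, ?_⟩
  · intro v; rw [vv, RingQuot.liftAlgHom_mkAlgHom_apply]; simp [f]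
  · intro v; rw [ee, RingQuot.liftAlgHom_mkAlgHom_apply]; simp [f]
  · intro v; rw [gg, RingQuot.liftAlgHom_mkAlgHom_apply]; simp [f]

/-- Every vertex is nonzero. -/
theorem vv_ne_zero (v : V) : vv K V E s r v ≠ 0 := by
  classical
  have hφ : ∀ v : V, ∀ e, s e = v → Nonempty ({e // s e = v} × ℕ ≃ ℕ) := by
    intro v e he
    have : Nonempty {e // s e = v} := ⟨⟨e, he⟩⟩
    have : Infinite ({e // s e = v} × ℕ) := inferInstance
    exact nonempty_equiv_of_countable
  let φ : ∀ e : E, ({f // s f = s e} × ℕ ≃ ℕ) := fun e => (hφ (s e) e rfl).some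
  have hφc : ∀ e f (h : s e = s f) (g : E) (hg : s g = s e) n,
      φ e (⟨g, hg⟩, n) = φ f (⟨g, hg.trans h⟩, n) := by
    intro e f h g hg n
    simp only [φ]
    have : ∀ (a b : V) (hab : a = b) (ha : s g = a) (e : E) (he : s e = a) (f : E) (hf : s f = b),
        (hφ a e he).some (⟨g, ha⟩, n) = (hφ b f hf).some (⟨g, ha.trans hab⟩, n) := by
      intro a b hab; subst hab; intros; rfl
    exact this _ _ h hg e rfl f rfl
  -- the position of the n-th basis vector under the edge e
  let pos : E → ℕ → ℕ := fun e n => φ e (⟨e, rfl⟩, n)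
  have pos_inj : ∀ e f n m, s e = s f → pos e n = pos f m → e = f ∧ n = m := by
    intro e f n m h h1
    simp only [pos] at h1
    rw [hφc e f h] at h1
    have := (φ f).injective h1
    simpa using this
  have pos_surj : ∀ e m, ∃ f n, s f = s e ∧ pos f n = m := by
    intro e m
    obtain ⟨⟨⟨f, hf⟩, n⟩, h⟩ := (φ e).surjective m
    refine ⟨f, n, hf, ?_⟩
    rw [← h]
    exact hφc f e hf f rfl n
  let fv : V → Module.End K (V × ℕ → K) := fun v =>
    { toFun := fun x p => if p.1 = v then x p else 0
      map_add' := by intro x y; ext p; simp; split_ifs <;> simp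
      map_smul' := by intro c x; ext p; simp }
  let fe : E → Module.End K (V × ℕ → K) := fun e =>
    { toFun := fun x p => if h : p.1 = s e ∧ ∃ n, pos e n = p.2 then x (r e, h.2.choose) else 0
      map_add' := by intro x y; ext p; simp; split_ifs <;> simp
      map_smul' := by intro c x; ext p; simp }
  let fg : E → Module.End K (V × ℕ → K) := fun e =>
    { toFun := fun x p => if p.1 = r e then x (s e, pos e p.2) else 0
      map_add' := by intro x y; ext p; simp; split_ifs <;> simp
      map_smul' := by intro c x; ext p; simp }
  have hv : ∀ v x w n, fv v x (w, n) = if w = v then x (w, n) else 0 := fun _ _ _ _ => rfl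
  have hg : ∀ e x w n, fg e x (w, n) = if w = r e then x (s e, pos e n) else 0 :=
    fun _ _ _ _ => rfl
  have he1 : ∀ e x n, fe e x (s e, pos e n) = x (r e, n) := by
    intro e x n
    have h : (s e, pos e n).1 = s e ∧ ∃ m, pos e m = (s e, pos e n).2 := ⟨rfl, n, rfl⟩
    have h2 : fe e x (s e, pos e n) = x (r e, h.2.choose) := dif_pos h
    rw [h2, (pos_inj e e _ _ rfl h.2.choose_spec).2]
  have he2 : ∀ e x w m, w ≠ s e → fe e x (w, m) = 0 := by
    intro e x w m h
    exact dif_neg (fun h' => h h'.1)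
  have he3 : ∀ e f x n, s f = s e → f ≠ e → fe e x (s e, pos f n) = 0 := by
    intro e f x n h hne
    apply dif_neg
    rintro ⟨-, m, hm⟩
    exact hne (pos_inj e f m n h.symm hm).1.symm
  obtain ⟨F, hF, -⟩ := exists_lift K V E s r fv fe fg
    (by
      intro v w h; ext x ⟨u, n⟩
      simp only [Module.End.mul_apply, hv, LinearMap.zero_apply, Pi.zero_apply]
      split_ifs <;> simp_all)
    (by
      intro v; ext x ⟨u, n⟩
      simp only [Module.End.mul_apply, hv]
      split_ifs <;> simp_all)
    (by
      intro e; ext x ⟨u, n⟩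
      simp only [Module.End.mul_apply, hv]
      split_ifs with h
      · rfl
      · rw [he2 _ _ _ _ h])
    (by
      intro e; ext x ⟨u, n⟩
      simp only [Module.End.mul_apply]
      by_cases h : u = s e
      · subst h
        obtain ⟨f, m, hf, rfl⟩ := pos_surj e n
        by_cases hfe : f = e
        · subst hfe
          rw [he1, he1, hv]; simp
        · rw [he3 _ _ _ _ hf hfe, he3 _ _ _ _ hf hfe]
      · rw [he2 _ _ _ _ h, he2 _ _ _ _ h])
    (by
      intro e; ext x ⟨u, n⟩
      simp only [Module.End.mul_apply, hv, hg]
      split_ifs <;> simp_all)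
    (by
      intro e; ext x ⟨u, n⟩
      simp only [Module.End.mul_apply, hv, hg]
      split_ifs <;> simp_all)
    (by
      intro e f hne; ext x ⟨u, n⟩
      simp only [Module.End.mul_apply, hg, LinearMap.zero_apply, Pi.zero_apply]
      split_ifs with h
      · by_cases hs : s e = s f
        · rw [hs, he3 _ _ _ _ hs hne]
        · rw [he2 _ _ _ _ hs]
      · rfl)
    (by
      intro e; ext x ⟨u, n⟩
      simp only [Module.End.mul_apply, hg, hv]
      split_ifs with h
      · rw [he1, h]
      · rfl)
    (by
      intro v e0 he0; ext x ⟨u, n⟩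
      simp only [LinearMap.sum_apply, Finset.sum_apply, Module.End.mul_apply, hv]
      split_ifs with h
      · subst h
        subst he0
        obtain ⟨f, m, hf, rfl⟩ := pos_surj e0 n
        rw [Finset.sum_eq_single f]
        · rw [← hf, he1, hg]; simp
        · intro e he hne
          have : s e = s e0 := by simpa using he
          rw [← this, he3 _ _ _ _ (hf.trans this.symm) hne.symm]
        · intro h; simp [hf] at h
      · symm
        apply Finset.sum_eq_zero
        intro e he
        have : s e = v := by simpa using he
        exact he2 _ _ _ _ (this ▸ h))
    (by
      ext x ⟨u, n⟩
      simp [LinearMap.sum_apply, Finset.sum_apply, hv])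
  intro h0
  have h := hF v
  rw [h0, map_zero] at h
  have h1 : (fv v) (fun _ => 1) (v, 0) = 0 := by rw [← h]; rfl
  rw [hv] at h1
  simp at h1

/-- The grading homomorphism. -/
theorem exists_grading : ∃ F : LeavittPathAlgebra K V E s r →ₐ[K]
      AddMonoidAlgebra (LeavittPathAlgebra K V E s r) ℤ,
      (∀ v, F (vv K V E s r v) = AddMonoidAlgebra.single 0 (vv K V E s r v)) ∧
      (∀ e, F (ee K V E s r e) = AddMonoidAlgebra.single 1 (ee K V E s r e)) ∧
      (∀ e, F (gg K V E s r e) = AddMonoidAlgebra.single (-1) (gg K V E s r e)) := by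
  classical
  apply exists_lift K V E s r (fun v => AddMonoidAlgebra.single 0 (vv K V E s r v))
    (fun e => AddMonoidAlgebra.single 1 (ee K V E s r e))
    (fun e => AddMonoidAlgebra.single (-1) (gg K V E s r e))
  · intro v w h; rw [AddMonoidAlgebra.single_mul_single, vv_orth _ _ _ _ _ _ _ h]; simp
  · intro v; rw [AddMonoidAlgebra.single_mul_single, vv_idem]; simp
  · intro e; rw [AddMonoidAlgebra.single_mul_single, ee_src]; simp
  · intro e; rw [AddMonoidAlgebra.single_mul_single, ee_rng]; simp
  · intro e; rw [AddMonoidAlgebra.single_mul_single, gg_rng]; simp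
  · intro e; rw [AddMonoidAlgebra.single_mul_single, gg_src]; simp
  · intro e f h; rw [AddMonoidAlgebra.single_mul_single, gg_ee_ne _ _ _ _ _ _ _ h]; simp
  · intro e; rw [AddMonoidAlgebra.single_mul_single, gg_ee]; simp
  · intro v e h
    simp only [AddMonoidAlgebra.single_mul_single]
    rw [ck2 K V E s r v e h]
    simp only [add_neg_cancel]
    exact map_sum (AddMonoidAlgebra.singleAddHom (R := LeavittPathAlgebra K V E s r) (0 : ℤ)) _ _
  · rw [AddMonoidAlgebra.one_def, one_eq]
    exact map_sum (AddMonoidAlgebra.singleAddHom (R := LeavittPathAlgebra K V E s r) (0 : ℤ)) _ _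

end LPA
namespace LPA

/-- Reachability in the graph. -/
def Reach {V E : Type} (s r : E → V) : V → V → Prop :=
  Relation.ReflTransGen (fun a b => ∃ e, s e = a ∧ r e = b)

/-- A vertex all of whose successors reach back to it and emit at most one edge. -/
def Term {V E : Type} (s r : E → V) (w : V) : Prop :=
  ∀ u, Reach s r w u → Reach s r u w ∧ ∀ e f, s e = u → s f = u → e = f

variable (K V E : Type) [Field K] [Fintype V] [Fintype E] (s r : E → V)

/-- `Pth a b n x y`: `x` is the element of a path of length `n` from `a` to `b`, `y` its ghost. -/
inductive Pth : V → V → ℕ → LeavittPathAlgebra K V E s r → LeavittPathAlgebra K V E s r → Prop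
  | nil (v : V) : Pth v v 0 (vv K V E s r v) (vv K V E s r v)
  | cons (e : E) (u : V) (n : ℕ) (x y : LeavittPathAlgebra K V E s r) (h : Pth (r e) u n x y) :
      Pth (s e) u (n + 1) (ee K V E s r e * x) (y * gg K V E s r e)

variable {K V E s r}

theorem Pth.left {a b n x y} (h : Pth K V E s r a b n x y) :
    vv K V E s r a * x = x ∧ y * vv K V E s r a = y := by
  cases h with
  | nil => exact ⟨vv_idem .., vv_idem ..⟩
  | cons e u n x y h => rw [← mul_assoc, ee_src, mul_assoc, gg_src]; exact ⟨rfl, rfl⟩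

theorem Pth.right {a b n x y} (h : Pth K V E s r a b n x y) :
    x * vv K V E s r b = x ∧ vv K V E s r b * y = y := by
  induction h with
  | nil => exact ⟨vv_idem .., vv_idem ..⟩
  | cons e u n x y h ih => rw [mul_assoc, ih.1, ← mul_assoc, ih.2]; exact ⟨rfl, rfl⟩

theorem Pth.comp {a b c n m x y x' y'} (h : Pth K V E s r a b n x y)
    (h' : Pth K V E s r b c m x' y') : Pth K V E s r a c (n + m) (x * x') (y' * y) := by
  induction h with
  | nil => rw [h'.left.1, h'.left.2, zero_add]; exact h'
  | cons e u n x y h ih =>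
    have := Pth.cons (K := K) (s := s) e _ _ _ _ (ih h')
    rw [mul_assoc, ← mul_assoc y', show n + 1 + m = n + m + 1 by ring]
    exact this

theorem Pth.yx {a b n x y} (h : Pth K V E s r a b n x y) : y * x = vv K V E s r b := by
  induction h with
  | nil => exact vv_idem ..
  | cons e u n x y h ih =>
    rw [mul_assoc, ← mul_assoc (gg K V E s r e), gg_ee, h.left.1, ih]

theorem Pth.reach {a b n x y} (h : Pth K V E s r a b n x y) : Reach s r a b := by
  induction h with
  | nil => exact Relation.ReflTransGen.refl
  | cons e u n x y h ih => exact Relation.ReflTransGen.head ⟨e, rfl, rfl⟩ ih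

theorem exists_pth {a b} (h : Reach s r a b) : ∃ n x y, Pth K V E s r a b n x y := by
  induction h using Relation.ReflTransGen.head_induction_on with
  | refl => exact ⟨_, _, _, Pth.nil b⟩
  | head h1 h2 ih =>
    obtain ⟨e, rfl, rfl⟩ := h1
    obtain ⟨n, x, y, h⟩ := ih
    exact ⟨_, _, _, Pth.cons e _ _ _ _ h⟩

theorem Term.step {w u} (h : Term s r w) (hu : Reach s r w u) : Term s r u := by
  intro t ht
  exact ⟨(h t (hu.trans ht)).1.trans hu, (h t (hu.trans ht)).2⟩

theorem Pth.xy {a b n x y} (h : Pth K V E s r a b n x y) (ht : Term s r a) :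
    x * y = vv K V E s r a := by
  classical
  induction h with
  | nil => exact vv_idem ..
  | cons e u n x y h ih =>
    have h1 := ih (ht.step (Relation.ReflTransGen.single ⟨e, rfl, rfl⟩))
    rw [mul_assoc, ← mul_assoc x, h1, ← mul_assoc, ee_rng, ck2 K V E s r (s e) e rfl]
    rw [Finset.sum_eq_single e]
    · intro f hf hne
      exact absurd ((ht (s e) Relation.ReflTransGen.refl).2 f e (by simpa using hf) rfl) hne
    · simp

theorem Pth.unique {a b b' n x y x' y'} (h : Pth K V E s r a b n x y) (ht : Term s r a)
    (h' : Pth K V E s r a b' n x' y') : b = b' ∧ x = x' ∧ y = y' := by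
  induction h generalizing b' x' y' with
  | nil => cases h'; exact ⟨rfl, rfl, rfl⟩
  | cons e u n x y h ih =>
    generalize hv : s e = v at h'
    cases h' with
    | cons f u' _ x' y' h' =>
      have : f = e := (ht (s e) Relation.ReflTransGen.refl).2 f e hv.symm rfl
      subst this
      obtain ⟨rfl, rfl, rfl⟩ := ih (ht.step (Relation.ReflTransGen.single ⟨f, rfl, rfl⟩)) h'
      exact ⟨rfl, rfl, rfl⟩

/-- The spanning set. -/
def Spn (K V E : Type) [Field K] [Fintype V] [Fintype E] (s r : E → V) :
    Set (LeavittPathAlgebra K V E s r) :=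
  {z | ∃ a a' b n m x y x' y', Pth K V E s r a b n x y ∧ Pth K V E s r a' b m x' y' ∧ z = x * y'}

theorem gen_mul_span (t : LeavittPathAlgebra K V E s r)
    (ht : (∃ v, t = vv K V E s r v) ∨ (∃ e, t = ee K V E s r e) ∨ (∃ e, t = gg K V E s r e))
    (z : LeavittPathAlgebra K V E s r) (hz : z ∈ Submodule.span K (Spn K V E s r)) :
    t * z ∈ Submodule.span K (Spn K V E s r) := by
  induction hz using Submodule.span_induction with
  | zero => simp
  | add a b _ _ ha hb => rw [mul_add]; exact Submodule.add_mem _ ha hb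
  | smul c a _ ha => rw [mul_smul_comm]; exact Submodule.smul_mem _ _ ha
  | mem z hz =>
    obtain ⟨a, a', b, n, m, x, y, x', y', h, h', rfl⟩ := hz
    rw [← mul_assoc]
    rcases ht with ⟨v, rfl⟩ | ⟨e, rfl⟩ | ⟨e, rfl⟩
    · by_cases hv : v = a
      · subst hv
        rw [h.left.1]
        exact Submodule.subset_span ⟨_, _, _, _, _, _, _, _, _, h, h', rfl⟩
      · rw [← h.left.1, ← mul_assoc, vv_orth _ _ _ _ _ _ _ hv]; simp
    · by_cases hv : r e = a
      · subst hv
        exact Submodule.subset_span ⟨_, _, _, _, _, _, _, _, _, Pth.cons e _ _ _ _ h, h', rfl⟩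
      · rw [← h.left.1, ← ee_rng, ← mul_assoc, mul_assoc (ee K V E s r e),
          vv_orth _ _ _ _ _ _ _ hv]; simp
    · cases h with
      | nil =>
        rw [mul_assoc, h'.right.2]
        by_cases hv : s e = a
        · subst hv
          have h1 := h'.comp (Pth.cons (K := K) (s := s) e _ _ _ _ (Pth.nil (r e)))
          rw [gg_rng] at h1
          refine Submodule.subset_span ⟨_, _, _, _, _, _, _, _, _, Pth.nil (r e), h1, ?_⟩
          rw [← mul_assoc, gg_rng]
        · rw [← h'.right.2, ← gg_src, ← mul_assoc, mul_assoc (gg K V E s r e),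
            vv_orth _ _ _ _ _ _ _ hv]; simp
      | cons f u n x y h =>
        by_cases hf : e = f
        · subst hf
          rw [← mul_assoc, gg_ee, h.left.1]
          exact Submodule.subset_span ⟨_, _, _, _, _, _, _, _, _, h, h', rfl⟩
        · rw [← mul_assoc, gg_ee_ne _ _ _ _ _ _ _ hf]; simp

theorem mem_span (t : LeavittPathAlgebra K V E s r) : t ∈ Submodule.span K (Spn K V E s r) := by
  obtain ⟨t, rfl⟩ := RingQuot.mkAlgHom_surjective K (LPARel K V E s r) t
  have h1 : (1 : LeavittPathAlgebra K V E s r) ∈ Submodule.span K (Spn K V E s r) := by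
    rw [one_eq]
    refine Submodule.sum_mem _ fun v _ => Submodule.subset_span ?_
    exact ⟨_, _, _, _, _, _, _, _, _, Pth.nil v, Pth.nil v, (vv_idem ..).symm⟩
  have key : ∀ z ∈ Submodule.span K (Spn K V E s r),
      RingQuot.mkAlgHom K (LPARel K V E s r) t * z ∈ Submodule.span K (Spn K V E s r) := by
    induction t using FreeAlgebra.induction with
    | grade0 c =>
      intro z hz
      rw [AlgHom.commutes, ← Algebra.smul_def]
      exact Submodule.smul_mem _ _ hz
    | grade1 g =>
      intro z hz
      apply gen_mul_span _ _ z hz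
      cases g with
      | vertex v => exact Or.inl ⟨v, rfl⟩
      | edge e => exact Or.inr (Or.inl ⟨e, rfl⟩)
      | ghost e => exact Or.inr (Or.inr ⟨e, rfl⟩)
    | mul a b ha hb =>
      intro z hz
      rw [map_mul, mul_assoc]
      exact ha _ (hb _ hz)
    | add a b ha hb =>
      intro z hz
      rw [map_add, add_mul]
      exact Submodule.add_mem _ (ha _ hz) (hb _ hz)
  simpa using key 1 h1

theorem corner_mem_span (w w' : V) (t : LeavittPathAlgebra K V E s r) :
    vv K V E s r w * t * vv K V E s r w' ∈ Submodule.span K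
      {z | ∃ b n m x y x' y', Pth K V E s r w b n x y ∧ Pth K V E s r w' b m x' y' ∧
        z = x * y'} := by
  induction mem_span t using Submodule.span_induction with
  | zero => simp
  | add a b _ _ ha hb => rw [mul_add, add_mul]; exact Submodule.add_mem _ ha hb
  | smul c a _ ha => rw [mul_smul_comm, smul_mul_assoc]; exact Submodule.smul_mem _ _ ha
  | mem z hz =>
    obtain ⟨a, a', b, n, m, x, y, x', y', h, h', rfl⟩ := hz
    rw [← mul_assoc, mul_assoc (_ * x)]
    by_cases hw : w = a
    · by_cases hw' : w' = a'
      · subst hw hw'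
        rw [h.left.1, h'.left.2]
        exact Submodule.subset_span ⟨_, _, _, _, _, _, _, h, h', rfl⟩
      · rw [← h'.left.2, mul_assoc y', vv_orth _ _ _ _ _ _ _ (Ne.symm hw')]; simp
    · rw [← h.left.1, ← mul_assoc (vv K V E s r w), vv_orth _ _ _ _ _ _ _ hw]; simp

theorem corner_orth (w w' : V) (hw : Term s r w) (hw' : ¬ Reach s r w w')
    (hT' : Term s r w')
    (t : LeavittPathAlgebra K V E s r) : vv K V E s r w * t * vv K V E s r w' = 0 := by
  have h := corner_mem_span w w' t
  have h2 : {z | ∃ b n m x y x' y', Pth K V E s r w b n x y ∧ Pth K V E s r w' b m x' y' ∧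
        z = x * y'} = ∅ := by
    ext z
    simp only [Set.mem_setOf_eq, Set.mem_empty_iff_false, iff_false]
    rintro ⟨b, n, m, x, y, x', y', h, h', -⟩
    exact hw' (h.reach.trans (hT' b h'.reach).1)
  rw [h2] at h
  simpa using h

/-- Monomials of degree `k` in the corner at `w`. -/
def Mon (w : V) (k : ℤ) (g : LeavittPathAlgebra K V E s r) : Prop :=
  ∃ (n m : ℕ) (x y x' y' : LeavittPathAlgebra K V E s r), Pth K V E s r w w n x y ∧
    Pth K V E s r w w m x' y' ∧ g = x * y' ∧ k = (n : ℤ) - m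

theorem corner_mem_span_mon (w : V) (hw : Term s r w) (t : LeavittPathAlgebra K V E s r) :
    vv K V E s r w * t * vv K V E s r w ∈ Submodule.span K {z | ∃ k, Mon w k z} := by
  refine Submodule.span_mono ?_ (corner_mem_span w w t)
  rintro z ⟨b, n, m, x, y, x', y', h, h', rfl⟩
  obtain ⟨l, μ, ν, hμ⟩ := exists_pth (K := K) (hw b h.reach).1
  refine ⟨_, _, _, _, _, _, _, h.comp hμ, h'.comp hμ, ?_, rfl⟩
  rw [mul_assoc x, ← mul_assoc μ, hμ.xy (hw.step h.reach), h'.right.2]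

theorem pth_comm {w : V} (hw : Term s r w) {n m x y x' y'} (h : Pth K V E s r w w n x y)
    (h' : Pth K V E s r w w m x' y') : x * x' = x' * x := by
  have h1 := h.comp h'
  have h2 := h'.comp h
  rw [add_comm m n] at h2
  exact (h1.unique hw h2).2.1

theorem pth_comm' {w : V} (hw : Term s r w) {n m x y x' y'} (h : Pth K V E s r w w n x y)
    (h' : Pth K V E s r w w m x' y') : y * x' = x' * y := by
  calc y * x' = y * (x' * vv K V E s r w) := by rw [h'.right.1]
    _ = y * (x' * x) * y := by rw [← h.xy hw]; simp only [mul_assoc]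
    _ = (y * x) * x' * y := by rw [← pth_comm hw h h']; simp only [mul_assoc]
    _ = x' * y := by rw [h.yx, h'.left.1]

theorem Mon.mul {w : V} (hw : Term s r w) {k l : ℤ} {g g' : LeavittPathAlgebra K V E s r}
    (h : Mon w k g) (h' : Mon w l g') : Mon w (k + l) (g * g') := by
  obtain ⟨n, m, x, y, x', y', h1, h2, rfl, rfl⟩ := h
  obtain ⟨n1, m1, x1, y1, x1', y1', h3, h4, rfl, rfl⟩ := h'
  refine ⟨_, _, _, _, _, _, h1.comp h3, h4.comp h2, ?_, ?_⟩
  · rw [mul_assoc x, ← mul_assoc y', pth_comm' hw h2 h3]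
    simp only [mul_assoc]
  · push_cast; ring

theorem Mon.inv {w : V} (hw : Term s r w) {k : ℤ} {g : LeavittPathAlgebra K V E s r}
    (h : Mon w k g) : ∃ g', Mon w (-k) g' ∧ g * g' = vv K V E s r w := by
  obtain ⟨n, m, x, y, x', y', h1, h2, rfl, rfl⟩ := h
  refine ⟨x' * y, ⟨_, _, _, _, _, _, h2, h1, rfl, by ring⟩, ?_⟩
  rw [mul_assoc, ← mul_assoc y', h2.yx, h1.right.2, h1.xy hw]

theorem Mon.one (w : V) : Mon w 0 (vv K V E s r w) :=
  ⟨_, _, _, _, _, _, Pth.nil w, Pth.nil w, (vv_idem ..).symm, by simp⟩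

theorem Mon.unique {w : V} (hw : Term s r w) {k : ℤ} {g g' : LeavittPathAlgebra K V E s r}
    (h : Mon w k g) (h' : Mon w k g') : g = g' := by
  obtain ⟨n, m, x, y, x', y', h1, h2, rfl, rfl⟩ := h
  obtain ⟨n1, m1, x1, y1, x1', y1', h3, h4, rfl, hk⟩ := h'
  have e1 := h1.comp h4
  have e2 := h3.comp h2
  rw [show n1 + m = n + m1 by omega] at e2
  have e3 : x * x1' = x1 * x' := (e1.unique hw e2).2.1
  calc x * y' = x * (x1' * y1') * y' := by rw [h4.xy hw, h1.right.1]
    _ = x1 * (x' * y1') * y' := by rw [← mul_assoc x, e3]; simp only [mul_assoc]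
    _ = x1 * y1' * (x' * y') := by rw [← pth_comm' hw h4 h2]; simp only [mul_assoc]
    _ = x1 * y1' := by rw [h2.xy hw, mul_assoc, h4.left.2]

/-- Degrees occurring in the corner at `w`. -/
def degs (w : V) (hw : Term s r w) (K : Type) [Field K] : AddSubgroup ℤ where
  carrier := {k | ∃ g : LeavittPathAlgebra K V E s r, Mon w k g}
  zero_mem' := ⟨_, Mon.one w⟩
  add_mem' := by
    rintro a b ⟨g, hg⟩ ⟨g', hg'⟩
    exact ⟨_, hg.mul hw hg'⟩
  neg_mem' := by
    rintro a ⟨g, hg⟩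
    obtain ⟨g', h, -⟩ := hg.inv hw
    exact ⟨g', h⟩

theorem corner_domain (w : V) (hw : Term s r w) :
    ∃ (C : Type) (_ : CommRing C) (_ : IsDomain C) (ψ : C →ₙ+* LeavittPathAlgebra K V E s r),
      Function.Injective ψ ∧ ∀ a, ∃ c, ψ c = vv K V E s r w * a * vv K V E s r w := by
  classical
  have hH : ∀ k : degs w hw K, ∃ g : LeavittPathAlgebra K V E s r, Mon w (k : ℤ) g := fun k => k.2
  choose g hg using hH
  let ψ₀ : (degs w hw K →₀ K) →ₗ[K] LeavittPathAlgebra K V E s r := Finsupp.linearCombination K g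
  let ψ₁ : AddMonoidAlgebra K (degs w hw K) →+ LeavittPathAlgebra K V E s r :=
    ψ₀.toAddMonoidHom.comp (AddMonoidAlgebra.coeffAddEquiv).toAddMonoidHom
  have hs : ∀ k c, ψ₁ (AddMonoidAlgebra.single k c) = c • g k := by
    intro k c
    simp [ψ₁, ψ₀]
  have hmul : ∀ a b, ψ₁ (a * b) = ψ₁ a * ψ₁ b := by
    intro a b
    induction a using AddMonoidAlgebra.induction_linear with
    | zero => simp
    | add a a' ha ha' => rw [add_mul, map_add, ha, ha', map_add, add_mul]
    | single k c =>
      induction b using AddMonoidAlgebra.induction_linear with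
      | zero => simp
      | add a a' ha ha' => rw [mul_add, map_add, ha, ha', map_add, mul_add]
      | single l d =>
        rw [AddMonoidAlgebra.single_mul_single, hs, hs, hs, smul_mul_smul_comm]
        congr 1
        exact (hg (k + l)).unique hw ((hg k).mul hw (hg l))
  let ψ : AddMonoidAlgebra K (degs w hw K) →ₙ+* LeavittPathAlgebra K V E s r :=
    { ψ₁ with map_mul' := hmul }
  have hψ : ∀ a, ψ a = ψ₁ a := fun _ => rfl
  refine ⟨AddMonoidAlgebra K (degs w hw K), inferInstance, inferInstance, ψ, ?_, ?_⟩
  · obtain ⟨δ, d1, d2, d3⟩ := exists_grading K V E s r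
    have hp : ∀ a b n x y, Pth K V E s r a b n x y → δ x = AddMonoidAlgebra.single (n : ℤ) x ∧
        δ y = AddMonoidAlgebra.single (-(n : ℤ)) y := by
      intro a b n x y h
      induction h with
      | nil => simp [d1]
      | cons e u n x y h ih =>
        rw [map_mul, map_mul, ih.1, ih.2, d2, d3, AddMonoidAlgebra.single_mul_single,
          AddMonoidAlgebra.single_mul_single]
        constructor <;> congr 1 <;> push_cast <;> ring
    have hm : ∀ k z, Mon w k z → δ z = AddMonoidAlgebra.single k z := by
      rintro k z ⟨n, m, x, y, x', y', h1, h2, rfl, rfl⟩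
      rw [map_mul, (hp _ _ _ _ _ h1).1, (hp _ _ _ _ _ h2).2, AddMonoidAlgebra.single_mul_single]
      rfl
    have hc : ∀ f : AddMonoidAlgebra K (degs w hw K), ∀ k : degs w hw K,
        (δ (ψ f)).coeff (k : ℤ) = f.coeff k • g k := by
      intro f k
      rw [hψ]
      induction f using AddMonoidAlgebra.induction_linear with
      | zero => simp
      | add a a' ha ha' =>
        rw [map_add, map_add, AddMonoidAlgebra.coeff_add, AddMonoidAlgebra.coeff_add,
          Finsupp.add_apply, Finsupp.add_apply, ha, ha', add_smul]
      | single l c =>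
        rw [hs, map_smul, hm _ _ (hg l)]
        simp only [AddMonoidAlgebra.coeff_smul, AddMonoidAlgebra.coeff_single, Finsupp.smul_apply,
          Finsupp.single_apply]
        by_cases hlk : l = k
        · subst hlk; simp
        · have : (l : ℤ) ≠ k := fun h => hlk (Subtype.ext h)
          simp [hlk, this]
    rw [injective_iff_map_eq_zero]
    intro f hf
    ext k
    have h := hc f k
    rw [hf, map_zero] at h
    have hg0 : g k ≠ 0 := by
      intro h0
      obtain ⟨g', -, h1⟩ := (hg k).inv hw
      rw [h0, zero_mul] at h1
      exact vv_ne_zero K V E s r w h1.symm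
    have h' : f.coeff k • g k = 0 := by rw [← h]; simp
    rcases smul_eq_zero.mp h' with h2 | h2
    · simpa using h2
    · exact absurd h2 hg0
  · intro a
    have hmem := corner_mem_span_mon w hw a
    generalize vv K V E s r w * a * vv K V E s r w = z at hmem ⊢
    induction hmem using Submodule.span_induction with
    | zero => exact ⟨0, map_zero _⟩
    | add a b _ _ ha hb =>
      obtain ⟨c, rfl⟩ := ha
      obtain ⟨d, rfl⟩ := hb
      exact ⟨c + d, map_add _ _ _⟩
    | smul c a hx ha =>
      obtain ⟨d, rfl⟩ := ha
      clear hx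
      refine ⟨AddMonoidAlgebra.single 0 c * d, ?_⟩
      rw [map_mul, hψ, hψ, hs, smul_mul_assoc]
      congr 1
      rw [(hg 0).unique hw (Mon.one w)]
      induction d using AddMonoidAlgebra.induction_linear with
      | zero => simp
      | add a a' ha ha' => rw [map_add, mul_add, ha, ha']
      | single l d =>
        rw [hs, mul_smul_comm]
        congr 1
        have := (Mon.one w).mul hw (hg l)
        rw [zero_add] at this
        exact this.unique hw (hg l)
    | mem z hz =>
      obtain ⟨k, hk⟩ := hz
      refine ⟨AddMonoidAlgebra.single ⟨k, z, hk⟩ 1, ?_⟩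
      rw [hψ, hs, one_smul]
      exact (hg _).unique hw hk

end LPA
namespace LPA

section graph
variable {V E : Type} {s r : E → V}

/-- Edge lists that are paths from `a` to `b`. -/
def LP (s r : E → V) : V → List E → V → Prop
  | a, [], b => a = b
  | a, e :: l, b => s e = a ∧ LP s r (r e) l b

theorem LP.suffix {b : V} : ∀ (m : List E) (e : E) (l : List E) (a : V),
    LP s r a (m ++ e :: l) b → LP s r (s e) (e :: l) b
  | [], e, l, a, h => ⟨rfl, h.2⟩
  | f :: m, e, l, a, h => LP.suffix m e l (r f) h.2

theorem exists_simple {a b : V} (h : Reach s r a b) :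
    ∃ l, LP s r a l b ∧ (l.map s).Nodup ∧ b ∉ l.map s := by
  classical
  induction h using Relation.ReflTransGen.head_induction_on with
  | refl => exact ⟨[], rfl, by simp, by simp⟩
  | head h1 h2 ih =>
    obtain ⟨e, rfl, rfl⟩ := h1
    obtain ⟨l, hl, hn, hb⟩ := ih
    by_cases hab : s e = b
    · exact ⟨[], hab, by simp, by simp⟩
    · by_cases hm : s e ∈ l.map s
      · obtain ⟨f, hf, hfe⟩ := List.mem_map.mp hm
        obtain ⟨m, l', rfl⟩ := List.append_of_mem hf
        have h1 := LP.suffix _ _ _ _ hl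
        rw [hfe] at h1
        rw [List.map_append] at hn hb
        refine ⟨f :: l', h1, (List.nodup_append.mp hn).2.1, fun h => hb ?_⟩
        exact List.mem_append_right _ h
      · refine ⟨e :: l, ⟨rfl, hl⟩, ?_, ?_⟩
        · rw [List.map_cons, List.nodup_cons]; exact ⟨hm, hn⟩
        · rw [List.map_cons, List.mem_cons]
          rintro (h | h)
          · exact hab h.symm
          · exact hb h

theorem LP.chain {b : V} : ∀ (l : List E) (a : V), LP s r a l b → IsPathChain s r l
  | [], _, _ => by intro i h; simp at h
  | [e], _, _ => by intro i h; simp at h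
  | e :: f :: l, a, h => by
    intro i hi
    cases i with
    | zero => exact h.2.1.symm
    | succ i =>
      have := LP.chain (f :: l) _ h.2 i (by simpa using hi)
      simpa using this

theorem LP.last {b : V} : ∀ (l : List E) (a : V) (hne : l ≠ []), LP s r a l b →
    r (l.getLast hne) = b
  | [], _, h, _ => absurd rfl h
  | [e], _, _, h => h.2
  | e :: f :: l, a, _, h => by
    rw [List.getLast_cons (by simp)]
    exact LP.last (f :: l) _ (by simp) h.2

theorem unique_edge (hne : ∀ es : List E, IsCycle s r es → ¬ HasExit s r es) (e f : E)
    (hf : s f = s e) (h : Reach s r (r e) (s e)) : f = e := by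
  by_contra hfe
  obtain ⟨l, hl, hn, hb⟩ := exists_simple h
  have hL : LP s r (s e) (e :: l) (s e) := ⟨rfl, hl⟩
  refine hne (e :: l) ⟨by simp, hL.chain, ?_, ?_⟩ ⟨f, 0, by simp, by simpa using hf, by simpa using hfe⟩
  · rw [hL.last]; rfl
  · rw [List.map_cons, List.nodup_cons]; exact ⟨hb, hn⟩

/-- A vertex on a closed path is terminal. -/
theorem term_of_rec (hne : ∀ es : List E, IsCycle s r es → ¬ HasExit s r es) (e : E)
    (h : Reach s r (r e) (s e)) : Term s r (s e) := by
  have key : ∀ u, Reach s r (s e) u → Reach s r u (s e) ∧ ∃ e', s e' = u ∧ Reach s r (r e') u := by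
    intro u hu
    induction hu with
    | refl => exact ⟨Relation.ReflTransGen.refl, e, rfl, h⟩
    | tail h1 h2 ih =>
      obtain ⟨f, rfl, rfl⟩ := h2
      obtain ⟨h3, e', he', h4⟩ := ih
      have hfe : f = e' := unique_edge hne e' f he'.symm (he'.symm ▸ h4)
      subst hfe
      refine ⟨h4.trans h3, ?_⟩
      rcases Relation.ReflTransGen.cases_head h4 with h5 | ⟨c, ⟨g, hg, rfl⟩, h5⟩
      · exact ⟨f, h5.symm, h5 ▸ Relation.ReflTransGen.refl⟩
      · exact ⟨g, hg, h5.trans (Relation.ReflTransGen.single ⟨f, rfl, rfl⟩)⟩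
  intro u hu
  obtain ⟨h1, e', he', h2⟩ := key u hu
  refine ⟨h1, fun a b ha hb => ?_⟩
  rw [unique_edge hne e' a (ha.trans he'.symm) (he'.symm ▸ h2),
    unique_edge hne e' b (hb.trans he'.symm) (he'.symm ▸ h2)]

theorem reach_of_chain (es : List E) (h : IsPathChain s r es) (i k : ℕ) (hk : i + k < es.length) :
    Reach s r (s (es[i]'(by omega))) (s (es[i + k]'hk)) := by
  induction k with
  | zero => exact Relation.ReflTransGen.refl
  | succ k ih =>
    refine (ih (by omega)).tail ⟨es[i + k]'(by omega), rfl, ?_⟩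
    exact h (i + k) hk

theorem reach_of_cycle (es : List E) (h : IsCycle s r es) (i : ℕ) (hi : i < es.length) :
    Reach s r (r (es[i]'hi)) (s (es[i]'hi)) := by
  obtain ⟨hne, hch, hlast, -⟩ := h
  rw [List.getLast_eq_getElem, List.head_eq_getElem] at hlast
  have h0 : Reach s r (s (es[0]'(by omega))) (s (es[i]'hi)) := by
    have := reach_of_chain es hch 0 i (by omega)
    simpa using this
  by_cases hl : i + 1 < es.length
  · obtain ⟨k, hk⟩ : ∃ k, es.length - 1 = i + 1 + k := ⟨es.length - 1 - (i + 1), by omega⟩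
    have h1 := reach_of_chain es hch (i + 1) k (by omega)
    have h2 : r (es[i + 1 + k]'(by omega)) = s (es[0]'(by omega)) := by
      rw [← hlast]; simp only [hk]
    rw [hch i hl]
    exact (h1.tail ⟨_, rfl, h2⟩).trans h0
  · have h2 : r (es[i]'hi) = s (es[0]'(by omega)) := by
      have : es.length - 1 = i := by omega
      rw [← hlast]; simp only [this]
    rw [h2]
    exact h0

end graph

variable (K V E : Type) [Field K] [Fintype V] [Fintype E] (s r : E → V)

theorem bounded_of_noExit (hne : ∀ es : List E, IsCycle s r es → ¬ HasExit s r es) :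
    ∃ n : ℕ, 0 < n ∧ ∀ a : LeavittPathAlgebra K V E s r, IsNilpotent a → a ^ n = 0 := by
  classical
  -- representatives of the classes of terminal vertices
  let S : Setoid V :=
    { r := fun a b => Reach s r a b ∧ Reach s r b a
      iseqv := ⟨fun _ => ⟨Relation.ReflTransGen.refl, Relation.ReflTransGen.refl⟩,
        fun h => ⟨h.2, h.1⟩, fun h h' => ⟨h.1.trans h'.1, h'.2.trans h.2⟩⟩ }
  let rep : V → V := fun v => (Quotient.mk S v).out
  have hrep : ∀ v, Reach s r (rep v) v ∧ Reach s r v (rep v) := fun v =>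
    Quotient.mk_out (s := S) v
  have hrep2 : ∀ v w, Reach s r v w → Reach s r w v → rep v = rep w := by
    intro v w h1 h2
    have : Quotient.mk S v = Quotient.mk S w := Quotient.sound (s := S) ⟨h1, h2⟩
    simp only [rep, this]
  let W := {w : V // Term s r w ∧ rep w = w}
  choose C i1 i2 ψ hinj hsurj using fun w : W => corner_domain (K := K) w.1 w.2.1
  let I : Set (LeavittPathAlgebra K V E s r) :=
    {z | ∃ (x y : LeavittPathAlgebra K V E s r) (w : W), z = x * vv K V E s r w.1 * y}
  have hI : ∀ x y z, z ∈ Submodule.span K I → x * z * y ∈ Submodule.span K I := by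
    intro x y z hz
    induction hz using Submodule.span_induction with
    | zero => simp
    | add a b _ _ ha hb => rw [mul_add, add_mul]; exact Submodule.add_mem _ ha hb
    | smul c a _ ha => rw [mul_smul_comm, smul_mul_assoc]; exact Submodule.smul_mem _ _ ha
    | mem z hz =>
      obtain ⟨x', y', w, rfl⟩ := hz
      exact Submodule.subset_span ⟨x * x', y' * y, w, by simp only [mul_assoc]⟩
  have hwf : WellFounded (fun u v => Reach s r v u ∧ ¬ Reach s r u v) := by
    have : IsTrans V (fun u v => Reach s r v u ∧ ¬ Reach s r u v) :=
      ⟨fun a b c h h' => ⟨h'.1.trans h.1, fun h'' => h.2 (h''.trans h'.1)⟩⟩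
    have : Std.Irrefl (fun u v => Reach s r v u ∧ ¬ Reach s r u v) :=
      ⟨fun a h => h.2 h.1⟩
    exact Finite.wellFounded_of_trans_of_irrefl _
  have hv : ∀ v, vv K V E s r v ∈ Submodule.span K I := by
    intro v
    induction v using hwf.induction with
    | _ v ih =>
      by_cases hT : Term s r v
      · obtain ⟨n, x, y, h⟩ := exists_pth (K := K) (hrep v).2
        apply Submodule.subset_span
        refine ⟨x, y, ⟨rep v, hT.step (hrep v).2, hrep2 _ _ (hrep v).1 (hrep v).2⟩, ?_⟩
        rw [h.right.1, h.xy hT]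
      · have hex : ∃ e, s e = v := by
          by_contra hno
          apply hT
          have : ∀ u, Reach s r v u → u = v := by
            intro u hu
            rcases Relation.ReflTransGen.cases_head hu with h5 | ⟨c, ⟨g, hg, rfl⟩, h5⟩
            · exact h5.symm
            · exact absurd ⟨g, hg⟩ hno
          intro u hu
          obtain rfl := this u hu
          exact ⟨Relation.ReflTransGen.refl, fun e _ he _ => absurd ⟨e, he⟩ hno⟩
        obtain ⟨e0, he0⟩ := hex
        rw [ck2 K V E s r v e0 he0]
        refine Submodule.sum_mem _ fun e he => ?_
        have he : s e = v := by simpa using he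
        subst he
        have h1 := ih (r e) ⟨Relation.ReflTransGen.single ⟨e, rfl, rfl⟩,
          fun h => hT (term_of_rec hne e h)⟩
        have h2 := hI (ee K V E s r e) (gg K V E s r e) _ h1
        rwa [ee_rng] at h2
  have hone : (1 : LeavittPathAlgebra K V E s r) ∈ Submodule.span K I := by
    rw [one_eq]
    exact Submodule.sum_mem _ fun v _ => hv v
  obtain ⟨N, c, z, hz⟩ := Submodule.mem_span_set'.mp hone
  choose x y t hxyt using fun i => (z i).2
  refine ⟨N + 1, by omega, fun a ha => ?_⟩
  refine lpa_bounded_abstract (fun w : W => vv K V E s r w.1) (fun w => vv_idem ..) ?_ C ψ hinj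
    hsurj N (fun i => c i • x i) y t ?_ a ha
  · intro w w' hww b
    apply corner_orth _ _ w.2.1 _ w'.2.1
    intro h
    apply hww
    apply Subtype.ext
    rw [← w.2.2, ← w'.2.2]
    exact hrep2 _ _ h (w.2.1 _ h).1
  · rw [← hz]
    refine Finset.sum_congr rfl fun i _ => ?_
    rw [hxyt i, smul_mul_assoc, smul_mul_assoc]

theorem noExit_of_bounded
    (hb : ∃ n : ℕ, 0 < n ∧ ∀ a : LeavittPathAlgebra K V E s r, IsNilpotent a → a ^ n = 0) :
    ∀ es : List E, IsCycle s r es → ¬ HasExit s r es := by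
  rintro es hc ⟨f, i, hi, hf, hfe⟩
  obtain ⟨n, -, hn⟩ := hb
  have hr := reach_of_cycle es hc i hi
  generalize es[i] = e at hf hfe hr
  obtain ⟨m, x', y', hp⟩ := exists_pth (K := K) hr
  have hP := Pth.cons e _ _ _ _ hp
  have hfx : gg K V E s r f * (ee K V E s r e * x') = 0 := by
    rw [← mul_assoc, gg_ee_ne _ _ _ _ _ _ _ hfe, zero_mul]
  generalize ee K V E s r e * x' = x at hP hfx
  generalize y' * gg K V E s r e = y at hP
  have hl := hP.left
  have hrr := hP.right
  have hyx := hP.yx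
  have hid := vv_idem K V E s r (s e)
  have hgv : gg K V E s r f * vv K V E s r (s e) = gg K V E s r f := by
    rw [← hf]; exact gg_src ..
  have hge : gg K V E s r f * ee K V E s r f = vv K V E s r (r f) := gg_ee ..
  generalize vv K V E s r (s e) = v at hl hrr hyx hid hgv
  obtain ⟨a, ha, hna⟩ := lpa_unbounded_abstract (x + (1 - v)) (y + (1 - v))
    (by
      simp only [add_mul, mul_add, mul_sub, sub_mul, hyx, hl.1, hl.2, hid, mul_one, one_mul]
      abel)
    (by
      intro h
      have h1 : gg K V E s r f * ((x + (1 - v)) * (y + (1 - v))) = 0 := by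
        have h0 : gg K V E s r f * (x + (1 - v)) = 0 := by
          rw [mul_add, hfx, mul_sub, hgv]; simp
        rw [← mul_assoc, h0, zero_mul]
      rw [h, mul_one] at h1
      rw [h1, zero_mul] at hge
      exact vv_ne_zero K V E s r _ hge.symm) n
  exact hna (hn a ha)

end LPA

/-- For a finite directed graph `E` and a field `K`, no cycle in `E` has
an exit if and only if the Leavitt path algebra `L_K(E)` has bounded index of nilpotence:
there is `n ≥ 1` with `a ^ n = 0` for every nilpotent `a`. -/
theorem lpa_noExitCycles_iff_boundedIndex (K V E : Type) [Field K] [Fintype V] [Fintype E]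
    (s r : E → V) :
    (∀ es : List E, IsCycle s r es → ¬ HasExit s r es) ↔
      ∃ n : ℕ, 0 < n ∧ ∀ a : LeavittPathAlgebra K V E s r, IsNilpotent a → a ^ n = 0 :=
  ⟨LPA.bounded_of_noExit K V E s r, LPA.noExit_of_bounded K V E s r⟩
end

section
/- Let E be a finite directed graph (E⁰ and E¹ both finite) and K a field, and let L = L_K(E) be the (unital) Leavitt path algebra. Then no cycle in E has an exit if and only if L is finite over its center, i.e., L is finitely generated as a module over its center Z(L). -/
namespace LPAProof

open Relation

/-- One-step reachability in the graph. -/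
def Step {V E : Type} (s r : E → V) (v w : V) : Prop := ∃ e, s e = v ∧ r e = w

/-- Every edge on a closed path is the only edge leaving its source. -/
def NE {V E : Type} (s r : E → V) : Prop :=
  ∀ e f, ReflTransGen (Step s r) (r e) (s e) → s f = s e → f = e

/-- `l` is a path from `a` to `b`. -/
def Ch {V E : Type} (s r : E → V) : V → List E → V → Prop
  | a, [], b => a = b
  | a, e :: l, b => s e = a ∧ Ch s r (r e) l b

section graph
variable {V E : Type} {s r : E → V}

lemma ch_suffix (b : V) : ∀ (l : List E) (a c : V), Ch s r a l b → c ∈ l.map s →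
    ∃ l', l' <:+ l ∧ Ch s r c l' b := by
  intro l
  induction l with
  | nil => intro a c _ h; simp at h
  | cons e l ih =>
    intro a c h hc
    by_cases hce : s e = c
    · exact ⟨e :: l, List.suffix_rfl, hce, h.2⟩
    · have : c ∈ l.map s := by
        simp only [List.map_cons, List.mem_cons] at hc
        rcases hc with hc | hc
        · exact absurd hc.symm hce
        · exact hc
      obtain ⟨l', h1, h2⟩ := ih _ c h.2 this
      exact ⟨l', h1.trans (List.suffix_cons e l), h2⟩

lemma exists_ch {a b : V} (h : ReflTransGen (Step s r) a b) :
    ∃ l, Ch s r a l b ∧ (l.map s).Nodup ∧ b ∉ l.map s := by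
  classical
  induction h using ReflTransGen.head_induction_on with
  | refl => exact ⟨[], rfl, by simp, by simp⟩
  | head hs _ ih =>
    rename_i a a'
    obtain ⟨e, rfl, rfl⟩ := hs
    obtain ⟨l, h1, h2, h3⟩ := ih
    by_cases hb : s e = b
    · exact ⟨[], hb, by simp, by simp⟩
    by_cases hm : s e ∈ l.map s
    · obtain ⟨l', h4, h5⟩ := ch_suffix b l _ _ h1 hm
      have h6 : l'.map s <:+ l.map s := h4.map s
      exact ⟨l', h5, h2.sublist h6.sublist, fun h => h3 (h6.subset h)⟩
    · refine ⟨e :: l, ⟨rfl, h1⟩, by simpa using ⟨by simpa using hm, h2⟩, ?_⟩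
      simp only [List.map_cons, List.mem_cons, not_or]
      exact ⟨fun h => hb h.symm, h3⟩

lemma ch_chain : ∀ (l : List E) (e : E) (b : V), Ch s r (r e) l b →
    IsPathChain s r (e :: l) ∧ r ((e :: l).getLast (by simp)) = b := by
  intro l
  induction l with
  | nil => intro e b h; exact ⟨fun i h => by simp at h, h⟩
  | cons f l ih =>
    intro e b h
    obtain ⟨h1, h2⟩ := ih f b h.2
    refine ⟨?_, ?_⟩
    · intro i hi
      cases i with
      | zero => exact h.1.symm
      | succ i => exact h1 i (by simpa using hi)
    · rw [List.getLast_cons (by simp)]; exact h2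

lemma ne_of_noExit (h : ∀ es : List E, IsCycle s r es → ¬ HasExit s r es) : NE s r := by
  intro e f hr hf
  by_contra hne
  obtain ⟨l, h1, h2, h3⟩ := exists_ch hr
  obtain ⟨h4, h5⟩ := ch_chain l e _ h1
  refine h (e :: l) ⟨by simp, h4, h5, ?_⟩ ⟨f, 0, by simp, hf, hne⟩
  rw [List.map_cons, List.nodup_cons]
  exact ⟨h3, h2⟩

lemma noExit_of_ne (h : NE s r) (es : List E) (hc : IsCycle s r es) : ¬ HasExit s r es := by
  rintro ⟨f, i, hi, hf, hne⟩
  obtain ⟨hnil, hch, hlast, -⟩ := hc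
  apply hne
  refine h _ _ ?_ hf
  have key : ∀ (d j : ℕ) (hj : j + d < es.length),
      ReflTransGen (Step s r) (s (es[j]'(by omega))) (s (es[j+d]'hj)) := by
    intro d
    induction d with
    | zero => intro j hj; exact ReflTransGen.refl
    | succ d ih =>
      intro j hj
      refine (ih j (by omega)).tail ⟨es[j+d]'(by omega), rfl, ?_⟩
      exact hch (j+d) (by omega)
  have hpos : 0 < es.length := by omega
  have h0 : ReflTransGen (Step s r) (s (es.head hnil)) (s es[i]) := by
    have := key i 0 (by omega)
    simpa [List.head_eq_getElem] using this
  have hl : ReflTransGen (Step s r) (s es[i]) (s (es.getLast hnil)) := by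
    have := key (es.length - 1 - i) i (by omega)
    rw [List.getLast_eq_getElem]
    convert this using 3
    omega
  by_cases hil : i + 1 < es.length
  · rw [hch i hil]
    have h1 : ReflTransGen (Step s r) (s es[i+1]) (s (es.getLast hnil)) := by
      have := key (es.length - 1 - (i+1)) (i+1) (by omega)
      rw [List.getLast_eq_getElem]
      convert this using 3
      omega
    exact (h1.tail ⟨_, rfl, hlast⟩).trans h0
  · have : es[i] = es.getLast hnil := by
      rw [List.getLast_eq_getElem]
      congr 1
      omega
    have h2 : r es[i] = s (es.head hnil) := by rw [this]; exact hlast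
    rw [h2]; exact h0

/-- Vertices on closed paths. -/
def Cyc (s r : E → V) (v : V) : Prop := TransGen (Step s r) v v

lemma cyc_back {e : E} (h : NE s r) (hc : Cyc s r (s e)) :
    ReflTransGen (Step s r) (r e) (s e) := by
  obtain ⟨w, ⟨f, hf, rfl⟩, h2⟩ := (TransGen.head'_iff).1 hc
  have : e = f := h f e (by rw [hf]; exact h2) hf.symm
  subst this; exact h2

lemma cyc_unique {e f : E} (h : NE s r) (hc : Cyc s r (s e)) (hf : s f = s e) : f = e :=
  h e f (cyc_back h hc) hf

lemma cyc_rng {e : E} (h : NE s r) (hc : Cyc s r (s e)) : Cyc s r (r e) :=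
  TransGen.tail' (cyc_back h hc) ⟨e, rfl, rfl⟩

open Classical in
/-- The successor of a vertex on a cycle. -/
noncomputable def next (s r : E → V) (v : V) : V :=
  if h : ∃ e, s e = v then r h.choose else v

lemma next_eq {e : E} (h : NE s r) (hc : Cyc s r (s e)) : next s r (s e) = r e := by
  have hex : ∃ f, s f = s e := ⟨e, rfl⟩
  unfold next
  rw [dif_pos hex, cyc_unique h hc hex.choose_spec]

lemma cyc_exists {v : V} (hc : Cyc s r v) : ∃ e, s e = v := by
  obtain ⟨w, ⟨f, hf, rfl⟩, h2⟩ := (TransGen.head'_iff).1 hc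
  exact ⟨f, hf⟩

lemma reach_next {u w : V} (h : NE s r) (hu : Cyc s r u) (hr : TransGen (Step s r) u w) :
    Cyc s r w ∧ ∃ k, 0 < k ∧ (next s r)^[k] u = w := by
  induction hr with
  | single hs =>
    obtain ⟨e, rfl, rfl⟩ := hs
    exact ⟨cyc_rng h hu, 1, by simp, by simpa using next_eq h hu⟩
  | tail _ hs ih =>
    obtain ⟨e, rfl, rfl⟩ := hs
    obtain ⟨h1, k, hk, h2⟩ := ih
    refine ⟨cyc_rng h h1, k+1, by omega, ?_⟩
    rw [Function.iterate_succ_apply', h2, next_eq h h1]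

lemma exists_period [Fintype V] (h : NE s r) :
    ∃ M, 0 < M ∧ ∀ u, Cyc s r u → (next s r)^[M] u = u := by
  classical
  have : ∀ u, ∃ k, 0 < k ∧ (Cyc s r u → (next s r)^[k] u = u) := by
    intro u
    by_cases hu : Cyc s r u
    · obtain ⟨-, k, hk, h2⟩ := reach_next h hu hu
      exact ⟨k, hk, fun _ => h2⟩
    · exact ⟨1, by simp, fun h => absurd h hu⟩
  choose k hk h2 using this
  refine ⟨∏ u, k u, Finset.prod_pos fun u _ => hk u, fun u hu => ?_⟩
  have h3 : Function.IsPeriodicPt (next s r) (k u) u := h2 u hu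
  exact h3.trans_dvd (Finset.dvd_prod_of_mem k (Finset.mem_univ u))

open Classical in
/-- Number of vertices reachable. -/
noncomputable def ht [Fintype V] (s r : E → V) (v : V) : ℕ :=
  (Finset.univ.filter fun w => ReflTransGen (Step s r) v w).card

lemma ht_le [Fintype V] (v : V) : ht s r v ≤ Fintype.card V := by
  classical
  exact Finset.card_le_univ _

lemma ht_lt [Fintype V] {e : E} (hc : ¬ Cyc s r (s e)) : ht s r (r e) < ht s r (s e) := by
  classical
  apply Finset.card_lt_card
  rw [Finset.ssubset_iff_of_subset]
  · refine ⟨s e, by simpa using ReflTransGen.refl, ?_⟩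
    simp only [Finset.mem_filter, Finset.mem_univ, true_and]
    exact fun h => hc (TransGen.head' ⟨e, rfl, rfl⟩ h)
  · intro w
    simp only [Finset.mem_filter, Finset.mem_univ, true_and]
    exact fun h => ReflTransGen.head ⟨e, rfl, rfl⟩ h

end graph

/-- A family of elements satisfying (a part of) the Leavitt path algebra relations. -/
structure LFam {V E R : Type} [Fintype V] [Ring R] (s r : E → V) (vx : V → R)
    (ed gh : E → R) : Prop where
  orth : ∀ v w, v ≠ w → vx v * vx w = 0
  idem : ∀ v, vx v * vx v = vx v
  es : ∀ e, vx (s e) * ed e = ed e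
  er : ∀ e, ed e * vx (r e) = ed e
  gr : ∀ e, vx (r e) * gh e = gh e
  gs : ∀ e, gh e * vx (s e) = gh e
  ck1d : ∀ e f, e ≠ f → gh e * ed f = 0
  ck1s : ∀ e, gh e * ed e = vx (r e)
  ck2 : ∀ e, (∀ f, s f = s e → f = e) → vx (s e) = ed e * gh e
  one : (1 : R) = ∑ v, vx v

namespace LFam
section fam
variable {V E R : Type} [Fintype V] [Fintype E] [Ring R] {s r : E → V} {vx : V → R}
    {ed gh : E → R}

lemma op (F : LFam s r vx ed gh) : LFam s r (fun v => MulOpposite.op (vx v))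
    (fun e => MulOpposite.op (gh e)) (fun e => MulOpposite.op (ed e)) where
  orth v w h := by simp [← MulOpposite.op_mul, F.orth w v h.symm]
  idem v := by simp [← MulOpposite.op_mul, F.idem]
  es e := by simp [← MulOpposite.op_mul, F.gs]
  er e := by simp [← MulOpposite.op_mul, F.gr]
  gr e := by simp [← MulOpposite.op_mul, F.er]
  gs e := by simp [← MulOpposite.op_mul, F.es]
  ck1d e f h := by simp [← MulOpposite.op_mul, F.ck1d f e h.symm]
  ck1s e := by simp [← MulOpposite.op_mul, F.ck1s]
  ck2 e h := by simp [← MulOpposite.op_mul, ← F.ck2 e h]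
  one := by rw [← MulOpposite.op_one, F.one]; exact Finset.op_sum _ _

lemma vx_ed (F : LFam s r vx ed gh) {v : V} {e : E} (h : v ≠ s e) : vx v * ed e = 0 := by
  rw [← F.es e, ← mul_assoc, F.orth _ _ h, zero_mul]

lemma ed_vx (F : LFam s r vx ed gh) {v : V} {e : E} (h : r e ≠ v) : ed e * vx v = 0 := by
  rw [← F.er e, mul_assoc, F.orth _ _ h, mul_zero]

lemma vx_gh (F : LFam s r vx ed gh) {v : V} {e : E} (h : v ≠ r e) : vx v * gh e = 0 := by
  rw [← F.gr e, ← mul_assoc, F.orth _ _ h, zero_mul]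

lemma gh_vx (F : LFam s r vx ed gh) {v : V} {e : E} (h : s e ≠ v) : gh e * vx v = 0 := by
  rw [← F.gs e, mul_assoc, F.orth _ _ h, mul_zero]

/-- The shift endomorphism. -/
def phi (ed gh : E → R) : R →+ R where
  toFun a := ∑ e, ed e * a * gh e
  map_zero' := by simp
  map_add' a b := by simp [mul_add, add_mul, Finset.sum_add_distrib]

lemma iter_sum (f : R →+ R) (k : ℕ) (t : Finset E) (g : E → R) :
    f^[k] (∑ e ∈ t, g e) = ∑ e ∈ t, f^[k] (g e) := by
  induction k with
  | zero => rfl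
  | succ k ih =>
    simp only [Function.iterate_succ_apply']
    rw [ih, map_sum]

lemma phi_ed (F : LFam s r vx ed gh) {a : R} (ha : ∀ v, vx v * a = a * vx v) (e : E) :
    phi ed gh a * ed e = ed e * a := by
  classical
  simp only [phi, AddMonoidHom.coe_mk, ZeroHom.coe_mk, Finset.sum_mul]
  rw [Finset.sum_eq_single e]
  · rw [mul_assoc, F.ck1s, mul_assoc, ← ha, ← mul_assoc, F.er]
  · intro f _ hf
    rw [mul_assoc, F.ck1d f e hf, mul_zero]
  · simp

lemma gh_phi (F : LFam s r vx ed gh) {a : R} (ha : ∀ v, vx v * a = a * vx v) (e : E) :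
    gh e * phi ed gh a = a * gh e := by
  classical
  simp only [phi, AddMonoidHom.coe_mk, ZeroHom.coe_mk, Finset.mul_sum]
  rw [Finset.sum_eq_single e]
  · rw [← mul_assoc, ← mul_assoc, F.ck1s, ha, mul_assoc, F.gr]
  · intro f _ hf
    rw [← mul_assoc, ← mul_assoc, F.ck1d e f hf.symm, zero_mul, zero_mul]
  · simp

lemma phi_comm (F : LFam s r vx ed gh) {a : R} (v : V) :
    vx v * phi ed gh a = phi ed gh a * vx v := by
  classical
  simp only [phi, AddMonoidHom.coe_mk, ZeroHom.coe_mk, Finset.mul_sum, Finset.sum_mul]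
  refine Finset.sum_congr rfl fun e _ => ?_
  by_cases h : v = s e
  · subst h
    rw [← mul_assoc, ← mul_assoc, F.es, mul_assoc _ (gh e), F.gs]
  · rw [← mul_assoc, ← mul_assoc, F.vx_ed h, mul_assoc _ (gh e), F.gh_vx (Ne.symm h)]
    simp

lemma phi_iter_zero (F : LFam s r vx ed gh) (hN : NE s r) (k : ℕ) : ∀ (u : V) (y : R),
    ¬ Cyc s r u → Fintype.card V < k + ht s r u → (phi ed gh)^[k] (vx u * y) = 0 := by
  induction k with
  | zero =>
    intro u y _ h
    have := ht_le (s := s) (r := r) u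
    omega
  | succ k ih =>
    intro u y hu h
    have h0 : ∀ t : Finset E, ∀ g : E → R, (phi ed gh)^[k] (∑ e ∈ t, g e) =
        ∑ e ∈ t, (phi ed gh)^[k] (g e) := by
      intro t g
      exact iter_sum _ k t g
    rw [Function.iterate_succ_apply]
    change (phi ed gh)^[k] (∑ e, ed e * (vx u * y) * gh e) = 0
    rw [h0]
    refine Finset.sum_eq_zero fun e _ => ?_
    by_cases he : r e = u
    · subst he
      have hs : ¬ Cyc s r (s e) := fun hc => hu (cyc_rng hN hc)
      have := ih (s e) (ed e * (vx (r e) * y) * gh e) hs (by have := ht_lt hs; omega)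
      rwa [← mul_assoc, ← mul_assoc, F.es] at this
    · rw [← mul_assoc, F.ed_vx he]
      rw [zero_mul, zero_mul]
      exact iterate_map_zero _ k

lemma prod_vx_zero (F : LFam s r vx ed gh) (hN : NE s r) (p : List E) : ∀ (u : V),
    ¬ Cyc s r u → Fintype.card V < p.length + ht s r u → (p.map ed).prod * vx u = 0 := by
  induction p using List.reverseRecOn with
  | nil =>
    intro u _ h
    have := ht_le (s := s) (r := r) u
    simp at h
    omega
  | append_singleton p e ih =>
    intro u hu h
    rw [List.map_append, List.prod_append, List.map_singleton, List.prod_singleton, mul_assoc]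
    by_cases he : r e = u
    · subst he
      have hs : ¬ Cyc s r (s e) := fun hc => hu (cyc_rng hN hc)
      have := ih (s e) hs (by have := ht_lt hs; simp at h; omega)
      rw [F.er, ← F.es e, ← mul_assoc, this, zero_mul]
    · rw [F.ed_vx he, mul_zero]

lemma prod_long (F : LFam s r vx ed gh) (hN : NE s r) (p : List E)
    (hp : Fintype.card V < p.length) : (p.map ed).prod = 0 ∨
      ∃ u, Cyc s r u ∧ (p.map ed).prod = (p.map ed).prod * vx u := by
  rcases List.eq_nil_or_concat' p with rfl | ⟨l, e, rfl⟩
  · simp at hp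
  · have h1 : ((l ++ [e]).map ed).prod = ((l ++ [e]).map ed).prod * vx (r e) := by
      simp [mul_assoc, F.er]
    by_cases hc : Cyc s r (r e)
    · exact Or.inr ⟨_, hc, h1⟩
    · left
      rw [h1]
      exact F.prod_vx_zero hN _ _ hc (by omega)

open Classical in
/-- The sum of all edges lying on cycles. -/
noncomputable def cycSum (s r : E → V) (ed : E → R) : R :=
  ∑ e with Cyc s r (s e), ed e

lemma vx_cyc (F : LFam s r vx ed gh) (hN : NE s r) {e : E} (hc : Cyc s r (s e)) :
    vx (s e) * cycSum s r ed = ed e := by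
  classical
  rw [cycSum, Finset.mul_sum, Finset.sum_eq_single e]
  · exact F.es e
  · intro f _ hf
    exact F.vx_ed fun h => hf (cyc_unique hN hc h.symm)
  · intro h; simp [hc] at h

lemma vx_noncyc (F : LFam s r vx ed gh) {v : V} (hc : ¬ Cyc s r v) :
    vx v * cycSum s r ed = 0 := by
  classical
  rw [cycSum, Finset.mul_sum]
  refine Finset.sum_eq_zero fun f hf => F.vx_ed ?_
  rintro rfl
  simp at hf
  exact hc hf

lemma vx_cyc_next (F : LFam s r vx ed gh) (hN : NE s r) {v : V} (hc : Cyc s r v) :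
    vx v * cycSum s r ed = vx v * cycSum s r ed * vx (next s r v) ∧ Cyc s r (next s r v) := by
  obtain ⟨e, rfl⟩ := cyc_exists hc
  rw [F.vx_cyc hN hc, next_eq hN hc, F.er]
  exact ⟨rfl, cyc_rng hN hc⟩

lemma vx_cyc_pow (F : LFam s r vx ed gh) (hN : NE s r) (k : ℕ) {v : V} (hc : Cyc s r v) :
    vx v * cycSum s r ed ^ k = vx v * cycSum s r ed ^ k * vx ((next s r)^[k] v) ∧
      Cyc s r ((next s r)^[k] v) := by
  induction k with
  | zero => simp [F.idem, hc]
  | succ k ih =>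
    obtain ⟨h1, h2⟩ := ih
    obtain ⟨h3, h4⟩ := F.vx_cyc_next hN h2
    rw [Function.iterate_succ_apply']
    refine ⟨?_, h4⟩
    rw [pow_succ, ← mul_assoc, h1, mul_assoc _ (vx _), h3]
    simp only [mul_assoc, F.idem]

lemma cyc_pow_comm (F : LFam s r vx ed gh) (hN : NE s r) {M : ℕ} (hM : 0 < M)
    (hper : ∀ u, Cyc s r u → (next s r)^[M] u = u) (v : V) :
    vx v * cycSum s r ed ^ M = cycSum s r ed ^ M * vx v := by
  classical
  have h1 : ∀ u, vx u * cycSum s r ed ^ M = vx u * cycSum s r ed ^ M * vx u := by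
    intro u
    by_cases hu : Cyc s r u
    · have := (F.vx_cyc_pow hN M hu).1
      rwa [hper u hu] at this
    · obtain ⟨m, rfl⟩ : ∃ m, M = m + 1 := ⟨M - 1, by omega⟩
      rw [pow_succ', ← mul_assoc, F.vx_noncyc hu, zero_mul, zero_mul]
  have h2 : cycSum s r ed ^ M = ∑ u, vx u * cycSum s r ed ^ M * vx u := by
    conv_lhs => rw [← one_mul (cycSum s r ed ^ M), F.one, Finset.sum_mul]
    exact Finset.sum_congr rfl fun u _ => h1 u
  have h3 : cycSum s r ed ^ M * vx v = vx v * cycSum s r ed ^ M * vx v := by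
    conv_lhs => rw [h2, Finset.sum_mul]
    rw [Finset.sum_eq_single v]
    · rw [mul_assoc, F.idem]
    · intro u _ hu
      rw [mul_assoc, F.orth u v hu, mul_zero]
    · simp
  rw [h3, ← h1]

lemma vx_list (F : LFam s r vx ed gh) (hN : NE s r) (p : List E) : ∀ {u : V}, Cyc s r u →
    vx u * (p.map ed).prod = 0 ∨
      vx u * (p.map ed).prod = vx u * cycSum s r ed ^ p.length := by
  induction p with
  | nil => intro u _; right; simp
  | cons e p ih =>
    intro u hu
    rw [List.map_cons, List.prod_cons, List.length_cons, pow_succ', ← mul_assoc, ← mul_assoc]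
    by_cases h : u = s e
    · subst h
      rw [F.es, F.vx_cyc hN hu, ← F.er e, mul_assoc, mul_assoc]
      rcases ih (cyc_rng hN hu) with h | h
      · left; rw [h, mul_zero]
      · right; rw [h]
    · left; rw [F.vx_ed h, zero_mul]

lemma main (F : LFam s r vx ed gh) (hN : NE s r) {M : ℕ} (hM : 0 < M)
    (hper : ∀ u, Cyc s r u → (next s r)^[M] u = u) : ∃ z : R,
    (∀ v, vx v * z = z * vx v) ∧ (∀ e, ed e * z = z * ed e) ∧ (∀ e, gh e * z = z * gh e) ∧
    ∀ p q : List E, p.length = Fintype.card V + 1 → q.length = M →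
      (p.map ed).prod * (q.map ed).prod = 0 ∨
      (p.map ed).prod * (q.map ed).prod = z * (p.map ed).prod := by
  classical
  set A := cycSum s r ed with hA
  set x := A ^ M with hx
  set n := Fintype.card V + 1 with hn
  have hxc : ∀ v, vx v * x = x * vx v := F.cyc_pow_comm hN hM hper
  have hkc : ∀ k v, vx v * (phi ed gh)^[k] x = (phi ed gh)^[k] x * vx v := by
    intro k v
    cases k with
    | zero => exact hxc v
    | succ k => rw [Function.iterate_succ_apply']; exact F.phi_comm v
  have h1 : ∃ y : E → R, phi ed gh x = x + ∑ e with ¬ Cyc s r (s e), vx (s e) * y e := by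
    refine ⟨fun e => ed e * x * gh e, ?_⟩
    have ha : phi ed gh x = ∑ e, ed e * x * gh e := rfl
    have hb : ∀ e, Cyc s r (s e) → ed e * x * gh e = vx (s e) * x := by
      intro e he
      have h2 : ed e * x = x * ed e := by
        rw [← F.vx_cyc hN he, mul_assoc, ← hA, hx, ← pow_succ', pow_succ, ← mul_assoc,
          ← hx, hxc, mul_assoc]
      rw [h2, mul_assoc, ← F.ck2 e (fun f hf => cyc_unique hN he hf), hxc]
    have hc : x = ∑ e with Cyc s r (s e), ed e * x * gh e := by
      have h3 : ∑ e with Cyc s r (s e), ed e * x * gh e = ∑ v with Cyc s r v, vx v * x := by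
        refine Finset.sum_bij (fun e _ => s e) ?_ ?_ ?_ ?_
        · intro e he; simpa using he
        · intro e he f hf h
          simp at he hf
          exact cyc_unique hN hf h
        · intro v hv
          simp at hv
          obtain ⟨e, rfl⟩ := cyc_exists hv
          exact ⟨e, by simpa using hv, rfl⟩
        · intro e he
          simp at he
          exact hb e he
      rw [h3]
      conv_lhs => rw [← one_mul x, F.one, Finset.sum_mul]
      rw [← Finset.sum_filter_add_sum_filter_not Finset.univ (fun v => Cyc s r v)]
      rw [add_eq_left]
      refine Finset.sum_eq_zero fun v hv => ?_
      simp at hv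
      obtain ⟨m, rfl⟩ : ∃ m, M = m + 1 := ⟨M - 1, by omega⟩
      rw [hx, pow_succ', ← mul_assoc, F.vx_noncyc hv, zero_mul]
    rw [ha, ← Finset.sum_filter_add_sum_filter_not Finset.univ (fun e => Cyc s r (s e)), ← hc]
    congr 1
    refine Finset.sum_congr rfl fun e _ => ?_
    rw [← mul_assoc, ← mul_assoc, F.es]
  obtain ⟨y, hy⟩ := h1
  set z := (phi ed gh)^[n] x with hz
  have hfix : phi ed gh z = z := by
    rw [hz, ← Function.iterate_succ_apply' (phi ed gh), Function.iterate_succ_apply, hy,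
      iterate_map_add, iter_sum]
    rw [add_eq_left]
    refine Finset.sum_eq_zero fun e he => ?_
    simp at he
    exact F.phi_iter_zero hN n (s e) (y e) he (by omega)
  have hlist : ∀ p : List E, (phi ed gh)^[p.length] x * (p.map ed).prod = (p.map ed).prod * x := by
    intro p
    induction p with
    | nil => simp
    | cons e p ih =>
      rw [List.map_cons, List.prod_cons, List.length_cons, Function.iterate_succ_apply',
        ← mul_assoc, F.phi_ed (hkc _), mul_assoc, ih, mul_assoc]
  refine ⟨z, hkc n, ?_, ?_, ?_⟩
  · intro e
    rw [← F.phi_ed (hkc n) e, ← hz, hfix]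
  · intro e
    rw [← F.gh_phi (hkc n) e, ← hz, hfix]
  · intro p q hp hq
    rcases F.prod_long hN p (by omega) with h | ⟨u, hu, h⟩
    · left; rw [h, zero_mul]
    · rcases F.vx_list hN q hu with h2 | h2
      · left; rw [h, mul_assoc, h2, mul_zero]
      · right
        rw [h, mul_assoc, h2, hq, ← hA, ← hx, ← mul_assoc, ← h, ← hlist p, hp, ← hz]

/-- If the ring is finite over its center then no cycle has an exit. -/
lemma ne_of_finite (F : LFam s r vx ed gh) (hnz : ∀ v, vx v ≠ 0)
    [Module.Finite (Subring.center R) R] : NE s r := by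
  intro e f hr hf
  by_contra hne
  have key : ∃ a b : R, b * a = vx (s e) ∧ vx (r e) * a = a ∧ a * vx (s e) = a ∧
      b * vx (r e) = b ∧ vx (s e) * b = b := by
    generalize s e = w at hr
    induction hr with
    | refl => exact ⟨vx (r e), vx (r e), F.idem _, F.idem _, F.idem _, F.idem _, F.idem _⟩
    | tail _ hs ih =>
      obtain ⟨g, rfl, rfl⟩ := hs
      obtain ⟨a, b, h1, h2, h3, h4, h5⟩ := ih
      refine ⟨a * ed g, gh g * b, ?_, ?_, ?_, ?_, ?_⟩
      · rw [mul_assoc, ← mul_assoc b, h1, F.es, F.ck1s]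
      · rw [← mul_assoc, h2]
      · rw [mul_assoc, F.er]
      · rw [mul_assoc, h4]
      · rw [← mul_assoc, F.gr]
  obtain ⟨a, b, h1, h2, h3, h4, h5⟩ := key
  set v := vx (s e) with hv
  have hvv : v * v = v := F.idem _
  set c := ed e * a with hc
  set d := b * gh e with hd
  have hdc : d * c = v := by
    rw [hc, hd, mul_assoc, ← mul_assoc (gh e), F.ck1s, h2, h1]
  have hvc : v * c = c := by rw [hc, ← mul_assoc, F.es]
  have hdv : d * v = d := by rw [hd, mul_assoc, F.gs]
  have hcv : c * v = c := by rw [hc, mul_assoc, h3]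
  have hvd : v * d = d := by rw [hd, ← mul_assoc, h5]
  have hba : (d + (1 - v)) * (c + (1 - v)) = 1 := by
    simp only [mul_add, add_mul, mul_sub, sub_mul, hdc, hvc, hdv, hvv, mul_one, one_mul]
    abel
  have hsurj : Function.Surjective (LinearMap.mulLeft (Subring.center R) (d + (1 - v))) := by
    intro y
    exact ⟨(c + (1 - v)) * y, by simp [← mul_assoc, hba]⟩
  have hinj := OrzechProperty.injective_of_surjective_endomorphism _ hsurj
  have hab : (c + (1 - v)) * (d + (1 - v)) = 1 := by
    apply hinj
    simp only [LinearMap.mulLeft_apply]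
    rw [← mul_assoc, hba, one_mul, mul_one]
  have hcd : c * d = v := by
    simp only [mul_add, add_mul, mul_sub, sub_mul, hcv, hvd, hvv, mul_one, one_mul] at hab
    have : c * d - v = 0 := by
      rw [← sub_eq_zero] at hab
      rw [← hab]; abel
    exact sub_eq_zero.1 this
  have hf0 : ed f = 0 := by
    rw [← F.es f, hf, ← hv, ← hcd, mul_assoc, hd, mul_assoc b, F.ck1d e f (Ne.symm hne)]
    simp
  apply hnz (r f)
  rw [← F.ck1s, hf0, mul_zero]

end fam
end LFam

section algebra
variable (K V E : Type) [Field K] [Fintype V] [Fintype E] (s r : E → V)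

/-- The image of a generator. -/
def gen (g : LPAGen V E) : LeavittPathAlgebra K V E s r :=
  RingQuot.mkAlgHom K (LPARel K V E s r) (FreeAlgebra.ι K g)

lemma fam : LFam s r (fun v => gen K V E s r (.vertex v)) (fun e => gen K V E s r (.edge e))
    (fun e => gen K V E s r (.ghost e)) := by
  have h := fun {x y} (hr : LPARel K V E s r x y) => RingQuot.mkAlgHom_rel K hr
  constructor
  · intro v w hvw
    have := h (.vertex_orth v w hvw)
    rwa [map_mul, map_zero] at this
  · intro v
    have := h (.vertex_idem v)
    rwa [map_mul] at this
  · intro e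
    have := h (.edge_src e)
    rwa [map_mul] at this
  · intro e
    have := h (.edge_rng e)
    rwa [map_mul] at this
  · intro e
    have := h (.ghost_rng e)
    rwa [map_mul] at this
  · intro e
    have := h (.ghost_src e)
    rwa [map_mul] at this
  · intro e f hef
    have := h (.ck1_distinct e f hef)
    rwa [map_mul, map_zero] at this
  · intro e
    have := h (.ck1_same e)
    rwa [map_mul] at this
  · intro e he
    have := h (.ck2 (s e) (Set.toFinite _) ⟨e, rfl⟩)
    rw [map_sum, Finset.sum_eq_single e, map_mul] at this
    · exact this
    · intro f hf hne
      simp at hf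
      exact absurd (he f hf) hne
    · intro h; simp at h
  · have := h .unit
    rwa [map_one, map_sum] at this

variable {K V E s r} in
lemma gen_induct {P : LeavittPathAlgebra K V E s r → Prop}
    (hK : ∀ k : K, P (algebraMap K _ k)) (hg : ∀ g, P (gen K V E s r g))
    (hm : ∀ a b, P a → P b → P (a * b)) (ha : ∀ a b, P a → P b → P (a + b)) (x) : P x := by
  obtain ⟨y, rfl⟩ := RingQuot.mkAlgHom_surjective K (LPARel K V E s r) x
  induction y using FreeAlgebra.induction with
  | grade0 k => rw [AlgHom.commutes]; exact hK k
  | grade1 g => exact hg g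
  | mul a b h1 h2 => rw [map_mul]; exact hm _ _ h1 h2
  | add a b h1 h2 => rw [map_add]; exact ha _ _ h1 h2

variable {K V E s r} in
lemma mem_center_of_comm {z : LeavittPathAlgebra K V E s r}
    (h : ∀ g, gen K V E s r g * z = z * gen K V E s r g) :
    z ∈ Subring.center (LeavittPathAlgebra K V E s r) := by
  rw [Subring.mem_center_iff]
  intro x
  induction x using gen_induct with
  | hK k => exact Algebra.commutes k z
  | hg g => exact h g
  | hm a b h1 h2 => rw [mul_assoc, h2, ← mul_assoc, h1, mul_assoc]
  | ha a b h1 h2 => rw [add_mul, mul_add, h1, h2]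

/-- Product of edges. -/
def eprod (p : List E) : LeavittPathAlgebra K V E s r :=
  (p.map fun e => gen K V E s r (.edge e)).prod

/-- Product of ghost edges, in reverse order. -/
def gprod (p : List E) : LeavittPathAlgebra K V E s r :=
  (p.reverse.map fun e => gen K V E s r (.ghost e)).prod

/-- Standard monomials. -/
def mono (t : List E × V × List E) : LeavittPathAlgebra K V E s r :=
  eprod K V E s r t.1 * gen K V E s r (.vertex t.2.1) * gprod K V E s r t.2.2

lemma span_mono : Submodule.span (Subring.center (LeavittPathAlgebra K V E s r))
    (Set.range (mono K V E s r)) = ⊤ := by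
  classical
  have F := fam K V E s r
  set N := Submodule.span (Subring.center (LeavittPathAlgebra K V E s r))
    (Set.range (mono K V E s r)) with hN
  have hmono : ∀ p v q, eprod K V E s r p * gen K V E s r (.vertex v) * gprod K V E s r q ∈ N :=
    fun p v q => Submodule.subset_span ⟨(p, v, q), rfl⟩
  have hv : ∀ w p v q, gen K V E s r (.vertex w) * (eprod K V E s r p *
      gen K V E s r (.vertex v) * gprod K V E s r q) ∈ N := by
    intro w p v q
    cases p with
    | nil =>
      by_cases h : w = v
      · subst h
        have := hmono [] w q
        simp only [eprod, List.map_nil, List.prod_nil, one_mul] at this ⊢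
        rw [← mul_assoc, F.idem]
        exact this
      · simp only [eprod, List.map_nil, List.prod_nil, one_mul]
        rw [← mul_assoc, F.orth w v h, zero_mul]
        exact N.zero_mem
    | cons e p =>
      have := hmono (e :: p) v q
      simp only [eprod, List.map_cons, List.prod_cons] at this ⊢
      simp only [mul_assoc] at this ⊢
      rw [← mul_assoc (gen K V E s r (.vertex w))]
      by_cases h : w = s e
      · subst h
        rw [F.es]
        exact this
      · rw [F.vx_ed h, zero_mul]
        exact N.zero_mem
  have hg : ∀ g p v q, gen K V E s r g * (eprod K V E s r p *
      gen K V E s r (.vertex v) * gprod K V E s r q) ∈ N := by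
    intro g p v q
    cases g with
    | vertex w => exact hv w p v q
    | edge e =>
      have := hmono (e :: p) v q
      simp only [eprod, List.map_cons, List.prod_cons, mul_assoc] at this ⊢
      exact this
    | ghost e =>
      cases p with
      | nil =>
        simp only [eprod, List.map_nil, List.prod_nil, one_mul]
        rw [← mul_assoc]
        by_cases h : s e = v
        · subst h
          rw [F.gs]
          have := hmono [] (r e) (q ++ [e])
          simp only [eprod, List.map_nil, List.prod_nil, one_mul, gprod, List.reverse_append,
            List.reverse_singleton, List.map_append, List.prod_append, List.map_singleton,
            List.prod_singleton] at this
          rw [← mul_assoc, F.gr] at this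
          exact this
        · rw [F.gh_vx h, zero_mul]
          exact N.zero_mem
      | cons f p =>
        have := hv (r e) p v q
        simp only [eprod, List.map_cons, List.prod_cons, mul_assoc] at this ⊢
        rw [← mul_assoc]
        by_cases h : e = f
        · subst h
          rw [F.ck1s]
          exact this
        · rw [F.ck1d e f h, zero_mul]
          exact N.zero_mem
  have hall : ∀ x, ∀ y ∈ N, x * y ∈ N := by
    intro x
    induction x using gen_induct with
    | hK k =>
      intro y hy
      exact N.smul_mem ⟨algebraMap K _ k, Subring.mem_center_iff.2
        fun g => (Algebra.commutes k g).symm⟩ hy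
    | hg g =>
      intro y hy
      induction hy using Submodule.span_induction with
      | mem y hy =>
        obtain ⟨⟨p, v, q⟩, rfl⟩ := hy
        exact hg g p v q
      | zero => rw [mul_zero]; exact N.zero_mem
      | add a b _ _ h1 h2 => rw [mul_add]; exact N.add_mem h1 h2
      | smul c a _ h1 => rw [mul_smul_comm]; exact N.smul_mem c h1
    | hm a b h1 h2 => intro y hy; rw [mul_assoc]; exact h1 _ (h2 y hy)
    | ha a b h1 h2 => intro y hy; rw [add_mul]; exact N.add_mem (h1 y hy) (h2 y hy)
  rw [eq_top_iff]
  intro x _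
  rw [← mul_one x]
  refine hall x 1 ?_
  rw [F.one]
  refine N.sum_mem fun v _ => ?_
  simpa [eprod, gprod] using hmono [] v []

lemma finite_of_ne (hN : NE s r) : Module.Finite
    (Subring.center (LeavittPathAlgebra K V E s r)) (LeavittPathAlgebra K V E s r) := by
  classical
  obtain ⟨M, hM, hper⟩ := exists_period hN
  have F := fam K V E s r
  obtain ⟨z, z1, z2, z3, z4⟩ := F.main hN hM hper
  obtain ⟨w', w1, w2, w3, w4⟩ := F.op.main hN hM hper
  set B := Fintype.card V + 1 + M with hB
  have hz : z ∈ Subring.center (LeavittPathAlgebra K V E s r) := by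
    apply mem_center_of_comm
    rintro (v | e | e)
    · exact z1 v
    · exact z2 e
    · exact z3 e
  obtain ⟨w, rfl⟩ := MulOpposite.op_surjective w'
  have hw : w ∈ Subring.center (LeavittPathAlgebra K V E s r) := by
    apply mem_center_of_comm
    rintro (v | e | e)
    · exact (MulOpposite.op_injective (w1 v)).symm
    · exact (MulOpposite.op_injective (w3 e)).symm
    · exact (MulOpposite.op_injective (w2 e)).symm
  have hop : ∀ p : List E, (p.map fun e => MulOpposite.op (gen K V E s r (.ghost e))).prod =
      MulOpposite.op (gprod K V E s r p) := by
    intro p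
    induction p with
    | nil => simp [gprod]
    | cons e p ih =>
      rw [List.map_cons, List.prod_cons, ih, ← MulOpposite.op_mul]
      simp [gprod]
  have gapp : ∀ p q, gprod K V E s r (p ++ q) = gprod K V E s r q * gprod K V E s r p := by
    intro p q; simp [gprod]
  have eapp : ∀ p q, eprod K V E s r (p ++ q) = eprod K V E s r p * eprod K V E s r q := by
    intro p q; simp [eprod]
  have hsplit : ∀ p : List E, B ≤ p.length → ∃ p1 p3 p2, p = p1 ++ p3 ++ p2 ∧
      p1.length = Fintype.card V + 1 ∧ p3.length = M := by
    intro p hp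
    refine ⟨p.take (Fintype.card V + 1), (p.drop (Fintype.card V + 1)).take M,
      (p.drop (Fintype.card V + 1)).drop M, ?_, ?_, ?_⟩
    · rw [List.append_assoc, List.take_append_drop, List.take_append_drop]
    · rw [List.length_take]; omega
    · rw [List.length_take, List.length_drop]; omega
  have hred : ∀ p : List E, B ≤ p.length → ∃ p' : List E, p'.length < p.length ∧
      (eprod K V E s r p = 0 ∨ eprod K V E s r p = z * eprod K V E s r p') := by
    intro p hp
    obtain ⟨p1, p3, p2, rfl, h1, h3⟩ := hsplit p hp
    refine ⟨p1 ++ p2, by simp; omega, ?_⟩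
    rw [eapp, eapp, eapp]
    rcases z4 p1 p3 h1 h3 with h | h
    · left
      change eprod K V E s r p1 * eprod K V E s r p3 = 0 at h
      rw [h, zero_mul]
    · right
      change eprod K V E s r p1 * eprod K V E s r p3 = z * eprod K V E s r p1 at h
      rw [h, mul_assoc]
  have hredg : ∀ p : List E, B ≤ p.length → ∃ p' : List E, p'.length < p.length ∧
      (gprod K V E s r p = 0 ∨ gprod K V E s r p = w * gprod K V E s r p') := by
    intro p hp
    obtain ⟨p1, p3, p2, rfl, h1, h3⟩ := hsplit p hp
    refine ⟨p1 ++ p2, by simp; omega, ?_⟩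
    have h4 := w4 p1 p3 h1 h3
    rw [hop, hop, ← MulOpposite.op_mul, ← MulOpposite.op_mul] at h4
    rw [gapp, gapp, gapp]
    rcases h4 with h | h
    · left
      have h : gprod K V E s r p3 * gprod K V E s r p1 = 0 :=
        MulOpposite.op_injective h
      rw [h, mul_zero]
    · right
      have h : gprod K V E s r p3 * gprod K V E s r p1 = gprod K V E s r p1 * w :=
        MulOpposite.op_injective h
      rw [h, ← mul_assoc, Subring.mem_center_iff.1 hw]
  set S : Set (List E × V × List E) := {l | l.length < B} ×ˢ (Set.univ ×ˢ {l | l.length < B})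
    with hS
  have hSf : S.Finite := (List.finite_length_lt E B).prod
    (Set.finite_univ.prod (List.finite_length_lt E B))
  have key : ∀ k p v q, p.length + q.length ≤ k → mono K V E s r (p, v, q) ∈
      Submodule.span (Subring.center (LeavittPathAlgebra K V E s r)) (mono K V E s r '' S) := by
    intro k
    induction k using Nat.strong_induction_on with
    | _ k ih =>
    intro p v q hk
    by_cases hp : B ≤ p.length
    · obtain ⟨p', hp', h⟩ := hred p hp
      rcases h with h | h
      · simp [mono, h]
      · have := ih (p'.length + q.length) (by omega) p' v q le_rfl
        have h5 : mono K V E s r (p, v, q) = z * mono K V E s r (p', v, q) := by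
          simp only [mono, h, mul_assoc]
        rw [h5]
        exact Submodule.smul_mem _ (⟨z, hz⟩ : Subring.center _) this
    by_cases hq : B ≤ q.length
    · obtain ⟨q', hq', h⟩ := hredg q hq
      rcases h with h | h
      · simp [mono, h]
      · have := ih (p.length + q'.length) (by omega) p v q' le_rfl
        have h5 : mono K V E s r (p, v, q) = w * mono K V E s r (p, v, q') := by
          simp only [mono, h]
          rw [← mul_assoc, Subring.mem_center_iff.1 hw, mul_assoc]
        rw [h5]
        exact Submodule.smul_mem _ (⟨w, hw⟩ : Subring.center _) this
    · exact Submodule.subset_span ⟨(p, v, q), ⟨by simpa using hp, trivial, by simpa using hq⟩, rfl⟩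
  refine ⟨?_⟩
  have htop : Submodule.span (Subring.center (LeavittPathAlgebra K V E s r))
      (mono K V E s r '' S) = ⊤ := by
    rw [eq_top_iff, ← span_mono, Submodule.span_le]
    rintro _ ⟨⟨p, v, q⟩, rfl⟩
    exact key _ p v q le_rfl
  rw [← htop]
  exact Submodule.fg_span (hSf.image _)

variable {V E} in
/-- Splitting data for a faithful-on-vertices representation. -/
lemma exists_split : ∃ (σ : E → ℕ → ℕ),
    (∀ e f n m, s e = s f → σ e n = σ f m → e = f ∧ n = m) ∧
    (∀ e0 m, ∃ e n, s e = s e0 ∧ σ e n = m) := by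
  classical
  have : ∀ v, ∃ φ : ({e // s e = v} × ℕ → ℕ), (∃ e, s e = v) → Function.Bijective φ := by
    intro v
    by_cases h : ∃ e, s e = v
    · obtain ⟨e, he⟩ := h
      have : Nonempty {e // s e = v} := ⟨⟨e, he⟩⟩
      obtain ⟨φ⟩ := nonempty_equiv_of_countable (α := {e // s e = v} × ℕ) (β := ℕ)
      exact ⟨φ, fun _ => φ.bijective⟩
    · exact ⟨fun _ => 0, fun h' => absurd h' h⟩
  choose φ hφ using this
  have hdep : ∀ (v : V) (f : E) (hf : s f = v) (m : ℕ), φ (s f) (⟨f, rfl⟩, m) =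
      φ v (⟨f, hf⟩, m) := by
    rintro v f rfl m
    rfl
  refine ⟨fun e n => φ (s e) (⟨e, rfl⟩, n), ?_, ?_⟩
  · intro e f n m h heq
    simp only at heq
    rw [hdep (s e) f h.symm m] at heq
    have := (hφ (s e) ⟨e, rfl⟩).1 heq
    simpa using this
  · intro e0 m
    obtain ⟨⟨⟨e, he⟩, n⟩, h⟩ := (hφ (s e0) ⟨e0, rfl⟩).2 m
    exact ⟨e, n, he, by rw [← h]; exact hdep _ e he n⟩

section rep
open Classical

variable {V E}

/-- Action of a vertex. -/
noncomputable def opV (v : V) : Module.End K (V → ℕ → K) where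
  toFun g w m := if w = v then g w m else 0
  map_add' a b := by ext w m; by_cases h : w = v <;> simp [h]
  map_smul' c a := by ext w m; by_cases h : w = v <;> simp [h]

/-- Action of an edge. -/
noncomputable def opE (τ : E → ℕ → Option ℕ) (e : E) : Module.End K (V → ℕ → K) where
  toFun g w m := if w = s e then (τ e m).elim 0 (g (r e)) else 0
  map_add' a b := by ext w m; by_cases h : w = s e <;> cases h2 : τ e m <;> simp [h, h2]
  map_smul' c a := by ext w m; by_cases h : w = s e <;> cases h2 : τ e m <;> simp [h, h2]

/-- Action of a ghost edge. -/
noncomputable def opG (σ : E → ℕ → ℕ) (e : E) : Module.End K (V → ℕ → K) where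
  toFun g w n := if w = r e then g (s e) (σ e n) else 0
  map_add' a b := by ext w m; by_cases h : w = r e <;> simp [h]
  map_smul' c a := by ext w m; by_cases h : w = r e <;> simp [h]

/-- Action of a generator. -/
noncomputable def opGen (σ : E → ℕ → ℕ) (τ : E → ℕ → Option ℕ) :
    LPAGen V E → Module.End K (V → ℕ → K)
  | .vertex v => opV K v
  | .edge e => opE K s r τ e
  | .ghost e => opG K s r σ e

lemma rep_rel (σ : E → ℕ → ℕ) (τ : E → ℕ → Option ℕ)
    (h1 : ∀ e f n m, s e = s f → σ e n = σ f m → e = f ∧ n = m)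
    (h2 : ∀ e0 m, ∃ e n, s e = s e0 ∧ σ e n = m)
    (h3 : ∀ e m n, τ e m = some n ↔ σ e n = m) ⦃x y⦄ (h : LPARel K V E s r x y) :
    FreeAlgebra.lift K (opGen K s r σ τ) x = FreeAlgebra.lift K (opGen K s r σ τ) y := by
  cases h with
  | vertex_orth v w h =>
    simp only [map_mul, FreeAlgebra.lift_ι_apply, map_zero, opGen]
    refine LinearMap.ext fun g => funext fun u => funext fun m => ?_
    by_cases hu : u = v
    · subst hu; simp [opV, h]
    · simp [opV, hu]
  | vertex_idem v =>
    simp only [map_mul, FreeAlgebra.lift_ι_apply, opGen]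
    refine LinearMap.ext fun g => funext fun u => funext fun m => ?_
    simp [opV]
    exact fun h h' => absurd h' h
  | edge_src e =>
    simp only [map_mul, FreeAlgebra.lift_ι_apply, opGen]
    refine LinearMap.ext fun g => funext fun u => funext fun m => ?_
    simp [opV, opE]
    exact fun h h' => absurd h' h
  | edge_rng e =>
    simp only [map_mul, FreeAlgebra.lift_ι_apply, opGen]
    refine LinearMap.ext fun g => funext fun u => funext fun m => ?_
    simp [opV, opE]
  | ghost_rng e =>
    simp only [map_mul, FreeAlgebra.lift_ι_apply, opGen]
    refine LinearMap.ext fun g => funext fun u => funext fun m => ?_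
    simp [opV, opG]
    exact fun h h' => absurd h' h
  | ghost_src e =>
    simp only [map_mul, FreeAlgebra.lift_ι_apply, opGen]
    refine LinearMap.ext fun g => funext fun u => funext fun m => ?_
    simp [opV, opG]
  | ck1_distinct e f h =>
    simp only [map_mul, FreeAlgebra.lift_ι_apply, opGen, map_zero]
    refine LinearMap.ext fun g => funext fun u => funext fun m => ?_
    by_cases hs : s e = s f
    · have : τ f (σ e m) = none := by
        rw [Option.eq_none_iff_forall_ne_some]
        intro n hn
        rw [h3] at hn
        exact h (h1 f e n m hs.symm hn).1.symm
      simp [opG, opE, this]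
    · simp [opG, opE, hs]
  | ck1_same e =>
    simp only [map_mul, FreeAlgebra.lift_ι_apply, opGen]
    refine LinearMap.ext fun g => funext fun u => funext fun m => ?_
    have : τ e (σ e m) = some m := (h3 _ _ _).2 rfl
    by_cases hu : u = r e
    · subst hu; simp [opG, opE, opV, this]
    · simp [opG, opV, hu]
  | ck2 v hfin hne =>
    obtain ⟨e0, rfl⟩ := hne
    simp only [map_mul, map_sum, FreeAlgebra.lift_ι_apply, opGen]
    refine LinearMap.ext fun g => funext fun u => funext fun m => ?_
    rw [LinearMap.sum_apply, Finset.sum_apply, Finset.sum_apply]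
    by_cases hu : u = s e0
    · subst hu
      obtain ⟨e, n, he, rfl⟩ := h2 e0 m
      rw [Finset.sum_eq_single e]
      · have : τ e (σ e n) = some n := (h3 _ _ _).2 rfl
        simp [opG, opE, opV, this, he]
      · intro f hf hfe
        have : τ f (σ e n) = none := by
          rw [Option.eq_none_iff_forall_ne_some]
          intro n' hn
          rw [h3] at hn
          simp at hf
          exact hfe (h1 f e n' n (hf.trans he.symm) hn).1
        simp [opE, this]
      · intro h; simp [he] at h
    · rw [Finset.sum_eq_zero]
      · simp [opV, hu]
      · intro f hf
        simp at hf
        simp [opE, hf, hu]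
  | unit =>
    simp only [map_one, map_sum, FreeAlgebra.lift_ι_apply, opGen]
    refine LinearMap.ext fun g => funext fun u => funext fun m => ?_
    rw [LinearMap.sum_apply, Finset.sum_apply, Finset.sum_apply]
    simp [opV]

lemma vertex_ne_zero (v : V) : gen K V E s r (.vertex v) ≠ 0 := by
  obtain ⟨σ, h1, h2⟩ := exists_split s
  have hinj : ∀ e, Function.Injective (σ e) := fun e n m h => (h1 e e n m rfl h).2
  let τ : E → ℕ → Option ℕ := fun e => Function.partialInv (σ e)
  have h3 : ∀ e m n, τ e m = some n ↔ σ e n = m := fun e m n =>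
    (hinj e).isPartialInv n m
  intro h
  have h4 := congrArg (RingQuot.liftAlgHom K
    ⟨FreeAlgebra.lift K (opGen K s r σ τ), rep_rel K s r σ τ h1 h2 h3⟩) h
  rw [map_zero, gen, RingQuot.liftAlgHom_mkAlgHom_apply, FreeAlgebra.lift_ι_apply] at h4
  have h5 := congrFun (congrFun (LinearMap.congr_fun h4 (fun _ _ => 1)) v) 0
  simp [opGen, opV] at h5

end rep

end algebra

end LPAProof

/-- For a finite directed graph `E` and a field `K`, no cycle in `E` has
an exit if and only if the Leavitt path algebra `L = L_K(E)` is finite over its center: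
there are finitely many elements `f 0, …, f (n-1)` of `L` such that every `x ∈ L` is a
combination `x = ∑ i, c i * f i` with all `c i` in the center `Z(L)`. -/
theorem lpa_noExitCycles_iff_finiteOverCenter (K V E : Type) [Field K] [Fintype V]
    [Fintype E] (s r : E → V) :
    (∀ es : List E, IsCycle s r es → ¬ HasExit s r es) ↔
      ∃ (n : ℕ) (f : Fin n → LeavittPathAlgebra K V E s r),
        ∀ x : LeavittPathAlgebra K V E s r,
          ∃ c : Fin n → LeavittPathAlgebra K V E s r,
            (∀ i, c i ∈ Subring.center (LeavittPathAlgebra K V E s r)) ∧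
            x = ∑ i, c i * f i := by
  have hiff : (∀ es : List E, IsCycle s r es → ¬ HasExit s r es) ↔
      Module.Finite (Subring.center (LeavittPathAlgebra K V E s r))
        (LeavittPathAlgebra K V E s r) := by
    constructor
    · intro h
      exact LPAProof.finite_of_ne K V E s r (LPAProof.ne_of_noExit h)
    · intro h
      exact LPAProof.noExit_of_ne
        ((LPAProof.fam K V E s r).ne_of_finite (LPAProof.vertex_ne_zero K s r))
  rw [hiff]
  constructor
  · intro h
    obtain ⟨n, f, hf⟩ := Module.Finite.exists_fin
      (R := Subring.center (LeavittPathAlgebra K V E s r)) (M := LeavittPathAlgebra K V E s r)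
    refine ⟨n, f, fun x => ?_⟩
    have hx : x ∈ Submodule.span (Subring.center (LeavittPathAlgebra K V E s r))
      (Set.range f) := by rw [hf]; trivial
    obtain ⟨c, hc⟩ := (Submodule.mem_span_range_iff_exists_fun _).1 hx
    exact ⟨fun i => (c i : LeavittPathAlgebra K V E s r), fun i => (c i).2, hc.symm⟩
  · rintro ⟨n, f, hf⟩
    refine Module.Finite.of_surjective (Fintype.linearCombination
      (Subring.center (LeavittPathAlgebra K V E s r)) f) ?_
    intro x
    obtain ⟨c, hc, rfl⟩ := hf x
    exact ⟨fun i => ⟨c i, hc i⟩, by rw [Fintype.linearCombination_apply]; rfl⟩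
end
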